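/- Let (a_n)_{n≥1} be a strictly increasing sequence of distinct positive real numbers such that inf_{1≤m≠n≤N} |a_m − a_n| ≥ 1 for all N ∈ ℕ. Then for almost all α ∈ [0,1], the inequality ⌊δ_min^α⌋(N) ≤ 3·log₂ B_N / (H_N · log(N/4) · log₂(N/4)) holds for infinitely many N, where B_N = max_{1≤m≠n≤N} ⌊|a_m − a_n|⌋. -/

import Mathlib

open MeasureTheory Filter

/-- Distance from a real number to the nearest integer. -/
noncomputable def nint (x : ℝ) : ℝ := |x - round x|

/-- `floorDeltaMin a α N = min { ‖α ⌊|a_m − a_n|⌋‖ : 1 ≤ m ≠ n ≤ N }`. -/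
noncomputable def floorDeltaMin (a : ℕ → ℝ) (α : ℝ) (N : ℕ) : ℝ :=
  sInf {d : ℝ | ∃ m n : ℕ, 1 ≤ m ∧ m ≤ N ∧ 1 ≤ n ∧ n ≤ N ∧ m ≠ n ∧
    d = nint (α * (⌊|a m - a n|⌋ : ℝ))}

/-- `Hcard a N` is the number of distinct floored positive differences
`#{ ⌊|a_m − a_n|⌋ : 1 ≤ m ≠ n ≤ N }`. -/
noncomputable def Hcard (a : ℕ → ℝ) (N : ℕ) : ℕ :=
  Set.ncard {k : ℤ | ∃ m n : ℕ, 1 ≤ m ∧ m ≤ N ∧ 1 ≤ n ∧ n ≤ N ∧ m ≠ n ∧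
    k = ⌊|a m - a n|⌋}

/-- `Log x = max (1, log x)`. -/
noncomputable def Log (x : ℝ) : ℝ := max 1 (Real.log x)

/-- Iterated logarithm `log₂ x = Log (Log x)`. -/
noncomputable def Log2 (x : ℝ) : ℝ := Log (Log x)

/-- The local kernel at a prime `p`, with `β = p ^ (-1 / 8)` and `lam = (1 - 1 / p) ^ (1 / 4)`. -/
noncomputable def primeKernel (β lam : ℝ) (i j : ℕ) : ℝ :=
  lam ^ ((if i = 0 then 0 else 1) + (if j = 0 then 0 else 1)) * β ^ (2 * Nat.dist i j) *
    (if i = j then 1 else 1 + β ^ 4)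

lemma primeKernel_nonneg {β lam : ℝ} (hβ : 0 ≤ β) (hl : 0 ≤ lam) (i j : ℕ) :
    0 ≤ primeKernel β lam i j := by
  unfold primeKernel
  split_ifs <;> positivity

lemma primeKernel_le {β lam : ℝ} (hβ : 0 ≤ β) (hl : 0 ≤ lam) (hl1 : lam ≤ 1) (i j : ℕ) :
    primeKernel β lam i j ≤ (1 + β ^ 4) * (β ^ 2) ^ Nat.dist i j := by
  unfold primeKernel
  rw [← pow_mul]
  have h1 : lam ^ ((if i = 0 then 0 else 1) + (if j = 0 then 0 else 1)) ≤ 1 := pow_le_one₀ hl hl1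
  have h2 : (if i = j then (1:ℝ) else 1 + β ^ 4) ≤ 1 + β ^ 4 := by
    split_ifs
    · linarith [pow_nonneg hβ 4]
    · exact le_rfl
  have h3 : 0 ≤ (if i = j then (1:ℝ) else 1 + β ^ 4) := by split_ifs <;> positivity
  calc _ ≤ 1 * β ^ (2 * Nat.dist i j) * (1 + β ^ 4) := by gcongr
    _ = _ := by ring

lemma primeKernel_self {β lam : ℝ} (k : ℕ) :
    primeKernel β lam k k = if k = 0 then 1 else lam ^ 2 := by
  unfold primeKernel
  rw [if_pos rfl]
  split_ifs <;> simp

/-- Geometric sums in the distance to a fixed index. -/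
lemma sum_pow_dist_le {r : ℝ} (hr : 0 ≤ r) (hr1 : r < 1) (n i : ℕ) :
    ∑ j ∈ (Finset.range n).filter (· < i), r ^ Nat.dist j i ≤ r / (1 - r) ∧
    ∑ j ∈ (Finset.range n).filter (i < ·), r ^ Nat.dist j i ≤ r / (1 - r) := by
  have hs : Summable fun d : ℕ => r ^ (d + 1) := by
    simpa [pow_succ] using (summable_geometric_of_lt_one hr hr1).mul_right r
  have ht : ∑' d : ℕ, r ^ (d + 1) = r / (1 - r) := by
    simp only [pow_succ]
    rw [tsum_mul_right, tsum_geometric_of_lt_one hr hr1]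
    field_simp
  constructor
  · rw [← ht]
    calc _ = ∑ d ∈ ((Finset.range n).filter (· < i)).image (fun j => i - 1 - j), r ^ (d + 1) := by
          rw [Finset.sum_image]
          · refine Finset.sum_congr rfl fun j hj => ?_
            simp only [Finset.mem_filter] at hj
            congr 1
            unfold Nat.dist
            omega
          · intro a ha b hb hab
            simp only [Finset.mem_coe, Finset.mem_filter] at ha hb
            dsimp only at hab
            omega
      _ ≤ _ := hs.sum_le_tsum _ fun d _ => by positivity
  · rw [← ht]
    calc _ = ∑ d ∈ ((Finset.range n).filter (i < ·)).image (fun j => j - 1 - i), r ^ (d + 1) := by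
          rw [Finset.sum_image]
          · refine Finset.sum_congr rfl fun j hj => ?_
            simp only [Finset.mem_filter] at hj
            congr 1
            unfold Nat.dist
            omega
          · intro a ha b hb hab
            simp only [Finset.mem_coe, Finset.mem_filter] at ha hb
            dsimp only at hab
            omega
      _ ≤ _ := hs.sum_le_tsum _ fun d _ => by positivity

lemma sum_ne_pow_dist_le {r : ℝ} (hr : 0 ≤ r) (hr1 : r < 1) (n i : ℕ) :
    ∑ j ∈ Finset.range n, (if j = i then 0 else r ^ Nat.dist j i) ≤ 2 * (r / (1 - r)) := by
  have h := sum_pow_dist_le hr hr1 n i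
  rw [Finset.sum_filter, Finset.sum_filter] at h
  have : ∑ j ∈ Finset.range n, (if j = i then 0 else r ^ Nat.dist j i) =
      ∑ j ∈ Finset.range n, (if j < i then r ^ Nat.dist j i else 0) +
      ∑ j ∈ Finset.range n, (if i < j then r ^ Nat.dist j i else 0) := by
    rw [← Finset.sum_add_distrib]
    refine Finset.sum_congr rfl fun j _ => ?_
    rcases lt_trichotomy j i with h | h | h
    · simp [h, h.ne, h.le.not_gt]
    · simp [h]
    · simp [h, h.ne', h.le.not_gt]
  linarith [h.1, h.2]

/-- Schur test for the kernel `r ^ |i - j|` off the diagonal. -/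
lemma schur_offdiag {r : ℝ} (hr : 0 ≤ r) (hr1 : r < 1) (n : ℕ) (u v : ℕ → ℝ) :
    ∑ i ∈ Finset.range n, ∑ j ∈ Finset.range n,
      (if i = j then 0 else r ^ Nat.dist i j) * (u i * v j) ≤
    r / (1 - r) * (∑ i ∈ Finset.range n, u i ^ 2 + ∑ i ∈ Finset.range n, v i ^ 2) := by
  have key : ∀ i j : ℕ, (if i = j then 0 else r ^ Nat.dist i j) * (u i * v j) ≤
      (if j = i then 0 else r ^ Nat.dist j i) * (u i ^ 2 / 2) +
      (if i = j then 0 else r ^ Nat.dist i j) * (v j ^ 2 / 2) := by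
    intro i j
    by_cases h : i = j
    · simp [h]
    · simp only [h, Ne.symm h, if_false, Nat.dist_comm j i]
      rw [← mul_add]
      exact mul_le_mul_of_nonneg_left (by nlinarith [sq_nonneg (u i - v j)]) (by positivity)
  calc _ ≤ ∑ i ∈ Finset.range n, ∑ j ∈ Finset.range n,
        ((if j = i then 0 else r ^ Nat.dist j i) * (u i ^ 2 / 2) +
      (if i = j then 0 else r ^ Nat.dist i j) * (v j ^ 2 / 2)) :=
        Finset.sum_le_sum fun i _ => Finset.sum_le_sum fun j _ => key i j
    _ = ∑ i ∈ Finset.range n, (∑ j ∈ Finset.range n, if j = i then 0 else r ^ Nat.dist j i) *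
          (u i ^ 2 / 2) +
        ∑ j ∈ Finset.range n, (∑ i ∈ Finset.range n, if i = j then 0 else r ^ Nat.dist i j) *
          (v j ^ 2 / 2) := by
        simp only [Finset.sum_add_distrib]
        congr 1
        · simp only [Finset.sum_mul]
        · rw [Finset.sum_comm]
          simp only [Finset.sum_mul]
    _ ≤ ∑ i ∈ Finset.range n, (2 * (r / (1 - r))) * (u i ^ 2 / 2) +
        ∑ j ∈ Finset.range n, (2 * (r / (1 - r))) * (v j ^ 2 / 2) := by
        gcongr with i _ i _ <;> exact sum_ne_pow_dist_le hr hr1 n i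
    _ = _ := by
        rw [← Finset.mul_sum, ← Finset.mul_sum, ← Finset.sum_div, ← Finset.sum_div]
        ring

lemma schur_full {r : ℝ} (hr : 0 ≤ r) (hr1 : r < 1) (n : ℕ) (u v : ℕ → ℝ) :
    ∑ i ∈ Finset.range n, ∑ j ∈ Finset.range n, r ^ Nat.dist i j * (u i * v j) ≤
    (1 / 2 + r / (1 - r)) * (∑ i ∈ Finset.range n, u i ^ 2 + ∑ i ∈ Finset.range n, v i ^ 2) := by
  have h := schur_offdiag hr hr1 n u v
  have e : ∑ i ∈ Finset.range n, ∑ j ∈ Finset.range n, r ^ Nat.dist i j * (u i * v j) =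
      ∑ i ∈ Finset.range n, ∑ j ∈ Finset.range n,
        (if i = j then 0 else r ^ Nat.dist i j) * (u i * v j) +
        ∑ i ∈ Finset.range n, u i * v i := by
    rw [← Finset.sum_add_distrib]
    refine Finset.sum_congr rfl fun i hi => ?_
    have : ∑ j ∈ Finset.range n, (if i = j then u i * v j else 0) = u i * v i := by
      rw [Finset.sum_ite_eq]
      simp [Finset.mem_range.1 hi]
    rw [← this, ← Finset.sum_add_distrib]
    refine Finset.sum_congr rfl fun j _ => ?_
    by_cases h : i = j
    · simp [h, Nat.dist_self]
    · simp [h]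
  have d : ∑ i ∈ Finset.range n, u i * v i ≤
      1 / 2 * (∑ i ∈ Finset.range n, u i ^ 2 + ∑ i ∈ Finset.range n, v i ^ 2) := by
    rw [← Finset.sum_add_distrib, Finset.mul_sum]
    exact Finset.sum_le_sum fun i _ => by nlinarith [sq_nonneg (u i - v i)]
  rw [e, add_mul]
  linarith

lemma sum_pow_six_le {s : Finset ℕ} {x : ℕ → ℝ} {θ : ℝ} (hθ : 0 ≤ θ)
    (h : ∑ i ∈ s, x i ^ 4 ≤ θ ^ 2) : ∑ i ∈ s, x i ^ 6 ≤ θ * ∑ i ∈ s, x i ^ 4 := by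
  rw [Finset.mul_sum]
  refine Finset.sum_le_sum fun i hi => ?_
  have h4 : x i ^ 4 ≤ θ ^ 2 :=
    (Finset.single_le_sum (f := fun i => x i ^ 4) (fun i _ => by positivity) hi).trans h
  have h2 : x i ^ 2 ≤ θ := by
    have : (x i ^ 2) ^ 2 ≤ θ ^ 2 := by rw [← pow_mul]; exact h4
    exact le_of_sq_le_sq this hθ
  calc x i ^ 6 = x i ^ 2 * x i ^ 4 := by ring
    _ ≤ _ := by gcongr

lemma young_sharp (a x : ℝ) : a * x ^ 3 ≤ 3 / 4 * x ^ 4 + 1 / 4 * a ^ 4 := by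
  nlinarith [mul_nonneg (sq_nonneg (x - a)) (sq_nonneg (x + a)), sq_nonneg (x ^ 2 - x * a),
    sq_nonneg (x * a - a ^ 2), sq_nonneg (x ^ 2 - a ^ 2), sq_nonneg ((x - a) * (x + a)),
    sq_nonneg (x * (x - a)), sq_nonneg (a * (x - a))]

lemma young_quarter (a x : ℝ) : a * x ^ 3 ≤ 1 / 4 * x ^ 4 + 7 * a ^ 4 := by
  nlinarith [sq_nonneg (x ^ 2 - 3 * x * a), sq_nonneg (x * a - 3 * a ^ 2),
    sq_nonneg (x * (x - 3 * a)), sq_nonneg (a * (x - 3 * a)),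
    sq_nonneg (x ^ 2 - 2 * x * a - 3 * a ^ 2), sq_nonneg (a ^ 2)]

lemma one_add_pow_four_le {β : ℝ} (h0 : 0 ≤ β) (h1 : β ≤ 1 / 1000) :
    (1 + β ^ 4) ^ 4 * (β ^ 8 / (1 - β ^ 8)) ≤ β ^ 8 + β ^ 9 := by
  have h3 : β ^ 4 ≤ β * (1 / 1000) ^ 3 := by
    calc β ^ 4 = β * β ^ 3 := by ring
      _ ≤ _ := by gcongr
  have h8 : β ^ 8 ≤ β * (1 / 1000) ^ 7 := by
    calc β ^ 8 = β * β ^ 7 := by ring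
      _ ≤ _ := by gcongr
  have hd : 0 < 1 - β ^ 8 := by nlinarith
  have h4 : (1 + β ^ 4) ^ 4 ≤ 1 + β / 2 := by
    have : β ^ 4 ≤ β / 100 := by nlinarith
    calc (1 + β ^ 4) ^ 4 ≤ (1 + β / 100) ^ 4 := by gcongr
      _ ≤ 1 + β / 2 := by
          nlinarith [pow_nonneg h0 2, pow_nonneg h0 3, mul_nonneg h0 h0]
  rw [← mul_div_assoc, div_le_iff₀ hd]
  have : (1 + β ^ 4) ^ 4 ≤ (1 + β) * (1 - β ^ 8) := by nlinarith
  calc (1 + β ^ 4) ^ 4 * β ^ 8 ≤ ((1 + β) * (1 - β ^ 8)) * β ^ 8 := by gcongr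
    _ = _ := by ring

/-- Sharp bound for the contribution of one row on one side of the dominant index. -/
lemma row_side_sharp {β : ℝ} (h0 : 0 ≤ β) (h1 : β ≤ 1 / 1000) (n k : ℕ) (x : ℕ → ℝ) :
    ∑ i ∈ (Finset.range n).filter (· < k), (1 + β ^ 4) * (β ^ 2) ^ Nat.dist i k * x i ^ 3 ≤
      3 / 4 * ∑ i ∈ (Finset.range n).filter (· < k), x i ^ 4 + 1 / 4 * (β ^ 8 + β ^ 9) := by
  have hr : β ^ 8 < 1 := pow_lt_one₀ h0 (by linarith) (by norm_num)
  calc _ ≤ ∑ i ∈ (Finset.range n).filter (· < k), (3 / 4 * x i ^ 4 +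
        1 / 4 * ((1 + β ^ 4) * (β ^ 2) ^ Nat.dist i k) ^ 4) :=
        Finset.sum_le_sum fun i _ => young_sharp _ _
    _ = 3 / 4 * ∑ i ∈ (Finset.range n).filter (· < k), x i ^ 4 + 1 / 4 * ((1 + β ^ 4) ^ 4 *
        ∑ i ∈ (Finset.range n).filter (· < k), (β ^ 8) ^ Nat.dist i k) := by
        rw [Finset.sum_add_distrib, Finset.mul_sum, Finset.mul_sum, Finset.mul_sum]
        congr 1
        refine Finset.sum_congr rfl fun i _ => ?_
        rw [mul_pow, ← pow_mul, ← pow_mul, ← pow_mul]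
        ring_nf
    _ ≤ _ := by
        have := (sum_pow_dist_le (by positivity) hr n k).1
        have h4 := one_add_pow_four_le h0 h1
        have : (1 + β ^ 4) ^ 4 * ∑ i ∈ (Finset.range n).filter (· < k), (β ^ 8) ^ Nat.dist i k ≤
          (1 + β ^ 4) ^ 4 * (β ^ 8 / (1 - β ^ 8)) := by gcongr
        linarith

/-- Cruder bound for the contribution of one row outside the dominant index. -/
lemma row_crude {β : ℝ} (h0 : 0 ≤ β) (h1 : β ≤ 1 / 1000) (n k : ℕ) (x : ℕ → ℝ)
    {s : Finset ℕ} (hs : s ⊆ (Finset.range n).filter (· ≠ k)) :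
    ∑ i ∈ s, 2 * (β ^ 2) ^ Nat.dist i k * x i ^ 3 ≤
      1 / 4 * ∑ i ∈ s, x i ^ 4 + 448 * β ^ 8 := by
  have hr : β ^ 8 < 1 := pow_lt_one₀ h0 (by linarith) (by norm_num)
  have h8 : β ^ 8 ≤ 1 / 2 := by
    calc β ^ 8 ≤ (1 / 1000) ^ 8 := by gcongr
      _ ≤ _ := by norm_num
  calc _ ≤ ∑ i ∈ s, (1 / 4 * x i ^ 4 + 7 * (2 * (β ^ 2) ^ Nat.dist i k) ^ 4) :=
        Finset.sum_le_sum fun i _ => young_quarter _ _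
    _ = 1 / 4 * ∑ i ∈ s, x i ^ 4 + 112 * ∑ i ∈ s, (β ^ 8) ^ Nat.dist i k := by
        rw [Finset.sum_add_distrib, Finset.mul_sum, Finset.mul_sum]
        congr 1
        refine Finset.sum_congr rfl fun i _ => ?_
        rw [mul_pow, ← pow_mul, ← pow_mul, ← pow_mul]
        ring_nf
    _ ≤ _ := by
        have h := sum_ne_pow_dist_le (r := β ^ 8) (by positivity) hr n k
        have h' : ∑ i ∈ s, (β ^ 8) ^ Nat.dist i k ≤
            ∑ j ∈ Finset.range n, (if j = k then 0 else (β ^ 8) ^ Nat.dist j k) := by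
          calc _ ≤ ∑ i ∈ (Finset.range n).filter (· ≠ k), (β ^ 8) ^ Nat.dist i k :=
                Finset.sum_le_sum_of_subset_of_nonneg hs fun i _ _ => by positivity
            _ = _ := by
                rw [Finset.sum_filter]
                exact Finset.sum_congr rfl fun i _ => by by_cases h : i = k <;> simp [h]
        have h2 : β ^ 8 / (1 - β ^ 8) ≤ 2 * β ^ 8 := by
          rw [div_le_iff₀ (by linarith)]
          nlinarith [pow_nonneg h0 8]
        linarith

/-- The total one-sided cost of mass placed below the dominant index. -/
lemma side_cost {β : ℝ} (h0 : 0 ≤ β) (h1 : β ≤ 1 / 1000) (n k : ℕ) (x : ℕ → ℝ)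
    (he : ∑ i ∈ (Finset.range n).filter (· < k), x i ^ 4 ≤ β ^ 6) :
    -(3 / 4) * ∑ i ∈ (Finset.range n).filter (· < k), x i ^ 4 +
      ∑ i ∈ (Finset.range n).filter (· < k), (1 + β ^ 4) * (β ^ 2) ^ Nat.dist i k * x i ^ 3 +
      3 * ∑ i ∈ (Finset.range n).filter (· < k), x i ^ 6 +
      1 / 2 * (∑ i ∈ (Finset.range n).filter (· < k), x i ^ 4) ^ 2 +
      β ^ 8 * ∑ i ∈ (Finset.range n).filter (· < k), x i ^ 4 ≤ 1 / 4 * β ^ 8 + 5 * β ^ 9 := by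
  have hsharp := row_side_sharp h0 h1 n k x
  have hM := sum_pow_six_le (s := (Finset.range n).filter (· < k)) (x := x)
    (θ := β ^ 3) (by positivity) (by rw [← pow_mul]; exact he)
  set e := ∑ i ∈ (Finset.range n).filter (· < k), x i ^ 4
  set M := ∑ i ∈ (Finset.range n).filter (· < k), x i ^ 6
  have e0 : 0 ≤ e := Finset.sum_nonneg fun i _ => by positivity
  have b9' := pow_nonneg h0 9
  have hM' : M ≤ β ^ 9 := hM.trans (by
    calc β ^ 3 * e ≤ β ^ 3 * β ^ 6 := by gcongr
      _ = _ := by ring)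
  have he2 : e ^ 2 ≤ β ^ 9 := by
    calc e ^ 2 ≤ (β ^ 6) ^ 2 := by gcongr
      _ = β ^ 9 * β ^ 3 := by ring
      _ ≤ β ^ 9 * 1 := by gcongr; exact pow_le_one₀ h0 (by linarith)
      _ = _ := by ring
  have he3 : β ^ 8 * e ≤ β ^ 9 := by
    calc β ^ 8 * e ≤ β ^ 8 * β ^ 6 := by gcongr
      _ = β ^ 9 * β ^ 5 := by ring
      _ ≤ β ^ 9 * 1 := by gcongr; exact pow_le_one₀ h0 (by linarith)
      _ = _ := by ring
  linarith

/-- The total cost of mass outside the dominant index, when no merging is used. -/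
lemma full_cost {β : ℝ} (h0 : 0 ≤ β) (h1 : β ≤ 1 / 1000) (n k : ℕ) (x : ℕ → ℝ)
    (he : ∑ i ∈ (Finset.range n).filter (· ≠ k), x i ^ 4 ≤ 32 * β ^ 2) :
    -(3 / 4) * ∑ i ∈ (Finset.range n).filter (· ≠ k), x i ^ 4 +
      ∑ i ∈ (Finset.range n).filter (· ≠ k), 2 * (β ^ 2) ^ Nat.dist i k * x i ^ 3 +
      3 * ∑ i ∈ (Finset.range n).filter (· ≠ k), x i ^ 6 +
      1 / 2 * (∑ i ∈ (Finset.range n).filter (· ≠ k), x i ^ 4) ^ 2 ≤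
    448 * β ^ 8 - 1 / 4 * ∑ i ∈ (Finset.range n).filter (· ≠ k), x i ^ 4 := by
  have hcrude := row_crude h0 h1 n k x (subset_refl _)
  have hθ1 := fun h => sum_pow_six_le (s := (Finset.range n).filter (· ≠ k)) (x := x)
    (θ := 6 * β) (by positivity) h
  set e := ∑ i ∈ (Finset.range n).filter (· ≠ k), x i ^ 4
  have e0 : 0 ≤ e := Finset.sum_nonneg fun i _ => by positivity
  have hθ1 := hθ1 (by nlinarith)
  have b2 : β ^ 2 ≤ 1 / 1000000 := by
    calc β ^ 2 ≤ (1 / 1000) ^ 2 := by gcongr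
      _ ≤ _ := by norm_num
  have he2 : e ^ 2 ≤ 1 / 100 * e := by
    rw [pow_two]
    gcongr
    linarith
  have he4 : β * e ≤ 1 / 1000 * e := by gcongr
  linarith

lemma off_both_le {β lam : ℝ} (h0 : 0 ≤ β) (h1 : β ≤ 1 / 1000) (hl : 0 ≤ lam) (hl1 : lam ≤ 1)
    (n k : ℕ) (x y : ℕ → ℝ) (hx : ∀ i, 0 ≤ x i) (hy : ∀ i, 0 ≤ y i) :
    ∑ i ∈ Finset.range n, ∑ j ∈ Finset.range n,
      (if i = k ∨ j = k then 0 else primeKernel β lam i j * (x i ^ 3 * y j ^ 3)) ≤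
    3 * (∑ i ∈ (Finset.range n).filter (· ≠ k), x i ^ 6 +
      ∑ i ∈ (Finset.range n).filter (· ≠ k), y i ^ 6) := by
  have b2 : β ^ 2 ≤ 1 / 1000000 := by
    calc β ^ 2 ≤ (1 / 1000) ^ 2 := by gcongr
      _ ≤ _ := by norm_num
  have b4 : β ^ 4 ≤ 1 / 2 := by
    calc β ^ 4 ≤ (1 / 1000) ^ 4 := by gcongr
      _ ≤ _ := by norm_num
  have hs := schur_full (r := β ^ 2) (by positivity) (by linarith) n
    (fun i => if i = k then 0 else x i ^ 3) (fun i => if i = k then 0 else y i ^ 3)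
  have e : ∀ z : ℕ → ℝ, ∑ i ∈ Finset.range n, (if i = k then 0 else z i ^ 3) ^ 2 =
      ∑ i ∈ (Finset.range n).filter (· ≠ k), z i ^ 6 := by
    intro z
    rw [Finset.sum_filter]
    refine Finset.sum_congr rfl fun i _ => ?_
    by_cases h : i = k
    · simp [h]
    · simp only [h, if_false, ne_eq, not_false_eq_true, if_true]
      ring
  rw [e, e] at hs
  have hr : β ^ 2 / (1 - β ^ 2) ≤ 1 / 2 := by
    rw [div_le_iff₀ (by linarith)]
    linarith
  have hM : 0 ≤ ∑ i ∈ (Finset.range n).filter (· ≠ k), x i ^ 6 +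
      ∑ i ∈ (Finset.range n).filter (· ≠ k), y i ^ 6 :=
    add_nonneg (Finset.sum_nonneg fun i _ => by positivity)
      (Finset.sum_nonneg fun i _ => by positivity)
  calc _ ≤ ∑ i ∈ Finset.range n, ∑ j ∈ Finset.range n, (1 + β ^ 4) *
        ((β ^ 2) ^ Nat.dist i j *
          ((if i = k then 0 else x i ^ 3) * (if j = k then 0 else y j ^ 3))) := by
        refine Finset.sum_le_sum fun i _ => Finset.sum_le_sum fun j _ => ?_
        have := hx i
        have := hy j
        by_cases hi : i = k
        · simp [hi]
        by_cases hj : j = k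
        · simp [hj]
        simp only [hi, hj, or_self, if_false]
        rw [← mul_assoc (1 + β ^ 4)]
        exact mul_le_mul_of_nonneg_right (primeKernel_le h0 hl hl1 i j) (by positivity)
    _ ≤ (1 + β ^ 4) * ((1 / 2 + β ^ 2 / (1 - β ^ 2)) *
        (∑ i ∈ (Finset.range n).filter (· ≠ k), x i ^ 6 +
          ∑ i ∈ (Finset.range n).filter (· ≠ k), y i ^ 6)) := by
        simp only [← Finset.mul_sum] at hs ⊢
        gcongr
    _ ≤ _ := by
        rw [← mul_assoc]
        gcongr
        nlinarith [pow_nonneg h0 4, div_nonneg (pow_nonneg h0 2) (by linarith : 0 ≤ 1 - β ^ 2)]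

lemma pow_three_le_of_pow_four {x e : ℝ} (h : x ^ 4 ≤ 1 - e) :
    x ^ 3 ≤ 1 - 3 / 4 * e := by
  have := young_sharp 1 x
  linarith

lemma sum_filter_ne_eq (n k : ℕ) (f : ℕ → ℝ) :
    ∑ i ∈ (Finset.range n).filter (· ≠ k), f i =
      ∑ i ∈ (Finset.range n).filter (· < k), f i + ∑ i ∈ (Finset.range n).filter (k < ·), f i := by
  rw [Finset.sum_filter, Finset.sum_filter, Finset.sum_filter, ← Finset.sum_add_distrib]
  refine Finset.sum_congr rfl fun i _ => ?_
  rcases lt_trichotomy i k with h | h | h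
  · simp [h, h.ne, h.le.not_gt]
  · simp [h]
  · simp [h, h.ne', h.le.not_gt]

lemma sum_eq_add_filter_ne {n k : ℕ} (hk : k < n) (f : ℕ → ℝ) :
    ∑ i ∈ Finset.range n, f i = f k + ∑ i ∈ (Finset.range n).filter (· ≠ k), f i := by
  rw [Finset.filter_ne', Finset.add_sum_erase _ _ (Finset.mem_range.2 hk)]

/-- When a fair amount of mass sits away from the dominant index, the plain bilinear form is
already small. -/
lemma kernel_case_plain {β lam : ℝ} (h0 : 0 ≤ β) (h1 : β ≤ 1 / 1000) (hl : 0 ≤ lam)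
    (hl1 : lam ≤ 1) {n k : ℕ} (hk : k < n) (x y : ℕ → ℝ) (hx : ∀ i, 0 ≤ x i) (hy : ∀ i, 0 ≤ y i)
    (sx : ∑ i ∈ Finset.range n, x i ^ 4 = 1) (sy : ∑ i ∈ Finset.range n, y i ^ 4 = 1)
    (ex : ∑ i ∈ (Finset.range n).filter (· ≠ k), x i ^ 4 ≤ 32 * β ^ 2)
    (ey : ∑ i ∈ (Finset.range n).filter (· ≠ k), y i ^ 4 ≤ 32 * β ^ 2)
    (hb : β ^ 6 ≤ ∑ i ∈ (Finset.range n).filter (· ≠ k), x i ^ 4 +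
      ∑ i ∈ (Finset.range n).filter (· ≠ k), y i ^ 4) :
    ∑ i ∈ Finset.range n, ∑ j ∈ Finset.range n, primeKernel β lam i j * (x i ^ 3 * y j ^ 3) ≤
      1 := by
  have hoff := off_both_le h0 h1 hl hl1 n k x y hx hy
  have fx := full_cost h0 h1 n k x ex
  have fy := full_cost h0 h1 n k y ey
  have sx' := sum_eq_add_filter_ne hk fun i => x i ^ 4
  have sy' := sum_eq_add_filter_ne hk fun i => y i ^ 4
  rw [sx] at sx'
  rw [sy] at sy'
  have b2 : β ^ 2 ≤ 1 / 1000000 := by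
    calc β ^ 2 ≤ (1 / 1000) ^ 2 := by gcongr
      _ ≤ _ := by norm_num
  have b4 : β ^ 4 ≤ 1 := pow_le_one₀ h0 (by linarith)
  have pt : ∀ i j, primeKernel β lam i j * (x i ^ 3 * y j ^ 3) ≤
      (if i = k ∨ j = k then 0 else primeKernel β lam i j * (x i ^ 3 * y j ^ 3)) +
      (if j = k then (if i ≠ k then 2 * (β ^ 2) ^ Nat.dist i k * x i ^ 3 else 0) else 0) +
      (if i = k then (if j ≠ k then 2 * (β ^ 2) ^ Nat.dist j k * y j ^ 3 else 0) else 0) +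
      (if j = k then (if i = k then x k ^ 3 * y k ^ 3 else 0) else 0) := by
    intro i j
    have hxi := hx i
    have hyj := hy j
    have xk1 : x k ^ 3 ≤ 1 := pow_le_one₀ (hx k) (by
      refine le_of_not_gt fun h => ?_
      have := one_lt_pow₀ h (n := 4) (by norm_num)
      have : 0 ≤ ∑ i ∈ (Finset.range n).filter (· ≠ k), x i ^ 4 :=
        Finset.sum_nonneg fun i _ => by positivity
      linarith)
    have yk1 : y k ^ 3 ≤ 1 := pow_le_one₀ (hy k) (by
      refine le_of_not_gt fun h => ?_
      have := one_lt_pow₀ h (n := 4) (by norm_num)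
      have : 0 ≤ ∑ i ∈ (Finset.range n).filter (· ≠ k), y i ^ 4 :=
        Finset.sum_nonneg fun i _ => by positivity
      linarith)
    have hker := primeKernel_le h0 hl hl1 i j
    have hker0 := primeKernel_nonneg h0 hl i j
    by_cases hi : i = k <;> by_cases hj : j = k
    · subst hi; subst hj
      have hself : primeKernel β lam j j ≤ 1 := by
        rw [primeKernel_self]
        split_ifs
        · exact le_rfl
        · exact pow_le_one₀ hl hl1
      have : 0 ≤ x j ^ 3 * y j ^ 3 := by positivity
      simp
      nlinarith
    · subst hi
      simp only [hj, or_false, if_true, if_false, ne_eq, not_false_eq_true, zero_add, add_zero]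
      rw [Nat.dist_comm j i]
      calc primeKernel β lam i j * (x i ^ 3 * y j ^ 3)
          ≤ ((1 + β ^ 4) * (β ^ 2) ^ Nat.dist i j) * (1 * y j ^ 3) := by gcongr
        _ ≤ (2 * (β ^ 2) ^ Nat.dist i j) * (1 * y j ^ 3) := by gcongr; linarith
        _ = _ := by ring
    · subst hj
      simp only [hi, or_true, if_true, if_false, ne_eq, not_false_eq_true, zero_add, add_zero]
      calc primeKernel β lam i j * (x i ^ 3 * y j ^ 3)
          ≤ ((1 + β ^ 4) * (β ^ 2) ^ Nat.dist i j) * (x i ^ 3 * 1) := by gcongr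
        _ ≤ (2 * (β ^ 2) ^ Nat.dist i j) * (x i ^ 3 * 1) := by gcongr; linarith
        _ = _ := by ring
    · simp [hi, hj]
  have tot := Finset.sum_le_sum fun i (_ : i ∈ Finset.range n) =>
    Finset.sum_le_sum fun j (_ : j ∈ Finset.range n) => pt i j
  simp only [Finset.sum_add_distrib] at tot
  have t2 : ∑ i ∈ Finset.range n, ∑ j ∈ Finset.range n,
      (if j = k then (if i ≠ k then 2 * (β ^ 2) ^ Nat.dist i k * x i ^ 3 else 0) else 0) =
      ∑ i ∈ (Finset.range n).filter (· ≠ k), 2 * (β ^ 2) ^ Nat.dist i k * x i ^ 3 := by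
    simp only [Finset.sum_ite_eq', Finset.mem_range.2 hk, if_true]
    rw [Finset.sum_filter]
  have t3 : ∑ i ∈ Finset.range n, ∑ j ∈ Finset.range n,
      (if i = k then (if j ≠ k then 2 * (β ^ 2) ^ Nat.dist j k * y j ^ 3 else 0) else 0) =
      ∑ i ∈ (Finset.range n).filter (· ≠ k), 2 * (β ^ 2) ^ Nat.dist i k * y i ^ 3 := by
    rw [Finset.sum_comm]
    simp only [Finset.sum_ite_eq', Finset.mem_range.2 hk, if_true]
    rw [Finset.sum_filter]
  have t4 : ∑ i ∈ Finset.range n, ∑ j ∈ Finset.range n,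
      (if j = k then (if i = k then x k ^ 3 * y k ^ 3 else 0) else 0) = x k ^ 3 * y k ^ 3 := by
    simp only [Finset.sum_ite_eq', Finset.mem_range.2 hk, if_true]
  rw [t2, t3, t4] at tot
  have zx := pow_three_le_of_pow_four (x := x k)
    (e := ∑ i ∈ (Finset.range n).filter (· ≠ k), x i ^ 4)
    (by linarith)
  have zy := pow_three_le_of_pow_four (x := y k)
    (e := ∑ i ∈ (Finset.range n).filter (· ≠ k), y i ^ 4)
    (by linarith)
  have ex0 : 0 ≤ ∑ i ∈ (Finset.range n).filter (· ≠ k), x i ^ 4 :=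
    Finset.sum_nonneg fun i _ => by positivity
  have ey0 : 0 ≤ ∑ i ∈ (Finset.range n).filter (· ≠ k), y i ^ 4 :=
    Finset.sum_nonneg fun i _ => by positivity
  set e := ∑ i ∈ (Finset.range n).filter (· ≠ k), x i ^ 4
  set f := ∑ i ∈ (Finset.range n).filter (· ≠ k), y i ^ 4
  have zz : x k ^ 3 * y k ^ 3 ≤ 1 - 3 / 4 * e - 3 / 4 * f + e * f := by
    have : x k ^ 3 * y k ^ 3 ≤ (1 - 3 / 4 * e) * (1 - 3 / 4 * f) :=
      mul_le_mul zx zy (pow_nonneg (hy k) 3) (by linarith)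
    nlinarith [mul_nonneg ex0 ey0]
  have hef : e * f ≤ 1 / 2 * e ^ 2 + 1 / 2 * f ^ 2 := by nlinarith [sq_nonneg (e - f)]
  have h8 : 896 * β ^ 8 ≤ 1 / 4 * β ^ 6 := by
    have : 896 * β ^ 8 = 896 * β ^ 2 * β ^ 6 := by ring
    rw [this]
    gcongr
    linarith
  linarith

lemma main_term_le {B l z w e f : ℝ} (hB : 0 ≤ B) (hB1 : B ≤ 1) (hl : l ≤ 1 - 1 / 2 * B)
    (hz : 0 ≤ z) (hw : 0 ≤ w) (he : 0 ≤ e) (hf : 0 ≤ f) (hze : z ≤ 1 - 3 / 4 * e)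
    (hwf : w ≤ 1 - 3 / 4 * f) :
    l * (z * w) ≤ 1 - 1 / 2 * B - 3 / 4 * e - 3 / 4 * f + B * e + B * f +
      1 / 2 * e ^ 2 + 1 / 2 * f ^ 2 := by
  have : (0:ℝ) ≤ 1 - 3 / 4 * e := hz.trans hze
  calc l * (z * w) ≤ (1 - 1 / 2 * B) * ((1 - 3 / 4 * e) * (1 - 3 / 4 * f)) := by
        gcongr
        linarith
    _ = 1 - 1 / 2 * B - 3 / 4 * e - 3 / 4 * f + 3 / 8 * (B * e) + 3 / 8 * (B * f) +
        9 / 16 * (e * f) - 9 / 32 * (B * (e * f)) := by ring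
    _ ≤ _ := by
        linarith [sq_nonneg (e - f), mul_nonneg he hf, mul_nonneg hB he, mul_nonneg hB hf,
          mul_nonneg hB (mul_nonneg he hf), (by ring : (e - f) ^ 2 = e ^ 2 - 2 * (e * f) + f ^ 2)]

/-- When almost all the mass sits at one index, merging all valuations above it is
efficient. -/
lemma kernel_case_merged {β lam : ℝ} (h0 : 0 ≤ β) (h1 : β ≤ 1 / 1000) (hl : 0 ≤ lam)
    (hlam : lam ^ 4 = 1 - β ^ 8) {n k : ℕ} (hk : k < n) (x y : ℕ → ℝ) (hx : ∀ i, 0 ≤ x i)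
    (hy : ∀ i, 0 ≤ y i)
    (sx : ∑ i ∈ Finset.range n, x i ^ 4 = 1) (sy : ∑ i ∈ Finset.range n, y i ^ 4 = 1)
    (hb : ∑ i ∈ (Finset.range n).filter (· ≠ k), x i ^ 4 +
      ∑ i ∈ (Finset.range n).filter (· ≠ k), y i ^ 4 ≤ β ^ 6)
    (z w : ℝ) (hz : 0 ≤ z) (hw : 0 ≤ w)
    (hz4 : z ^ 4 = ∑ i ∈ (Finset.range n).filter (k ≤ ·), x i ^ 4)
    (hw4 : w ^ 4 = ∑ i ∈ (Finset.range n).filter (k ≤ ·), y i ^ 4) :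
    primeKernel β lam k k * (z ^ 3 * w ^ 3) +
      ∑ i ∈ Finset.range n, ∑ j ∈ Finset.range n,
        (if min i j = k then 0 else primeKernel β lam i j * (x i ^ 3 * y j ^ 3)) ≤
      1 + 16 * β ^ 9 := by
  have nn : ∀ (s : Finset ℕ) (x : ℕ → ℝ), 0 ≤ ∑ i ∈ s, x i ^ 4 := fun s x =>
    Finset.sum_nonneg fun i _ => by positivity
  have hl1 : lam ≤ 1 := by
    refine le_of_not_gt fun h => ?_
    have := one_lt_pow₀ h (n := 4) (by norm_num)
    linarith [pow_nonneg h0 8]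
  have hoff := off_both_le h0 h1 hl hl1 n k x y hx hy
  have b2 : β ^ 2 ≤ 1 / 1000000 := by
    calc β ^ 2 ≤ (1 / 1000) ^ 2 := by gcongr
      _ ≤ _ := by norm_num
  have b4 : β ^ 4 ≤ 1 := pow_le_one₀ h0 (by linarith)
  have sx' := sum_eq_add_filter_ne hk fun i => x i ^ 4
  have sy' := sum_eq_add_filter_ne hk fun i => y i ^ 4
  rw [sx] at sx'
  rw [sy] at sy'
  have le1 : ∀ t : ℝ, 0 ≤ t → t ^ 4 ≤ 1 → t ^ 3 ≤ 1 := by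
    intro t ht h
    refine pow_le_one₀ ht (le_of_not_gt fun h' => ?_)
    have := one_lt_pow₀ h' (n := 4) (by norm_num)
    linarith
  have xk1 : x k ^ 3 ≤ 1 := le1 _ (hx k) (by linarith [nn ((Finset.range n).filter (· ≠ k)) x])
  have yk1 : y k ^ 3 ≤ 1 := le1 _ (hy k) (by linarith [nn ((Finset.range n).filter (· ≠ k)) y])
  have pt : ∀ i j,
      (if min i j = k then 0 else primeKernel β lam i j * (x i ^ 3 * y j ^ 3)) ≤
      (if i = k ∨ j = k then 0 else primeKernel β lam i j * (x i ^ 3 * y j ^ 3)) +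
      (if j = k then (if i < k then (1 + β ^ 4) * (β ^ 2) ^ Nat.dist i k * x i ^ 3 else 0)
        else 0) +
      (if i = k then (if j < k then (1 + β ^ 4) * (β ^ 2) ^ Nat.dist j k * y j ^ 3 else 0)
        else 0) := by
    intro i j
    have hxi := hx i
    have hyj := hy j
    have hker := primeKernel_le h0 hl hl1 i j
    have hker0 := primeKernel_nonneg h0 hl i j
    by_cases hi : i = k <;> by_cases hj : j = k
    · subst hi; subst hj
      simp
    · subst hi
      rcases lt_or_gt_of_ne hj with h | h
      · have : ¬ min i j = i := by rw [min_eq_right h.le]; exact hj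
        simp only [this, hj, h, or_false, if_true, if_false, zero_add]
        rw [Nat.dist_comm j i]
        calc primeKernel β lam i j * (x i ^ 3 * y j ^ 3)
            ≤ ((1 + β ^ 4) * (β ^ 2) ^ Nat.dist i j) * (1 * y j ^ 3) := by gcongr
          _ = _ := by ring
      · have : min i j = i := min_eq_left h.le
        simp [this, hj, h.le.not_gt]
    · subst hj
      rcases lt_or_gt_of_ne hi with h | h
      · have : ¬ min i j = j := by rw [min_eq_left h.le]; exact hi
        simp only [this, hi, h, or_true, if_true, if_false, zero_add, add_zero]
        calc primeKernel β lam i j * (x i ^ 3 * y j ^ 3)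
            ≤ ((1 + β ^ 4) * (β ^ 2) ^ Nat.dist i j) * (x i ^ 3 * 1) := by gcongr
          _ = _ := by ring
      · have : min i j = j := min_eq_right h.le
        simp [this, hi, h.le.not_gt]
    · have : ¬ min i j = k := by
        rcases min_choice i j with h | h <;> rw [h] <;> assumption
      simp [hi, hj, this]
  have tot := Finset.sum_le_sum fun i (_ : i ∈ Finset.range n) =>
    Finset.sum_le_sum fun j (_ : j ∈ Finset.range n) => pt i j
  simp only [Finset.sum_add_distrib] at tot
  have t2 : ∑ i ∈ Finset.range n, ∑ j ∈ Finset.range n,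
      (if j = k then (if i < k then (1 + β ^ 4) * (β ^ 2) ^ Nat.dist i k * x i ^ 3 else 0)
        else 0) =
      ∑ i ∈ (Finset.range n).filter (· < k), (1 + β ^ 4) * (β ^ 2) ^ Nat.dist i k * x i ^ 3 := by
    simp only [Finset.sum_ite_eq', Finset.mem_range.2 hk, if_true]
    rw [Finset.sum_filter]
  have t3 : ∑ i ∈ Finset.range n, ∑ j ∈ Finset.range n,
      (if i = k then (if j < k then (1 + β ^ 4) * (β ^ 2) ^ Nat.dist j k * y j ^ 3 else 0)
        else 0) =
      ∑ i ∈ (Finset.range n).filter (· < k), (1 + β ^ 4) * (β ^ 2) ^ Nat.dist i k * y i ^ 3 := by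
    rw [Finset.sum_comm]
    simp only [Finset.sum_ite_eq', Finset.mem_range.2 hk, if_true]
    rw [Finset.sum_filter]
  rw [t2, t3] at tot
  have hle : ∀ x : ℕ → ℝ, ∑ i ∈ (Finset.range n).filter (k ≤ ·), x i ^ 4 =
      ∑ i ∈ Finset.range n, x i ^ 4 - ∑ i ∈ (Finset.range n).filter (· < k), x i ^ 4 := by
    intro x
    rw [eq_sub_iff_add_eq, add_comm,
      ← Finset.sum_filter_add_sum_filter_not (Finset.range n) (· < k) (fun i => x i ^ 4)]
    simp only [not_lt]
  rw [hle, sx] at hz4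
  rw [hle, sy] at hw4
  rw [sum_filter_ne_eq n k fun i => x i ^ 4, sum_filter_ne_eq n k fun i => y i ^ 4] at hb
  rw [sum_filter_ne_eq n k fun i => x i ^ 6, sum_filter_ne_eq n k fun i => y i ^ 6] at hoff
  have xl0 := nn ((Finset.range n).filter (· < k)) x
  have yl0 := nn ((Finset.range n).filter (· < k)) y
  have xr0 := nn ((Finset.range n).filter (k < ·)) x
  have yr0 := nn ((Finset.range n).filter (k < ·)) y
  have cx := side_cost h0 h1 n k x (by linarith)
  have cy := side_cost h0 h1 n k y (by linarith)
  have hxr : ∑ i ∈ (Finset.range n).filter (k < ·), x i ^ 4 ≤ β ^ 6 := by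
    linarith
  have hyr : ∑ i ∈ (Finset.range n).filter (k < ·), y i ^ 4 ≤ β ^ 6 := by
    linarith
  have six : ∀ x : ℕ → ℝ, ∑ i ∈ (Finset.range n).filter (k < ·), x i ^ 4 ≤ β ^ 6 →
      ∑ i ∈ (Finset.range n).filter (k < ·), x i ^ 6 ≤ β ^ 9 := by
    intro x hx
    have := sum_pow_six_le (θ := β ^ 3) (by positivity) (by rw [← pow_mul]; exact hx)
    calc _ ≤ _ := this
      _ ≤ β ^ 3 * β ^ 6 := by gcongr
      _ = _ := by ring
  have sixx := six x hxr
  have sixy := six y hyr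
  have zz := pow_three_le_of_pow_four hz4.le
  have ww := pow_three_le_of_pow_four hw4.le
  have b9 := pow_nonneg h0 9
  have b8 := pow_nonneg h0 8
  rcases Nat.eq_zero_or_pos k with hk0 | hk0
  · subst hk0
    have e : (Finset.range n).filter (· < 0) = ∅ := by simp
    simp only [e, Finset.sum_empty] at *
    rw [primeKernel_self, if_pos rfl, one_mul]
    have : z ^ 3 * w ^ 3 ≤ 1 := mul_le_one₀ (by linarith) (by positivity) (by linarith)
    linarith
  · rw [primeKernel_self, if_neg hk0.ne']
    have hl2 : lam ^ 2 ≤ 1 - 1 / 2 * β ^ 8 := by nlinarith [sq_nonneg (lam ^ 2 - 1)]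
    set e := ∑ i ∈ (Finset.range n).filter (· < k), x i ^ 4
    set f := ∑ i ∈ (Finset.range n).filter (· < k), y i ^ 4
    have hz3 := pow_nonneg hz 3
    have main := main_term_le (e := e) (f := f) b8 (pow_le_one₀ h0 (by linarith)) hl2 hz3
      (pow_nonneg hw 3) xl0 yl0 zz ww
    linarith

/-- When no index carries almost all the mass, the plain bilinear form is small. -/
lemma kernel_case_spread {β lam : ℝ} (h0 : 0 ≤ β) (h1 : β ≤ 1 / 1000) (hl : 0 ≤ lam)
    (hl1 : lam ≤ 1) {n : ℕ} (x y : ℕ → ℝ) (hx : ∀ i, 0 ≤ x i) (hy : ∀ i, 0 ≤ y i)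
    (sx : ∑ i ∈ Finset.range n, x i ^ 4 = 1) (sy : ∑ i ∈ Finset.range n, y i ^ 4 = 1)
    (hu : ∀ i ∈ Finset.range n, (x i ^ 4 + y i ^ 4) / 2 ≤ 1 - 16 * β ^ 2) :
    ∑ i ∈ Finset.range n, ∑ j ∈ Finset.range n, primeKernel β lam i j * (x i ^ 3 * y j ^ 3) ≤
      1 := by
  have b2 : β ^ 2 ≤ 1 / 1000000 := by
    calc β ^ 2 ≤ (1 / 1000) ^ 2 := by gcongr
      _ ≤ _ := by norm_num
  have b4 : β ^ 4 ≤ 1 := pow_le_one₀ h0 (by linarith)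
  have hs := schur_offdiag (r := β ^ 2) (by positivity) (by linarith) n
    (fun i => x i ^ 3) (fun i => y i ^ 3)
  have hr : β ^ 2 / (1 - β ^ 2) ≤ 2 * β ^ 2 := by
    rw [div_le_iff₀ (by linarith)]
    nlinarith [pow_nonneg h0 2]
  have six : ∀ x : ℕ → ℝ, ∑ i ∈ Finset.range n, x i ^ 4 = 1 →
      ∑ i ∈ Finset.range n, (x i ^ 3) ^ 2 ≤ 1 := by
    intro x hx
    have := sum_pow_six_le (s := Finset.range n) (x := x) (θ := 1) zero_le_one
      (by rw [hx]; norm_num)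
    simp only [← pow_mul]
    linarith
  have pt : ∀ i ∈ Finset.range n, ∀ j ∈ Finset.range n,
      primeKernel β lam i j * (x i ^ 3 * y j ^ 3) ≤
      2 * ((if i = j then 0 else (β ^ 2) ^ Nat.dist i j) * (x i ^ 3 * y j ^ 3)) +
      (if i = j then (1 - 8 * β ^ 2) * ((x i ^ 4 + y i ^ 4) / 2) else 0) := by
    intro i hi j hj
    have hxi := hx i
    have hyj := hy j
    by_cases hij : i = j
    · subst hij
      simp only [if_true, zero_mul, mul_zero, zero_add]
      have hself : primeKernel β lam i i ≤ 1 := by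
        rw [primeKernel_self]
        split_ifs
        · exact le_rfl
        · exact pow_le_one₀ hl hl1
      have hxy2 : (x i * y i) ^ 2 ≤ (x i ^ 4 + y i ^ 4) / 2 := by
        nlinarith [sq_nonneg (x i ^ 2 - y i ^ 2)]
      have hxy : x i * y i ≤ 1 - 8 * β ^ 2 := by
        refine le_of_sq_le_sq ?_ (by linarith)
        nlinarith [hu i hi, sq_nonneg (β ^ 2)]
      have : 0 ≤ x i ^ 3 * y i ^ 3 := by positivity
      calc primeKernel β lam i i * (x i ^ 3 * y i ^ 3) ≤ 1 * (x i ^ 3 * y i ^ 3) := by gcongr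
        _ = (x i * y i) * (x i * y i) ^ 2 := by ring
        _ ≤ (1 - 8 * β ^ 2) * ((x i ^ 4 + y i ^ 4) / 2) := by
            gcongr
            linarith
    · simp only [hij, if_false, add_zero]
      rw [← mul_assoc 2]
      refine mul_le_mul_of_nonneg_right ?_
          (mul_nonneg (pow_nonneg (hx i) 3) (pow_nonneg (hy j) 3))
      refine (primeKernel_le h0 hl hl1 i j).trans ?_
      gcongr
      linarith
  have tot := Finset.sum_le_sum fun i (hi : i ∈ Finset.range n) =>
    Finset.sum_le_sum fun j (hj : j ∈ Finset.range n) => pt i hi j hj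
  simp only [Finset.sum_add_distrib, ← Finset.mul_sum] at tot
  have td : ∑ i ∈ Finset.range n, ∑ j ∈ Finset.range n,
      (if i = j then (1 - 8 * β ^ 2) * ((x i ^ 4 + y i ^ 4) / 2) else 0) = 1 - 8 * β ^ 2 := by
    have : ∀ i ∈ Finset.range n, ∑ j ∈ Finset.range n,
        (if i = j then (1 - 8 * β ^ 2) * ((x i ^ 4 + y i ^ 4) / 2) else 0) =
        (1 - 8 * β ^ 2) * ((x i ^ 4 + y i ^ 4) / 2) := by
      intro i hi
      rw [Finset.sum_ite_eq, if_pos hi]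
    rw [Finset.sum_congr rfl this, ← Finset.mul_sum, ← Finset.sum_div, Finset.sum_add_distrib, sx,
      sy]
    ring
  rw [td] at tot
  have hs' : β ^ 2 / (1 - β ^ 2) * (∑ i ∈ Finset.range n, (x i ^ 3) ^ 2 +
      ∑ i ∈ Finset.range n, (y i ^ 3) ^ 2) ≤ 2 * β ^ 2 * (1 + 1) := by
    have := six x sx
    have := six y sy
    gcongr
  linarith

/-- Trivial bound for the bilinear form of the kernel, used at small primes. -/
lemma kernel_trivial {β lam : ℝ} (h0 : 0 ≤ β) (h1 : β ^ 8 ≤ 1 / 2) (hl : 0 ≤ lam)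
    (hl1 : lam ≤ 1) {n : ℕ} (x y : ℕ → ℝ) (hx : ∀ i, 0 ≤ x i) (hy : ∀ i, 0 ≤ y i)
    (sx : ∑ i ∈ Finset.range n, x i ^ 4 = 1) (sy : ∑ i ∈ Finset.range n, y i ^ 4 = 1) :
    ∑ i ∈ Finset.range n, ∑ j ∈ Finset.range n, primeKernel β lam i j * (x i ^ 3 * y j ^ 3) ≤
      50 := by
  have b2 : β ^ 2 ≤ 9 / 10 := by
    refine le_of_not_gt fun h => ?_
    have : (9 / 10 : ℝ) ^ 4 < (β ^ 2) ^ 4 := by gcongr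
    rw [← pow_mul] at this
    norm_num at this
    linarith
  have b4 : β ^ 4 ≤ 1 := by nlinarith [sq_nonneg β]
  have hs := schur_full (r := β ^ 2) (by positivity) (by linarith) n
    (fun i => x i ^ 3) (fun i => y i ^ 3)
  have hr : β ^ 2 / (1 - β ^ 2) ≤ 9 := by
    rw [div_le_iff₀ (by linarith)]
    linarith
  have six : ∀ x : ℕ → ℝ, ∑ i ∈ Finset.range n, x i ^ 4 = 1 →
      ∑ i ∈ Finset.range n, (x i ^ 3) ^ 2 ≤ 1 := by
    intro x hx
    have := sum_pow_six_le (s := Finset.range n) (x := x) (θ := 1) zero_le_one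
      (by rw [hx]; norm_num)
    simp only [← pow_mul]
    linarith
  calc _ ≤ ∑ i ∈ Finset.range n, ∑ j ∈ Finset.range n,
        2 * ((β ^ 2) ^ Nat.dist i j * (x i ^ 3 * y j ^ 3)) := by
        refine Finset.sum_le_sum fun i _ => Finset.sum_le_sum fun j _ => ?_
        have := hx i
        have := hy j
        rw [← mul_assoc 2]
        refine mul_le_mul_of_nonneg_right ?_
          (mul_nonneg (pow_nonneg (hx i) 3) (pow_nonneg (hy j) 3))
        refine (primeKernel_le h0 hl hl1 i j).trans ?_
        gcongr
        linarith
    _ ≤ 2 * ((1 / 2 + 9) * (1 + 1)) := by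
        simp only [← Finset.mul_sum] at hs ⊢
        have := six x sx
        have := six y sy
        gcongr
        refine hs.trans ?_
        gcongr
    _ ≤ 50 := by norm_num

/-- The local bilinear inequality at a prime, normalized. -/
theorem kernel_bound : ∃ K : ℝ, 0 ≤ K ∧ ∀ β lam : ℝ, 0 ≤ β → β ^ 8 ≤ 1 / 2 → 0 ≤ lam →
    lam ^ 4 = 1 - β ^ 8 → ∀ (n : ℕ) (x y : ℕ → ℝ), (∀ i, 0 ≤ x i) → (∀ i, 0 ≤ y i) →
    ∑ i ∈ Finset.range n, x i ^ 4 = 1 → ∑ i ∈ Finset.range n, y i ^ 4 = 1 →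
    (∑ i ∈ Finset.range n, ∑ j ∈ Finset.range n, primeKernel β lam i j * (x i ^ 3 * y j ^ 3) ≤
      1 + K * β ^ 9) ∨
    ∃ k, ∀ z w : ℝ, 0 ≤ z → 0 ≤ w →
      z ^ 4 = ∑ i ∈ (Finset.range n).filter (k ≤ ·), x i ^ 4 →
      w ^ 4 = ∑ i ∈ (Finset.range n).filter (k ≤ ·), y i ^ 4 →
      primeKernel β lam k k * (z ^ 3 * w ^ 3) +
      ∑ i ∈ Finset.range n, ∑ j ∈ Finset.range n,
        (if min i j = k then 0 else primeKernel β lam i j * (x i ^ 3 * y j ^ 3)) ≤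
      1 + K * β ^ 9 := by
  refine ⟨50 * 1000 ^ 9, by norm_num, ?_⟩
  intro β lam h0 h8 hl hlam n x y hx hy sx sy
  have hl1 : lam ≤ 1 := by
    refine le_of_not_gt fun h => ?_
    have := one_lt_pow₀ h (n := 4) (by norm_num)
    linarith [pow_nonneg h0 8]
  have b9 := pow_nonneg h0 9
  rcases le_or_gt β (1 / 1000) with h1 | h1
  · by_cases hu : ∀ i ∈ Finset.range n, (x i ^ 4 + y i ^ 4) / 2 ≤ 1 - 16 * β ^ 2
    · left
      have := kernel_case_spread h0 h1 hl hl1 x y hx hy sx sy hu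
      nlinarith
    · push Not at hu
      obtain ⟨k, hk, hu⟩ := hu
      rw [Finset.mem_range] at hk
      have sx' := sum_eq_add_filter_ne hk fun i => x i ^ 4
      have sy' := sum_eq_add_filter_ne hk fun i => y i ^ 4
      rw [sx] at sx'
      rw [sy] at sy'
      have nn : ∀ (s : Finset ℕ) (x : ℕ → ℝ), 0 ≤ ∑ i ∈ s, x i ^ 4 := fun s x =>
        Finset.sum_nonneg fun i _ => by positivity
      have nx := nn ((Finset.range n).filter (· ≠ k)) x
      have ny := nn ((Finset.range n).filter (· ≠ k)) y
      have ex : ∑ i ∈ (Finset.range n).filter (· ≠ k), x i ^ 4 ≤ 32 * β ^ 2 := by linarith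
      have ey : ∑ i ∈ (Finset.range n).filter (· ≠ k), y i ^ 4 ≤ 32 * β ^ 2 := by linarith
      by_cases hb : β ^ 6 ≤ ∑ i ∈ (Finset.range n).filter (· ≠ k), x i ^ 4 +
          ∑ i ∈ (Finset.range n).filter (· ≠ k), y i ^ 4
      · left
        have := kernel_case_plain h0 h1 hl hl1 hk x y hx hy sx sy ex ey hb
        nlinarith
      · right
        refine ⟨k, fun z w hz hw hz4 hw4 => ?_⟩
        have := kernel_case_merged h0 h1 hl hlam hk x y hx hy sx sy
          (not_le.1 hb).le z w hz hw hz4 hw4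
        nlinarith
  · left
    have := kernel_trivial h0 h8 hl hl1 x y hx hy sx sy
    have : (1 / 1000 : ℝ) ^ 9 ≤ β ^ 9 := by gcongr
    nlinarith

/-- The nonnegative fourth root. -/
noncomputable def fourthRoot (x : ℝ) : ℝ := √(√x)

lemma fourthRoot_nonneg (x : ℝ) : 0 ≤ fourthRoot x := Real.sqrt_nonneg _

lemma fourthRoot_pow {x : ℝ} (hx : 0 ≤ x) : fourthRoot x ^ 4 = x := by
  unfold fourthRoot
  rw [show 4 = 2 * 2 by norm_num, pow_mul, Real.sq_sqrt (Real.sqrt_nonneg _), Real.sq_sqrt hx]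

lemma fourthRoot_sq (x : ℝ) : fourthRoot x ^ 2 = √x := Real.sq_sqrt (Real.sqrt_nonneg _)

lemma fourthRoot_mul {x : ℝ} (hx : 0 ≤ x) (y : ℝ) :
    fourthRoot (x * y) = fourthRoot x * fourthRoot y := by
  unfold fourthRoot
  rw [Real.sqrt_mul hx, Real.sqrt_mul (Real.sqrt_nonneg _)]

lemma fourthRoot_le {x y : ℝ} (h : x ≤ y) : fourthRoot x ≤ fourthRoot y :=
  Real.sqrt_le_sqrt (Real.sqrt_le_sqrt h)

@[simp] lemma fourthRoot_zero : fourthRoot 0 = 0 := by simp [fourthRoot]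

lemma fourthRoot_pos {x : ℝ} (hx : 0 < x) : 0 < fourthRoot x :=
  Real.sqrt_pos.2 (Real.sqrt_pos.2 hx)

/-- The local bilinear inequality at a prime, in homogeneous form. -/
theorem kernel_bound_homogeneous : ∃ K : ℝ, 0 ≤ K ∧ ∀ β lam : ℝ, 0 ≤ β → β ^ 8 ≤ 1 / 2 → 0 ≤ lam →
    lam ^ 4 = 1 - β ^ 8 → ∀ (n : ℕ) (x y : ℕ → ℝ), (∀ i, 0 ≤ x i) → (∀ i, 0 ≤ y i) →
    (∑ i ∈ Finset.range n, ∑ j ∈ Finset.range n,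
        primeKernel β lam i j * (fourthRoot (x i) * fourthRoot (y j)) ^ 3 ≤
      (1 + K * β ^ 9) * (fourthRoot (∑ i ∈ Finset.range n, x i) *
        fourthRoot (∑ i ∈ Finset.range n, y i)) ^ 3) ∨
    ∃ k, primeKernel β lam k k * (fourthRoot (∑ i ∈ (Finset.range n).filter (k ≤ ·), x i) *
        fourthRoot (∑ i ∈ (Finset.range n).filter (k ≤ ·), y i)) ^ 3 +
      ∑ i ∈ Finset.range n, ∑ j ∈ Finset.range n, (if min i j = k then 0 else
        primeKernel β lam i j * (fourthRoot (x i) * fourthRoot (y j)) ^ 3) ≤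
      (1 + K * β ^ 9) * (fourthRoot (∑ i ∈ Finset.range n, x i) *
        fourthRoot (∑ i ∈ Finset.range n, y i)) ^ 3 := by
  obtain ⟨K, hK, h⟩ := kernel_bound
  refine ⟨K, hK, fun β lam h0 h8 hl hlam n x y hx hy => ?_⟩
  set X := ∑ i ∈ Finset.range n, x i with hX
  set Y := ∑ i ∈ Finset.range n, y i with hY
  have X0 : 0 ≤ X := Finset.sum_nonneg fun i _ => hx i
  have Y0 : 0 ≤ Y := Finset.sum_nonneg fun i _ => hy i
  rcases X0.eq_or_lt with hX0 | hX0
  · left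
    have hz := (Finset.sum_eq_zero_iff_of_nonneg fun i _ => hx i).1 hX0.symm
    rw [← hX0, fourthRoot_zero]
    refine le_of_eq ?_
    rw [Finset.sum_eq_zero fun i hi => Finset.sum_eq_zero fun j _ => ?_]
    · ring
    · rw [hz i hi, fourthRoot_zero]
      ring
  rcases Y0.eq_or_lt with hY0 | hY0
  · left
    have hz := (Finset.sum_eq_zero_iff_of_nonneg fun i _ => hy i).1 hY0.symm
    rw [← hY0, fourthRoot_zero]
    refine le_of_eq ?_
    rw [Finset.sum_eq_zero fun i hi => Finset.sum_eq_zero fun j hj => ?_]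
    · ring
    · rw [hz j hj, fourthRoot_zero]
      ring
  have cx : 0 < fourthRoot X := fourthRoot_pos hX0
  have cy : 0 < fourthRoot Y := fourthRoot_pos hY0
  have cX : fourthRoot X ^ 4 = X := fourthRoot_pow X0
  have cY : fourthRoot Y ^ 4 = Y := fourthRoot_pow Y0
  have hP : 0 < (fourthRoot X * fourthRoot Y) ^ 3 := by positivity
  have sumdiv : ∀ (s : Finset ℕ) (x : ℕ → ℝ) (X : ℝ), (∀ i, 0 ≤ x i) → fourthRoot X ^ 4 = X →
      ∑ i ∈ s, (fourthRoot (x i) / fourthRoot X) ^ 4 = (∑ i ∈ s, x i) / X := by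
    intro s x X hx hX
    simp only [div_pow, hX, fourthRoot_pow (hx _), Finset.sum_div]
  have term : ∀ c u v : ℝ, c * ((u / fourthRoot X) ^ 3 * (v / fourthRoot Y) ^ 3) =
      c * (u * v) ^ 3 / (fourthRoot X * fourthRoot Y) ^ 3 := by
    intro c u v
    rw [div_pow, div_pow, mul_pow, mul_pow]
    field_simp
  rcases h β lam h0 h8 hl hlam n (fun i => fourthRoot (x i) / fourthRoot X)
    (fun i => fourthRoot (y i) / fourthRoot Y) (fun i => div_nonneg (fourthRoot_nonneg _) cx.le)
    (fun i => div_nonneg (fourthRoot_nonneg _) cy.le)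
    (by rw [sumdiv _ _ _ hx cX, ← hX, div_self hX0.ne'])
    (by rw [sumdiv _ _ _ hy cY, ← hY, div_self hY0.ne']) with h | ⟨k, h⟩
  · left
    simp only [term, ← Finset.sum_div] at h
    exact (div_le_iff₀ hP).1 h
  · right
    refine ⟨k, ?_⟩
    have hk := h (fourthRoot (∑ i ∈ (Finset.range n).filter (k ≤ ·), x i) / fourthRoot X)
      (fourthRoot (∑ i ∈ (Finset.range n).filter (k ≤ ·), y i) / fourthRoot Y)
      (div_nonneg (fourthRoot_nonneg _) cx.le) (div_nonneg (fourthRoot_nonneg _) cy.le)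
      (by rw [sumdiv _ _ _ hx cX, div_pow, cX, fourthRoot_pow (Finset.sum_nonneg fun i _ => hx i)])
      (by rw [sumdiv _ _ _ hy cY, div_pow, cY, fourthRoot_pow (Finset.sum_nonneg fun i _ => hy i)])
    have e : ∀ i j : ℕ, (if min i j = k then (0:ℝ) else primeKernel β lam i j *
        ((fourthRoot (x i) / fourthRoot X) ^ 3 * (fourthRoot (y j) / fourthRoot Y) ^ 3)) =
        (if min i j = k then 0 else
        primeKernel β lam i j * (fourthRoot (x i) * fourthRoot (y j)) ^ 3) /
          (fourthRoot X * fourthRoot Y) ^ 3 := by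
      intro i j
      rw [term]
      split_ifs <;> simp
    simp only [e, ← Finset.sum_div] at hk
    rw [term, ← add_div] at hk
    exact (div_le_iff₀ hP).1 hk

/-- `p ^ (-1 / 8)`. -/
noncomputable def primeBeta (p : ℕ) : ℝ := ((p : ℝ) ^ (1 / 8 : ℝ))⁻¹

/-- `(1 - 1 / p) ^ (1 / 4)`. -/
noncomputable def primeLam (p : ℕ) : ℝ := fourthRoot (1 - (p : ℝ)⁻¹)

lemma primeBeta_nonneg (p : ℕ) : 0 ≤ primeBeta p := by unfold primeBeta; positivity

lemma primeBeta_pow (p : ℕ) : primeBeta p ^ 8 = (p : ℝ)⁻¹ := by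
  unfold primeBeta
  rw [inv_pow, ← Real.rpow_natCast, ← Real.rpow_mul (Nat.cast_nonneg p)]
  norm_num

lemma primeBeta_pow_nine (p : ℕ) : primeBeta p ^ 9 = ((p : ℝ) ^ (9 / 8 : ℝ))⁻¹ := by
  unfold primeBeta
  rw [inv_pow, ← Real.rpow_natCast, ← Real.rpow_mul (Nat.cast_nonneg p)]
  norm_num

lemma primeBeta_pow_four (p : ℕ) : primeBeta p ^ 4 = (√(p : ℝ))⁻¹ := by
  have h : (primeBeta p ^ 4) ^ 2 = (p : ℝ)⁻¹ := by rw [← pow_mul, primeBeta_pow]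
  rw [← Real.sqrt_inv, ← h, Real.sqrt_sq (pow_nonneg (primeBeta_nonneg p) 4)]

lemma primeLam_nonneg (p : ℕ) : 0 ≤ primeLam p := fourthRoot_nonneg _

lemma primeLam_pow {p : ℕ} (hp : 1 ≤ p) : primeLam p ^ 4 = 1 - (p : ℝ)⁻¹ :=
  fourthRoot_pow (sub_nonneg.2 (inv_le_one_of_one_le₀ (by exact_mod_cast hp)))

/-- The product of the local kernels. -/
noncomputable def kernelProd (a b : ℕ) : ℝ :=
  ∏ p ∈ (a * b).primeFactors,
    primeKernel (primeBeta p) (primeLam p) (a.factorization p) (b.factorization p)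

lemma kernelProd_nonneg (a b : ℕ) : 0 ≤ kernelProd a b :=
  Finset.prod_nonneg fun p _ => primeKernel_nonneg (primeBeta_nonneg p) (primeLam_nonneg p) _ _

lemma kernelProd_one : kernelProd 1 1 = 1 := by simp [kernelProd]

lemma kernelProd_mul_pow {a b p : ℕ} (ha : 0 < a) (hb : 0 < b) (hp : p.Prime) (hpa : ¬ p ∣ a)
    (hpb : ¬ p ∣ b) (i j : ℕ) : kernelProd (a * p ^ i) (b * p ^ j) =
      primeKernel (primeBeta p) (primeLam p) i j * kernelProd a b := by
  have hpi := pow_pos hp.pos i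
  have hpj := pow_pos hp.pos j
  have hnot : p ∉ (a * b).primeFactors := by
    intro h
    rcases hp.dvd_mul.1 (Nat.dvd_of_mem_primeFactors h) with h | h <;> contradiction
  have hfac : ∀ c k q : ℕ, 0 < c → q ≠ p → (c * p ^ k).factorization q = c.factorization q := by
    intro c k q hc hq
    rw [Nat.factorization_mul hc.ne' (pow_pos hp.pos k).ne', hp.factorization_pow]
    simp [hq.symm]
  have hfacp : ∀ c k : ℕ, 0 < c → ¬ p ∣ c → (c * p ^ k).factorization p = k := by
    intro c k hc hpc
    rw [Nat.factorization_mul hc.ne' (pow_pos hp.pos k).ne', hp.factorization_pow]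
    simp [Nat.factorization_eq_zero_of_not_dvd hpc]
  have hsub : ((a * p ^ i) * (b * p ^ j)).primeFactors ⊆ insert p (a * b).primeFactors := by
    intro q hq
    have hqp := Nat.prime_of_mem_primeFactors hq
    rw [Finset.mem_insert, or_iff_not_imp_left]
    intro hne
    have hd := Nat.dvd_of_mem_primeFactors hq
    rw [show a * p ^ i * (b * p ^ j) = a * b * p ^ (i + j) by ring] at hd
    rcases hqp.dvd_mul.1 hd with h | h
    · exact Nat.mem_primeFactors.2 ⟨hqp, h, (Nat.mul_pos ha hb).ne'⟩
    · exact absurd ((Nat.prime_dvd_prime_iff_eq hqp hp).1 (hqp.dvd_of_dvd_pow h)) hne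
  unfold kernelProd
  rw [Finset.prod_subset hsub, Finset.prod_insert hnot, hfacp a i ha hpa, hfacp b j hb hpb]
  · congr 1
    refine Finset.prod_congr rfl fun q hq => ?_
    have hqp : q ≠ p := fun h => hnot (h ▸ hq)
    rw [hfac a i q ha hqp, hfac b j q hb hqp]
  · intro q hq hq'
    have hq0 : (a * p ^ i * (b * p ^ j)).factorization q = 0 := by
      rw [← Finsupp.notMem_support_iff, Nat.support_factorization]
      exact hq'
    rw [Nat.factorization_mul (by positivity) (by positivity), Finsupp.add_apply] at hq0
    rw [show (a * p ^ i).factorization q = 0 by omega,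
      show (b * p ^ j).factorization q = 0 by omega,
      primeKernel_self, if_pos rfl]

/-- Weighted pair sums whose local data at primes outside `𝒬` are prescribed by `(a, b)`
are bounded by the product of local kernels. -/
def LocalBound (s : ℕ → ℝ) (F : ℕ × ℕ → ℝ) (A : Set (ℕ × ℕ)) (C : ℝ) (𝒬 : Finset ℕ) : Prop :=
  ∀ a b : ℕ, 0 < a → 0 < b → (∀ p ∈ 𝒬, ¬ p ∣ a ∧ ¬ p ∣ b) →
    ∀ (V W : Finset ℕ) (E : Finset (ℕ × ℕ)), E ⊆ V ×ˢ W →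
    (∀ e ∈ E, e ∈ A ∧ 0 < e.1 ∧ 0 < e.2 ∧ a ∣ e.1 ∧ b ∣ e.2 ∧
      ∀ p, p.Prime → p ∉ 𝒬 → min (e.1.factorization p) (e.2.factorization p) =
        min (a.factorization p) (b.factorization p)) →
    ∑ e ∈ E, F e ≤ C * kernelProd a b *
      (fourthRoot (∑ v ∈ V, s v) * fourthRoot (∑ w ∈ W, s w)) ^ 3

lemma mul_pow_dvd {a p i v : ℕ} (hp : p.Prime) (hpa : ¬ p ∣ a) (hv : 0 < v) (hav : a ∣ v)
    (hi : i ≤ v.factorization p) : a * p ^ i ∣ v := by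
  refine Nat.Coprime.mul_dvd_of_dvd_of_dvd ?_ hav ?_
  · exact (Nat.Coprime.pow_left i ((Nat.Prime.coprime_iff_not_dvd hp).2 hpa)).symm
  · exact (hp.pow_dvd_iff_le_factorization hv.ne').2 hi

lemma factorization_mul_pow_self {c p : ℕ} (hp : p.Prime) (hc : 0 < c) (hpc : ¬ p ∣ c) (k : ℕ) :
    (c * p ^ k).factorization p = k := by
  rw [Nat.factorization_mul hc.ne' (pow_pos hp.pos k).ne', hp.factorization_pow]
  simp [Nat.factorization_eq_zero_of_not_dvd hpc]

lemma factorization_mul_pow_of_ne {c p q : ℕ} (hp : p.Prime) (hc : 0 < c) (hq : q ≠ p) (k : ℕ) :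
    (c * p ^ k).factorization q = c.factorization q := by
  rw [Nat.factorization_mul hc.ne' (pow_pos hp.pos k).ne', hp.factorization_pow]
  simp [hq.symm]

/-- Apply a local bound to the pairs with prescribed behaviour at one more prime. -/
lemma LocalBound.apply_pow {s : ℕ → ℝ} {F : ℕ × ℕ → ℝ} {A : Set (ℕ × ℕ)} {C : ℝ}
    {𝒬 : Finset ℕ} (h : LocalBound s F A C 𝒬) (h𝒬 : ∀ q ∈ 𝒬, q.Prime) {p : ℕ} (hp : p.Prime)
    (hp𝒬 : p ∉ 𝒬) {a b : ℕ} (ha : 0 < a) (hb : 0 < b)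
    (hab : ∀ q ∈ insert p 𝒬, ¬ q ∣ a ∧ ¬ q ∣ b) (i j : ℕ) (V W : Finset ℕ)
    (E : Finset (ℕ × ℕ)) (hE : E ⊆ V ×ˢ W)
    (hEA : ∀ e ∈ E, e ∈ A ∧ 0 < e.1 ∧ 0 < e.2 ∧ a ∣ e.1 ∧ b ∣ e.2 ∧
      ∀ q, q.Prime → q ∉ insert p 𝒬 → min (e.1.factorization q) (e.2.factorization q) =
        min (a.factorization q) (b.factorization q))
    (hij : ∀ e ∈ E, i ≤ e.1.factorization p ∧ j ≤ e.2.factorization p ∧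
      min (e.1.factorization p) (e.2.factorization p) = min i j) :
    ∑ e ∈ E, F e ≤ C * kernelProd a b * (primeKernel (primeBeta p) (primeLam p) i j *
      (fourthRoot (∑ v ∈ V, s v) * fourthRoot (∑ w ∈ W, s w)) ^ 3) := by
  have hpa := (hab p (Finset.mem_insert_self _ _)).1
  have hpb := (hab p (Finset.mem_insert_self _ _)).2
  have := h (a * p ^ i) (b * p ^ j) (by have := hp.pos; positivity)
    (by have := hp.pos; positivity) (fun q hq => ?_) V W E hE (fun e he => ?_)
  · rw [kernelProd_mul_pow ha hb hp hpa hpb] at this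
    linarith
  · have hqp : ¬ q ∣ p := fun h =>
      hp𝒬 (((Nat.prime_dvd_prime_iff_eq (h𝒬 q hq) hp).1 h) ▸ hq)
    have h1 := hab q (Finset.mem_insert_of_mem hq)
    constructor <;> intro hd <;> rcases (h𝒬 q hq).dvd_mul.1 hd with h2 | h2
    · exact h1.1 h2
    · exact hqp ((h𝒬 q hq).dvd_of_dvd_pow h2)
    · exact h1.2 h2
    · exact hqp ((h𝒬 q hq).dvd_of_dvd_pow h2)
  · obtain ⟨hA, h1, h2, h3, h4, h5⟩ := hEA e he
    obtain ⟨h6, h7, h8⟩ := hij e he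
    refine ⟨hA, h1, h2, mul_pow_dvd hp hpa h1 h3 h6, mul_pow_dvd hp hpb h2 h4 h7, ?_⟩
    intro q hq hq𝒬
    by_cases hqp : q = p
    · subst hqp
      rw [factorization_mul_pow_self hp ha hpa, factorization_mul_pow_self hp hb hpb, h8]
    · rw [factorization_mul_pow_of_ne hp ha hqp, factorization_mul_pow_of_ne hp hb hqp]
      exact h5 q hq (by simp [hqp, hq𝒬])

/-- One step of the prime-by-prime induction. -/
theorem exists_localBound_insert : ∃ K : ℝ, 0 ≤ K ∧ ∀ (s : ℕ → ℝ) (F : ℕ × ℕ → ℝ)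
    (A : Set (ℕ × ℕ)) (C : ℝ) (𝒬 : Finset ℕ) (p : ℕ), (∀ v, 0 ≤ s v) → 0 ≤ C →
    (∀ q ∈ 𝒬, q.Prime) → p.Prime → p ∉ 𝒬 → LocalBound s F A C 𝒬 →
    LocalBound s F A (C * (1 + K * primeBeta p ^ 9)) (insert p 𝒬) := by
  obtain ⟨K, hK, hker⟩ := kernel_bound_homogeneous
  refine ⟨K, hK, fun s F A C 𝒬 p hs hC h𝒬 hp hp𝒬 h a b ha hb hab V W E hE hEA => ?_⟩
  obtain ⟨n, hn⟩ : ∃ n, ∀ v ∈ V ∪ W, v.factorization p < n :=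
    ⟨(V ∪ W).sup (fun v => v.factorization p) + 1, fun v hv =>
      Nat.lt_succ_of_le (Finset.le_sup (f := fun v : ℕ => v.factorization p) hv)⟩
  have hG : 0 ≤ C * kernelProd a b := mul_nonneg hC (kernelProd_nonneg a b)
  have hpair : ∀ i j, ∑ e ∈ E.filter (fun e => e.1.factorization p = i ∧ e.2.factorization p = j),
      F e ≤ C * kernelProd a b * (primeKernel (primeBeta p) (primeLam p) i j *
        (fourthRoot (∑ v ∈ V.filter (fun v => v.factorization p = i), s v) *
          fourthRoot (∑ w ∈ W.filter (fun w => w.factorization p = j), s w)) ^ 3) := by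
    intro i j
    refine h.apply_pow h𝒬 hp hp𝒬 ha hb hab i j _ _ _ ?_ ?_ ?_
    · intro e he
      rw [Finset.mem_filter] at he
      have := Finset.mem_product.1 (hE he.1)
      simp only [Finset.mem_product, Finset.mem_filter]
      exact ⟨⟨this.1, he.2.1⟩, this.2, he.2.2⟩
    · exact fun e he => hEA e (Finset.mem_filter.1 he).1
    · intro e he
      obtain ⟨-, h1, h2⟩ := Finset.mem_filter.1 he
      rw [h1, h2]
      exact ⟨le_rfl, le_rfl, rfl⟩
  have hmerge : ∀ k, ∑ e ∈ E.filter
      (fun e => min (e.1.factorization p) (e.2.factorization p) = k), F e ≤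
      C * kernelProd a b * (primeKernel (primeBeta p) (primeLam p) k k *
        (fourthRoot (∑ v ∈ V.filter (fun v => k ≤ v.factorization p), s v) *
          fourthRoot (∑ w ∈ W.filter (fun w => k ≤ w.factorization p), s w)) ^ 3) := by
    intro k
    refine h.apply_pow h𝒬 hp hp𝒬 ha hb hab k k _ _ _ ?_ ?_ ?_
    · intro e he
      rw [Finset.mem_filter] at he
      have := Finset.mem_product.1 (hE he.1)
      simp only [Finset.mem_product, Finset.mem_filter]
      exact ⟨⟨this.1, he.2 ▸ min_le_left _ _⟩, this.2, he.2 ▸ min_le_right _ _⟩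
    · exact fun e he => hEA e (Finset.mem_filter.1 he).1
    · intro e he
      obtain ⟨-, h1⟩ := Finset.mem_filter.1 he
      exact ⟨h1 ▸ min_le_left _ _, h1 ▸ min_le_right _ _, by rw [h1, min_self]⟩
  have hfib : ∀ U : Finset ℕ, U ⊆ V ∪ W → ∑ i ∈ Finset.range n,
      ∑ v ∈ U.filter (fun v => v.factorization p = i), s v = ∑ v ∈ U, s v := by
    intro U hU
    exact Finset.sum_fiberwise_of_maps_to (fun v hv => Finset.mem_range.2 (hn v (hU hv))) _
  have hfib' : ∀ (k : ℕ) (U : Finset ℕ), U ⊆ V ∪ W →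
      ∑ i ∈ (Finset.range n).filter (k ≤ ·),
        ∑ v ∈ U.filter (fun v => v.factorization p = i), s v =
      ∑ v ∈ U.filter (fun v => k ≤ v.factorization p), s v := by
    intro k U hU
    rw [← Finset.sum_fiberwise_of_maps_to (s := U.filter (fun v => k ≤ v.factorization p))
      (t := (Finset.range n).filter (k ≤ ·)) (g := fun v => v.factorization p)]
    · refine Finset.sum_congr rfl fun i hi => Finset.sum_congr ?_ fun _ _ => rfl
      rw [Finset.filter_filter]
      refine Finset.filter_congr fun v _ => ?_
      have := (Finset.mem_filter.1 hi).2
      constructor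
      · rintro rfl
        exact ⟨this, rfl⟩
      · exact fun h => h.2
    · intro v hv
      rw [Finset.mem_filter] at hv ⊢
      exact ⟨Finset.mem_range.2 (hn v (hU hv.1)), hv.2⟩
  have hEfib : ∀ D ⊆ E, ∑ e ∈ D, F e = ∑ i ∈ Finset.range n, ∑ j ∈ Finset.range n,
      ∑ e ∈ D.filter (fun e => e.1.factorization p = i ∧ e.2.factorization p = j), F e := by
    intro D hD
    have hmem : ∀ e ∈ D, e.1 ∈ V ∧ e.2 ∈ W := fun e he => Finset.mem_product.1 (hE (hD he))
    rw [← Finset.sum_fiberwise_of_maps_to (g := fun e : ℕ × ℕ => e.1.factorization p)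
      (fun e he => Finset.mem_range.2 (hn e.1 (Finset.mem_union_left _ (hmem e he).1)))]
    refine Finset.sum_congr rfl fun i _ => ?_
    rw [← Finset.sum_fiberwise_of_maps_to (g := fun e : ℕ × ℕ => e.2.factorization p)
      (fun e he => Finset.mem_range.2 (hn e.2 (Finset.mem_union_right _
        (hmem e (Finset.mem_filter.1 he).1).2)))]
    simp only [Finset.filter_filter]
  have hp2 : (2 : ℝ) ≤ p := by exact_mod_cast hp.two_le
  rw [← hfib V Finset.subset_union_left, ← hfib W Finset.subset_union_right]
  rcases hker (primeBeta p) (primeLam p) (primeBeta_nonneg p)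
    (by rw [primeBeta_pow]; rw [one_div]; exact inv_anti₀ (by norm_num) hp2)
    (primeLam_nonneg p) (by rw [primeLam_pow hp.one_le, primeBeta_pow]) n
    (fun i => ∑ v ∈ V.filter (fun v => v.factorization p = i), s v)
    (fun i => ∑ v ∈ W.filter (fun v => v.factorization p = i), s v)
    (fun i => Finset.sum_nonneg fun v _ => hs v) (fun i => Finset.sum_nonneg fun v _ => hs v)
    with hk | ⟨k, hk⟩
  · have := mul_le_mul_of_nonneg_left hk hG
    rw [hEfib E subset_rfl]
    refine le_trans (Finset.sum_le_sum fun i _ => Finset.sum_le_sum fun j _ => hpair i j) ?_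
    simp only [← Finset.mul_sum]
    linarith
  · have := mul_le_mul_of_nonneg_left hk hG
    rw [hfib' k V Finset.subset_union_left, hfib' k W Finset.subset_union_right, mul_add] at this
    rw [← Finset.sum_filter_add_sum_filter_not E
      (fun e => min (e.1.factorization p) (e.2.factorization p) = k)]
    have h2 : ∑ e ∈ E.filter (fun e => ¬ min (e.1.factorization p) (e.2.factorization p) = k), F e ≤
        C * kernelProd a b * ∑ i ∈ Finset.range n, ∑ j ∈ Finset.range n,
          (if min i j = k then 0 else primeKernel (primeBeta p) (primeLam p) i j *
            (fourthRoot (∑ v ∈ V.filter (fun v => v.factorization p = i), s v) *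
              fourthRoot (∑ w ∈ W.filter (fun w => w.factorization p = j), s w)) ^ 3) := by
      rw [hEfib _ (Finset.filter_subset _ _)]
      simp only [Finset.mul_sum]
      refine Finset.sum_le_sum fun i _ => Finset.sum_le_sum fun j _ => ?_
      rw [Finset.filter_filter]
      split_ifs with hij
      · rw [mul_zero, Finset.sum_eq_zero]
        intro e he
        obtain ⟨-, h1, h2, h3⟩ := Finset.mem_filter.1 he
        rw [h2, h3] at h1
        exact absurd hij h1
      · refine le_trans (le_of_eq ?_) (hpair i j)
        refine Finset.sum_congr (Finset.filter_congr fun e _ => ?_) fun _ _ => rfl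
        constructor
        · exact fun h => h.2
        · intro h
          rw [h.1, h.2]
          exact ⟨hij, rfl, rfl⟩
    have := hmerge k
    linarith

/-- The prime-by-prime induction. -/
theorem exists_localBound_prod : ∃ K : ℝ, 0 ≤ K ∧ ∀ (s : ℕ → ℝ) (F : ℕ × ℕ → ℝ)
    (A : Set (ℕ × ℕ)) (C : ℝ), (∀ v, 0 ≤ s v) → 0 ≤ C → LocalBound s F A C ∅ →
    ∀ 𝒬 : Finset ℕ, (∀ q ∈ 𝒬, q.Prime) →
      LocalBound s F A (C * ∏ p ∈ 𝒬, (1 + K * primeBeta p ^ 9)) 𝒬 := by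
  obtain ⟨K, hK, hstep⟩ := exists_localBound_insert
  refine ⟨K, hK, fun s F A C hs hC h 𝒬 => ?_⟩
  induction 𝒬 using Finset.induction_on with
  | empty => simpa using h
  | insert p 𝒬 hp ih =>
    intro h𝒬
    have h1 : ∀ q ∈ 𝒬, q.Prime := fun q hq => h𝒬 q (Finset.mem_insert_of_mem hq)
    rw [Finset.prod_insert hp, mul_comm (1 + _), ← mul_assoc]
    refine hstep s F A _ 𝒬 p hs (mul_nonneg hC (Finset.prod_nonneg fun q _ => ?_)) h1
      (h𝒬 p (Finset.mem_insert_self _ _)) hp (ih h1)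
    have := primeBeta_nonneg q
    positivity

/-- The product of the local losses converges. -/
lemma exists_prod_local_loss_le (K : ℝ) (hK : 0 ≤ K) : ∃ C : ℝ, 0 < C ∧ ∀ 𝒬 : Finset ℕ,
    ∏ p ∈ 𝒬, (1 + K * primeBeta p ^ 9) ≤ C := by
  have hsum : Summable fun p : ℕ => K * primeBeta p ^ 9 := by
    simp only [primeBeta_pow_nine]
    exact (Real.summable_nat_rpow_inv.2 (by norm_num)).mul_left K
  refine ⟨Real.exp (∑' p : ℕ, K * primeBeta p ^ 9), Real.exp_pos _, fun 𝒬 => ?_⟩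
  have nn : ∀ p : ℕ, 0 ≤ K * primeBeta p ^ 9 := fun p => by
    have := primeBeta_nonneg p
    positivity
  calc _ ≤ ∏ p ∈ 𝒬, Real.exp (K * primeBeta p ^ 9) :=
        Finset.prod_le_prod (fun p _ => by linarith [nn p]) fun p _ => by
          linarith [Real.add_one_le_exp (K * primeBeta p ^ 9)]
    _ = Real.exp (∑ p ∈ 𝒬, K * primeBeta p ^ 9) := (Real.exp_sum _ _).symm
    _ ≤ _ := Real.exp_le_exp.2 (hsum.sum_le_tsum _ fun p _ => nn p)

/-- The multiplicative weight `∏_{p ∣ n} (1 + p^{-1/2})`. -/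
noncomputable def primeWeight (n : ℕ) : ℝ := ∏ p ∈ n.primeFactors, (1 + (√(p : ℝ))⁻¹)

lemma one_le_primeWeight (n : ℕ) : 1 ≤ primeWeight n :=
  Finset.one_le_prod fun p _ => le_add_of_nonneg_right (by positivity)

lemma primeWeight_nonneg (n : ℕ) : 0 ≤ primeWeight n :=
  zero_le_one.trans (one_le_primeWeight n)

lemma one_add_pow_le_linear (k : ℕ) {x : ℝ} (hx : 0 ≤ x) (hx1 : x ≤ 1) :
    (1 + x) ^ k ≤ 1 + (2 ^ k - 1) * x := by
  induction k with
  | zero => simp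
  | succ k ih =>
    have h2 : (1 : ℝ) ≤ 2 ^ k := one_le_pow₀ (by norm_num)
    calc (1 + x) ^ (k + 1) = (1 + x) ^ k * (1 + x) := pow_succ _ _
      _ ≤ (1 + (2 ^ k - 1) * x) * (1 + x) := by gcongr
      _ ≤ _ := by
        rw [pow_succ]
        nlinarith [mul_nonneg (mul_nonneg (sub_nonneg.2 h2) hx) (sub_nonneg.2 hx1)]

lemma primeWeight_pow_le (k n : ℕ) :
    primeWeight n ^ k ≤ ∏ p ∈ n.primeFactors, (1 + 2 ^ k * (√(p : ℝ))⁻¹) := by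
  rw [primeWeight, ← Finset.prod_pow]
  refine Finset.prod_le_prod (fun p _ => by positivity) fun p hp => ?_
  have hp1 : (1 : ℝ) ≤ p := by exact_mod_cast (Nat.prime_of_mem_primeFactors hp).one_le
  have h0 : 0 ≤ (√(p : ℝ))⁻¹ := by positivity
  have h1 : (√(p : ℝ))⁻¹ ≤ 1 := inv_le_one_of_one_le₀ (Real.one_le_sqrt.2 hp1)
  have := one_add_pow_le_linear k h0 h1
  linarith

lemma summable_inv_sqrt_mul : Summable fun p : ℕ => (√(p : ℝ))⁻¹ * (p : ℝ)⁻¹ := by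
  have h : Summable fun p : ℕ => ((p : ℝ) ^ (3 / 2 : ℝ))⁻¹ :=
    Real.summable_nat_rpow_inv.2 (by norm_num)
  refine h.congr fun p => ?_
  rcases Nat.eq_zero_or_pos p with rfl | hp
  · simp
  rw [← mul_inv, Real.sqrt_eq_rpow]
  congr 1
  nth_rewrite 3 [← Real.rpow_one (p : ℝ)]
  rw [← Real.rpow_add (by positivity)]
  norm_num

/-- Powers of `primeWeight` are bounded on average against weights that are equidistributed
over multiples. -/
lemma exists_sum_primeWeight_pow_le (k : ℕ) : ∃ C : ℝ, 0 < C ∧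
    ∀ (U : Finset ℕ) (w : ℕ → ℝ) (B : ℝ), (∀ x ∈ U, 0 < x) → (∀ x ∈ U, 0 ≤ w x) →
    (∀ d : ℕ, 0 < d → ∑ x ∈ U with d ∣ x, w x ≤ B / d) →
    ∑ x ∈ U, w x * primeWeight x ^ k ≤ C * B := by
  set c : ℝ := 2 ^ k with hc
  have hc0 : 0 ≤ c := by positivity
  have hsum : Summable fun p : ℕ => c * ((√(p : ℝ))⁻¹ * (p : ℝ)⁻¹) :=
    summable_inv_sqrt_mul.mul_left c
  refine ⟨Real.exp (∑' p : ℕ, c * ((√(p : ℝ))⁻¹ * (p : ℝ)⁻¹)), Real.exp_pos _, ?_⟩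
  intro U w B hU hw hB
  have hB0 : 0 ≤ B := by
    have := hB 1 one_pos
    simp only [Nat.cast_one, div_one] at this
    exact (Finset.sum_nonneg fun x hx => hw x (Finset.mem_filter.1 hx).1).trans this
  set P := U.biUnion Nat.primeFactors with hP
  set G : Finset ℕ → ℝ := fun S => ∏ p ∈ S, c * (√(p : ℝ))⁻¹ with hG
  have hG0 : ∀ S, 0 ≤ G S := fun S => Finset.prod_nonneg fun p _ => by positivity
  have hprime : ∀ S ∈ P.powerset, ∀ p ∈ S, p.Prime := by
    intro S hS p hp
    obtain ⟨x, _, hx⟩ := Finset.mem_biUnion.1 (Finset.mem_powerset.1 hS hp)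
    exact Nat.prime_of_mem_primeFactors hx
  have h1 : ∀ x ∈ U, w x * primeWeight x ^ k ≤
      ∑ S ∈ P.powerset, if (∏ p ∈ S, p) ∣ x then w x * G S else 0 := by
    intro x hx
    have hexp : primeWeight x ^ k ≤ ∑ S ∈ x.primeFactors.powerset, G S := by
      refine (primeWeight_pow_le k x).trans (le_of_eq ?_)
      rw [← hc, ← Finset.prod_add_one]
      exact Finset.prod_congr rfl fun p _ => add_comm _ _
    calc w x * primeWeight x ^ k ≤ w x * ∑ S ∈ x.primeFactors.powerset, G S :=
          mul_le_mul_of_nonneg_left hexp (hw x hx)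
      _ = ∑ S ∈ x.primeFactors.powerset, if (∏ p ∈ S, p) ∣ x then w x * G S else 0 := by
          rw [Finset.mul_sum]
          refine Finset.sum_congr rfl fun S hS => ?_
          rw [if_pos]
          refine Finset.prod_primes_dvd x
            (fun p hp => (Nat.prime_of_mem_primeFactors (Finset.mem_powerset.1 hS hp)).prime)
            fun p hp => Nat.dvd_of_mem_primeFactors (Finset.mem_powerset.1 hS hp)
      _ ≤ _ := by
          refine Finset.sum_le_sum_of_subset_of_nonneg
            (Finset.powerset_mono.2 (Finset.subset_biUnion_of_mem Nat.primeFactors hx)) ?_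
          intro S _ _
          split_ifs
          · exact mul_nonneg (hw x hx) (hG0 S)
          · exact le_rfl
  calc ∑ x ∈ U, w x * primeWeight x ^ k
      ≤ ∑ x ∈ U, ∑ S ∈ P.powerset, (if (∏ p ∈ S, p) ∣ x then w x * G S else 0) :=
        Finset.sum_le_sum h1
    _ = ∑ S ∈ P.powerset, (∑ x ∈ U with (∏ p ∈ S, p) ∣ x, w x) * G S := by
        rw [Finset.sum_comm]
        refine Finset.sum_congr rfl fun S _ => ?_
        rw [← Finset.sum_filter, Finset.sum_mul]
    _ ≤ ∑ S ∈ P.powerset, B * ∏ p ∈ S, c * ((√(p : ℝ))⁻¹ * (p : ℝ)⁻¹) := by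
        refine Finset.sum_le_sum fun S hS => ?_
        have hpos : 0 < ∏ p ∈ S, p := Finset.prod_pos fun p hp => (hprime S hS p hp).pos
        calc _ ≤ B / ((∏ p ∈ S, p : ℕ) : ℝ) * G S :=
              mul_le_mul_of_nonneg_right (hB _ hpos) (hG0 S)
          _ = B * ∏ p ∈ S, c * ((√(p : ℝ))⁻¹ * (p : ℝ)⁻¹) := by
              rw [hG, Nat.cast_prod]
              simp only [Finset.prod_mul_distrib, Finset.prod_inv_distrib]
              ring
    _ = B * ∏ p ∈ P, (1 + c * ((√(p : ℝ))⁻¹ * (p : ℝ)⁻¹)) := by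
        rw [← Finset.mul_sum, ← Finset.prod_add_one]
        congr 1
        exact Finset.prod_congr rfl fun p _ => add_comm _ _
    _ ≤ B * Real.exp (∑' p : ℕ, c * ((√(p : ℝ))⁻¹ * (p : ℝ)⁻¹)) := by
        refine mul_le_mul_of_nonneg_left ?_ hB0
        calc _ ≤ ∏ p ∈ P, Real.exp (c * ((√(p : ℝ))⁻¹ * (p : ℝ)⁻¹)) :=
              Finset.prod_le_prod (fun p _ => by positivity) fun p _ => by
                linarith [Real.add_one_le_exp (c * ((√(p : ℝ))⁻¹ * (p : ℝ)⁻¹))]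
          _ = Real.exp (∑ p ∈ P, c * ((√(p : ℝ))⁻¹ * (p : ℝ)⁻¹)) := (Real.exp_sum _ _).symm
          _ ≤ _ := Real.exp_le_exp.2 (hsum.sum_le_tsum _ fun p _ => by positivity)
    _ = _ := mul_comm _ _

lemma card_filter_dvd_le {U : Finset ℕ} {Z : ℝ} (hZ : 0 ≤ Z)
    (hU : ∀ x ∈ U, 0 < x ∧ (x : ℝ) ≤ Z) (d : ℕ) :
    (((U.filter (d ∣ ·)).card : ℕ) : ℝ) ≤ Z / d := by
  have hsub : U.filter (d ∣ ·) ⊆ (Finset.Ioc 0 ⌊Z⌋₊).filter (d ∣ ·) := by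
    intro y hy
    rw [Finset.mem_filter] at hy ⊢
    exact ⟨Finset.mem_Ioc.2 ⟨(hU y hy.1).1, Nat.le_floor (hU y hy.1).2⟩, hy.2⟩
  calc _ ≤ ((⌊Z⌋₊ / d : ℕ) : ℝ) := by
        exact_mod_cast (Finset.card_le_card hsub).trans
          (Nat.Ioc_filter_dvd_card_eq_div ⌊Z⌋₊ d).le
    _ ≤ (⌊Z⌋₊ : ℝ) / d := Nat.cast_div_le
    _ ≤ Z / d := by
        gcongr
        exact Nat.floor_le hZ

lemma exists_sum_primeWeight_le (k : ℕ) : ∃ C : ℝ, 0 < C ∧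
    ∀ (U : Finset ℕ) (Z : ℝ), 0 ≤ Z → (∀ x ∈ U, 0 < x ∧ (x : ℝ) ≤ Z) →
    ∑ x ∈ U, primeWeight x ^ k ≤ C * Z := by
  obtain ⟨C, hC, h⟩ := exists_sum_primeWeight_pow_le k
  refine ⟨C, hC, fun U Z hZ hU => ?_⟩
  have := h U (fun _ => 1) Z (fun x hx => (hU x hx).1) (fun _ _ => zero_le_one) fun d _ => ?_
  · simpa using this
  · simpa using card_filter_dvd_le hZ hU d

lemma sum_inv_sq_le {U : Finset ℕ} {M : ℕ} (hM : 0 < M) (hU : ∀ x ∈ U, M ≤ x) :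
    ∑ x ∈ U, ((x : ℝ) ^ 2)⁻¹ ≤ 2 / M := by
  obtain ⟨M, rfl⟩ := Nat.exists_eq_add_one.2 hM
  have hsub : U ⊆ Finset.Ioo M (U.sup id + 1) := by
    intro x hx
    refine Finset.mem_Ioo.2 ⟨hU x hx, Nat.lt_succ_of_le (Finset.le_sup (f := id) hx)⟩
  refine (Finset.sum_le_sum_of_subset_of_nonneg hsub fun x _ _ => by positivity).trans ?_
  exact_mod_cast sum_Ioo_inv_sq_le (α := ℝ) M (U.sup id + 1)

lemma sum_filter_dvd_inv_sq_le {U : Finset ℕ} {Z : ℝ} (hZ : 0 < Z)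
    (hU : ∀ x ∈ U, Z ≤ (x : ℝ)) {d : ℕ} (hd : 0 < d) :
    ∑ x ∈ U with d ∣ x, ((x : ℝ) ^ 2)⁻¹ ≤ 2 / Z / d := by
  have hd' : (0 : ℝ) < d := by exact_mod_cast hd
  have hinj : Set.InjOn (· / d) ((U.filter (d ∣ ·) : Finset ℕ) : Set ℕ) := by
    intro x hx y hy hxy
    rw [Finset.mem_coe, Finset.mem_filter] at hx hy
    obtain ⟨x, rfl⟩ := hx.2
    obtain ⟨y, rfl⟩ := hy.2
    simp only [Nat.mul_div_cancel_left _ hd] at hxy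
    rw [hxy]
  have hM : 0 < ⌈Z / d⌉₊ := Nat.ceil_pos.2 (by positivity)
  calc ∑ x ∈ U with d ∣ x, ((x : ℝ) ^ 2)⁻¹
      = ∑ x ∈ U with d ∣ x, ((d : ℝ) ^ 2)⁻¹ * (((x / d : ℕ) : ℝ) ^ 2)⁻¹ := by
        refine Finset.sum_congr rfl fun x hx => ?_
        obtain ⟨y, rfl⟩ := (Finset.mem_filter.1 hx).2
        rw [Nat.mul_div_cancel_left _ hd, Nat.cast_mul, mul_pow, mul_inv]
    _ = ((d : ℝ) ^ 2)⁻¹ * ∑ y ∈ (U.filter (d ∣ ·)).image (· / d), ((y : ℝ) ^ 2)⁻¹ := by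
        rw [Finset.sum_image hinj, Finset.mul_sum]
    _ ≤ ((d : ℝ) ^ 2)⁻¹ * (2 / ⌈Z / d⌉₊) := by
        refine mul_le_mul_of_nonneg_left (sum_inv_sq_le hM fun y hy => ?_) (by positivity)
        obtain ⟨x, hx, rfl⟩ := Finset.mem_image.1 hy
        obtain ⟨hx1, x, rfl⟩ := Finset.mem_filter.1 hx
        rw [Nat.mul_div_cancel_left _ hd]
        refine Nat.ceil_le.2 ((div_le_iff₀' hd').2 ?_)
        exact_mod_cast hU _ hx1
    _ ≤ ((d : ℝ) ^ 2)⁻¹ * (2 / (Z / d)) := by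
        gcongr
        exact Nat.le_ceil _
    _ = 2 / Z / d := by field_simp

lemma exists_sum_primeWeight_div_sq_le (k : ℕ) : ∃ C : ℝ, 0 < C ∧
    ∀ (U : Finset ℕ) (Z : ℝ), 0 < Z → (∀ x ∈ U, Z ≤ (x : ℝ)) →
    ∑ x ∈ U, primeWeight x ^ k / (x : ℝ) ^ 2 ≤ C / Z := by
  obtain ⟨C, hC, h⟩ := exists_sum_primeWeight_pow_le k
  refine ⟨C * 2, by positivity, fun U Z hZ hU => ?_⟩
  have := h U (fun x => ((x : ℝ) ^ 2)⁻¹) (2 / Z)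
    (fun x hx => by exact_mod_cast hZ.trans_le (hU x hx)) (fun _ _ => by positivity)
    fun d hd => sum_filter_dvd_inv_sq_le hZ hU hd
  calc _ = ∑ x ∈ U, ((x : ℝ) ^ 2)⁻¹ * primeWeight x ^ k :=
        Finset.sum_congr rfl fun x _ => by rw [div_eq_inv_mul]
    _ ≤ _ := this
    _ = _ := by ring

lemma sum_inv_sqrt_le {U : Finset ℕ} {Z : ℝ} (hU : ∀ x ∈ U, 0 < x ∧ (x : ℝ) ≤ Z) :
    ∑ x ∈ U, (√(x : ℝ))⁻¹ ≤ 2 * √Z := by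
  have key : ∀ n : ℕ, ∑ x ∈ Finset.range n, (√((x + 1 : ℕ) : ℝ))⁻¹ ≤ 2 * √n := by
    intro n
    induction n with
    | zero => simp
    | succ n ih =>
      rw [Finset.sum_range_succ]
      have h1 : 0 < √((n + 1 : ℕ) : ℝ) := Real.sqrt_pos.2 (by positivity)
      have h2 : √((n + 1 : ℕ) : ℝ) ^ 2 = n + 1 := by
        rw [Real.sq_sqrt (by positivity)]; push_cast; ring
      have h3 : √(n : ℝ) ^ 2 = n := Real.sq_sqrt (by positivity)
      have h4 : (√((n + 1 : ℕ) : ℝ))⁻¹ ≤ 2 * √((n + 1 : ℕ) : ℝ) - 2 * √(n : ℝ) := by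
        rw [inv_le_iff_one_le_mul₀ h1]
        nlinarith [sq_nonneg (√((n + 1 : ℕ) : ℝ) - √(n : ℝ))]
      linarith
  rcases U.eq_empty_or_nonempty with rfl | ⟨x, hx⟩
  · simp
  have hZ : 0 ≤ Z := le_trans (by positivity) (hU x hx).2
  have hsub : U ⊆ (Finset.range ⌊Z⌋₊).image (fun n : ℕ => n + 1) := by
    intro y hy
    obtain ⟨h1, h2⟩ := hU y hy
    have := Nat.le_floor h2
    exact Finset.mem_image.2 ⟨y - 1, Finset.mem_range.2 (by omega), by omega⟩
  calc _ ≤ ∑ x ∈ (Finset.range ⌊Z⌋₊).image (fun n : ℕ => n + 1), (√((x : ℕ) : ℝ))⁻¹ :=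
        Finset.sum_le_sum_of_subset_of_nonneg hsub fun x _ _ => by positivity
    _ = ∑ x ∈ Finset.range ⌊Z⌋₊, (√((x + 1 : ℕ) : ℝ))⁻¹ :=
        Finset.sum_image fun x _ y _ h => by simpa using h
    _ ≤ 2 * √(⌊Z⌋₊ : ℝ) := key _
    _ ≤ 2 * √Z := by
        gcongr
        exact Nat.floor_le hZ

lemma sum_le_of_left_fibers {E : Finset (ℕ × ℕ)} {X Y : Finset ℕ} (hE : E ⊆ X ×ˢ Y)
    (G : ℕ × ℕ → ℝ) (P : ℕ → ℝ)
    (h : ∀ x ∈ X, ∑ y ∈ Y with (x, y) ∈ E, G (x, y) ≤ P x) :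
    ∑ e ∈ E, G e ≤ ∑ x ∈ X, P x := by
  rw [Finset.sum_finset_product E X fun x => Y.filter fun y => (x, y) ∈ E]
  · exact Finset.sum_le_sum h
  · intro e
    rw [Finset.mem_filter]
    refine ⟨fun he => ⟨(Finset.mem_product.1 (hE he)).1, (Finset.mem_product.1 (hE he)).2, he⟩,
      fun he => he.2.2⟩

lemma sum_le_of_right_fibers {E : Finset (ℕ × ℕ)} {X Y : Finset ℕ} (hE : E ⊆ X ×ˢ Y)
    (G : ℕ × ℕ → ℝ) (P : ℕ → ℝ)
    (h : ∀ y ∈ Y, ∑ x ∈ X with (x, y) ∈ E, G (x, y) ≤ P y) :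
    ∑ e ∈ E, G e ≤ ∑ y ∈ Y, P y := by
  rw [Finset.sum_finset_product_right E Y fun y => X.filter fun x => (x, y) ∈ E]
  · exact Finset.sum_le_sum h
  · intro e
    rw [Finset.mem_filter]
    refine ⟨fun he => ⟨(Finset.mem_product.1 (hE he)).2, (Finset.mem_product.1 (hE he)).1, he⟩,
      fun he => he.2.2⟩

/-- Weighted sum of the fourth power of `primeWeight` over pairs with `x τ(y) ≤ A`,
`y σ(x) ≤ B`. -/
lemma exists_sum_primeWeight_left_le : ∃ C : ℝ, 0 < C ∧
    ∀ (σ τ : ℕ → ℝ) (A B κ : ℝ) (X Y : Finset ℕ) (E : Finset (ℕ × ℕ)),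
    (∀ x, 0 ≤ σ x) → (∀ y, 0 ≤ τ y) → 0 ≤ A → 0 ≤ B → 0 < κ → E ⊆ X ×ˢ Y →
    (∀ e ∈ E, 0 < e.1 ∧ 0 < e.2 ∧ e.1 * τ e.2 ≤ A ∧ e.2 * σ e.1 ≤ B) →
    ∑ e ∈ E, σ e.1 * τ e.2 * primeWeight e.1 ^ 4 ≤
      C * (κ * A * ∑ x ∈ X, σ x + κ⁻¹ * B * ∑ y ∈ Y, τ y) := by
  obtain ⟨C₁, hC₁, h₁⟩ := exists_sum_primeWeight_le 4
  obtain ⟨C₂, hC₂, h₂⟩ := exists_sum_primeWeight_div_sq_le 20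
  refine ⟨2 + C₁ + C₂, by positivity, ?_⟩
  intro σ τ A B κ X Y E hσ hτ hA hB hκ hE hEB
  have hm : 0 ≤ ∑ x ∈ X, σ x := Finset.sum_nonneg fun x _ => hσ x
  have hm' : 0 ≤ ∑ y ∈ Y, τ y := Finset.sum_nonneg fun y _ => hτ y
  set E₁ := E.filter fun e => (e.2 : ℝ) ≤ κ * e.1 with hE₁
  set E₂ := E.filter fun e => ¬ (e.2 : ℝ) ≤ κ * e.1 with hE₂
  have hE₁s : E₁ ⊆ X ×ˢ Y := (Finset.filter_subset _ _).trans hE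
  have hE₂s : E₂ ⊆ X ×ˢ Y := (Finset.filter_subset _ _).trans hE
  have b₁ : ∑ e ∈ E₁, σ e.1 * τ e.2 * (√(κ * e.1) * (√(e.2 : ℝ))⁻¹) ≤
      ∑ x ∈ X, 2 * (κ * A) * σ x := by
    refine sum_le_of_left_fibers hE₁s (fun e => σ e.1 * τ e.2 * (√(κ * e.1) * (√(e.2 : ℝ))⁻¹))
      _ fun x _ => ?_
    have hmem : ∀ y ∈ Y.filter fun y => (x, y) ∈ E₁, 0 < x ∧ 0 < y ∧ x * τ y ≤ A ∧
        (y : ℝ) ≤ κ * x := by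
      intro y hy
      obtain ⟨h3, h4⟩ := Finset.mem_filter.1 (Finset.mem_filter.1 hy).2
      exact ⟨(hEB _ h3).1, (hEB _ h3).2.1, (hEB _ h3).2.2.1, h4⟩
    rcases Nat.eq_zero_or_pos x with rfl | hx
    · rw [Finset.sum_eq_zero]
      · have := hσ 0
        positivity
      · intro y hy
        exact absurd (hmem y hy).1 (lt_irrefl 0)
    have hx' : (0 : ℝ) < x := by exact_mod_cast hx
    calc _ ≤ ∑ y ∈ Y with (x, y) ∈ E₁, σ x * (A / x) * √(κ * x) * (√(y : ℝ))⁻¹ := by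
          refine Finset.sum_le_sum fun y hy => ?_
          have h5 : τ y ≤ A / x := (le_div_iff₀' hx').2 (hmem y hy).2.2.1
          have := hσ x
          calc _ = σ x * τ y * √(κ * x) * (√(y : ℝ))⁻¹ := by ring
            _ ≤ _ := by gcongr
      _ ≤ σ x * (A / x) * √(κ * x) * (2 * √(κ * x)) := by
          rw [← Finset.mul_sum]
          refine mul_le_mul_of_nonneg_left
            (sum_inv_sqrt_le fun y hy => ⟨(hmem y hy).2.1, (hmem y hy).2.2.2⟩) ?_
          have := hσ x
          positivity
      _ = σ x * (A / x) * 2 * (√(κ * x) * √(κ * x)) := by ring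
      _ = 2 * (κ * A) * σ x := by
          rw [Real.mul_self_sqrt (by positivity)]
          field_simp
  have b₂ : ∑ e ∈ E₁, σ e.1 * τ e.2 *
      (primeWeight e.1 ^ 20 / (e.1 : ℝ) ^ 2 * ((e.2 : ℝ) / κ) ^ 2) ≤
      ∑ y ∈ Y, C₂ * (κ⁻¹ * B) * τ y := by
    refine sum_le_of_right_fibers hE₁s (fun e => σ e.1 * τ e.2 *
      (primeWeight e.1 ^ 20 / (e.1 : ℝ) ^ 2 * ((e.2 : ℝ) / κ) ^ 2)) _ fun y _ => ?_
    have hmem : ∀ x ∈ X.filter fun x => (x, y) ∈ E₁, 0 < y ∧ y * σ x ≤ B ∧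
        (y : ℝ) / κ ≤ x := by
      intro x hx
      obtain ⟨h3, h4⟩ := Finset.mem_filter.1 (Finset.mem_filter.1 hx).2
      exact ⟨(hEB _ h3).2.1, (hEB _ h3).2.2.2, (div_le_iff₀' hκ).2 h4⟩
    rcases Nat.eq_zero_or_pos y with rfl | hy
    · rw [Finset.sum_eq_zero]
      · have := hτ 0
        positivity
      · intro x hx
        exact absurd (hmem x hx).1 (lt_irrefl 0)
    have hy' : (0 : ℝ) < y := by exact_mod_cast hy
    calc _ ≤ ∑ x ∈ X with (x, y) ∈ E₁,
          τ y * (B / y) * ((y : ℝ) / κ) ^ 2 * (primeWeight x ^ 20 / (x : ℝ) ^ 2) := by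
          refine Finset.sum_le_sum fun x hx => ?_
          have h5 : σ x ≤ B / y := (le_div_iff₀' hy').2 (hmem x hx).2.1
          have := hτ y
          have := primeWeight_nonneg x
          calc _ = τ y * σ x * ((y : ℝ) / κ) ^ 2 * (primeWeight x ^ 20 / (x : ℝ) ^ 2) := by ring
            _ ≤ _ := by gcongr
      _ ≤ τ y * (B / y) * ((y : ℝ) / κ) ^ 2 * (C₂ / ((y : ℝ) / κ)) := by
          rw [← Finset.mul_sum]
          refine mul_le_mul_of_nonneg_left
            (h₂ _ _ (by positivity) fun x hx => (hmem x hx).2.2) ?_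
          have := hτ y
          positivity
      _ = C₂ * (κ⁻¹ * B) * τ y := by field_simp
  have b₃ : ∑ e ∈ E₂, σ e.1 * τ e.2 * primeWeight e.1 ^ 4 ≤
      ∑ y ∈ Y, C₁ * (κ⁻¹ * B) * τ y := by
    refine sum_le_of_right_fibers hE₂s (fun e => σ e.1 * τ e.2 * primeWeight e.1 ^ 4) _
      fun y _ => ?_
    have hmem : ∀ x ∈ X.filter fun x => (x, y) ∈ E₂, 0 < x ∧ 0 < y ∧ y * σ x ≤ B ∧
        (x : ℝ) ≤ y / κ := by
      intro x hx
      obtain ⟨h3, h4⟩ := Finset.mem_filter.1 (Finset.mem_filter.1 hx).2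
      exact ⟨(hEB _ h3).1, (hEB _ h3).2.1, (hEB _ h3).2.2.2,
        (le_div_iff₀' hκ).2 (not_le.1 h4).le⟩
    rcases Nat.eq_zero_or_pos y with rfl | hy
    · rw [Finset.sum_eq_zero]
      · have := hτ 0
        positivity
      · intro x hx
        exact absurd (hmem x hx).2.1 (lt_irrefl 0)
    have hy' : (0 : ℝ) < y := by exact_mod_cast hy
    calc _ ≤ ∑ x ∈ X with (x, y) ∈ E₂, τ y * (B / y) * primeWeight x ^ 4 := by
          refine Finset.sum_le_sum fun x hx => ?_
          have h5 : σ x ≤ B / y := (le_div_iff₀' hy').2 (hmem x hx).2.2.1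
          have := hτ y
          have := primeWeight_nonneg x
          calc _ = τ y * σ x * primeWeight x ^ 4 := by ring
            _ ≤ _ := by gcongr
      _ ≤ τ y * (B / y) * (C₁ * (y / κ)) := by
          rw [← Finset.mul_sum]
          refine mul_le_mul_of_nonneg_left
            (h₁ _ _ (by positivity) fun x hx => ⟨(hmem x hx).1, (hmem x hx).2.2.2⟩) ?_
          have := hτ y
          positivity
      _ = C₁ * (κ⁻¹ * B) * τ y := by field_simp
  have split : ∀ e ∈ E₁, σ e.1 * τ e.2 * primeWeight e.1 ^ 4 ≤
      σ e.1 * τ e.2 * (√(κ * e.1) * (√(e.2 : ℝ))⁻¹) +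
      σ e.1 * τ e.2 * (primeWeight e.1 ^ 20 / (e.1 : ℝ) ^ 2 * ((e.2 : ℝ) / κ) ^ 2) := by
    intro e he
    obtain ⟨h3, -⟩ := Finset.mem_filter.1 he
    have hx : (0 : ℝ) < e.1 := by exact_mod_cast (hEB _ h3).1
    have hy : (0 : ℝ) < e.2 := by exact_mod_cast (hEB _ h3).2.1
    have hw := primeWeight_nonneg e.1
    rw [← mul_add]
    refine mul_le_mul_of_nonneg_left ?_ (mul_nonneg (hσ _) (hτ _))
    set r := √(κ * e.1) * (√(e.2 : ℝ))⁻¹ with hr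
    have hr0 : 0 < r := by positivity
    have hr4 : r ^ 4 = (κ * e.1 / e.2) ^ 2 := by
      rw [hr, mul_pow, inv_pow, show (4 : ℕ) = 2 * 2 from rfl, pow_mul, pow_mul,
        Real.sq_sqrt (by positivity), Real.sq_sqrt hy.le]
      field_simp
    have heq : primeWeight e.1 ^ 20 / (e.1 : ℝ) ^ 2 * ((e.2 : ℝ) / κ) ^ 2 =
        (primeWeight e.1 ^ 4) ^ 5 / r ^ 4 := by
      rw [hr4]
      field_simp
    rw [heq]
    rcases le_total (primeWeight e.1 ^ 4) r with h | h
    · have : 0 ≤ (primeWeight e.1 ^ 4) ^ 5 / r ^ 4 := by positivity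
      linarith
    · have : primeWeight e.1 ^ 4 ≤ (primeWeight e.1 ^ 4) ^ 5 / r ^ 4 := by
        rw [le_div_iff₀ (by positivity), pow_succ' _ 4]
        gcongr
      linarith
  calc _ = ∑ e ∈ E₁, σ e.1 * τ e.2 * primeWeight e.1 ^ 4 +
        ∑ e ∈ E₂, σ e.1 * τ e.2 * primeWeight e.1 ^ 4 :=
        (Finset.sum_filter_add_sum_filter_not _ _ _).symm
    _ ≤ ((∑ x ∈ X, 2 * (κ * A) * σ x) + ∑ y ∈ Y, C₂ * (κ⁻¹ * B) * τ y) +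
        ∑ y ∈ Y, C₁ * (κ⁻¹ * B) * τ y := by
        refine add_le_add ((Finset.sum_le_sum split).trans ?_) b₃
        rw [Finset.sum_add_distrib]
        exact add_le_add b₁ b₂
    _ ≤ _ := by
        rw [← Finset.mul_sum, ← Finset.mul_sum, ← Finset.mul_sum]
        have h6 : 0 ≤ κ * A * ∑ x ∈ X, σ x := by positivity
        have h7 : 0 ≤ κ⁻¹ * B * ∑ y ∈ Y, τ y := by positivity
        nlinarith [mul_nonneg hC₁.le h6, mul_nonneg hC₂.le h6, mul_nonneg hC₁.le h7,
          mul_nonneg hC₂.le h7]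

lemma le_sqrt_of_forall_le {T c P Q : ℝ} (hP : 0 ≤ P) (hQ : 0 ≤ Q) (hc : 0 ≤ c)
    (h : ∀ κ : ℝ, 0 < κ → T ≤ c * (κ * P + κ⁻¹ * Q)) : T ≤ 2 * c * √(P * Q) := by
  have key : ∀ ε : ℝ, 0 < ε → T ≤ 2 * c * √((P + ε) * (Q + ε)) := by
    intro ε hε
    have hp : 0 < √(P + ε) := Real.sqrt_pos.2 (by positivity)
    have hq : 0 < √(Q + ε) := Real.sqrt_pos.2 (by positivity)
    have hp2 : √(P + ε) ^ 2 = P + ε := Real.sq_sqrt (by positivity)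
    have hq2 : √(Q + ε) ^ 2 = Q + ε := Real.sq_sqrt (by positivity)
    calc T ≤ c * (√(Q + ε) / √(P + ε) * P + (√(Q + ε) / √(P + ε))⁻¹ * Q) :=
          h _ (by positivity)
      _ ≤ c * (√(Q + ε) / √(P + ε) * √(P + ε) ^ 2 +
            (√(Q + ε) / √(P + ε))⁻¹ * √(Q + ε) ^ 2) := by
          rw [hp2, hq2]
          gcongr <;> linarith
      _ = 2 * c * (√(P + ε) * √(Q + ε)) := by
          field_simp
          ring
      _ = _ := by rw [Real.sqrt_mul (by positivity)]
  have hlim : Tendsto (fun ε : ℝ => 2 * c * √((P + ε) * (Q + ε))) (nhdsWithin 0 (Set.Ioi 0))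
      (nhds (2 * c * √((P + 0) * (Q + 0)))) := by
    refine Tendsto.mono_left (Continuous.tendsto ?_ 0) nhdsWithin_le_nhds
    fun_prop
  rw [add_zero, add_zero] at hlim
  exact ge_of_tendsto hlim (eventually_nhdsWithin_of_forall fun ε hε => key ε hε)

/-- The unstructured bilinear estimate. -/
lemma exists_sum_primeWeight_mul_le : ∃ K : ℝ, 0 < K ∧
    ∀ (σ τ : ℕ → ℝ) (A B : ℝ) (X Y : Finset ℕ) (E : Finset (ℕ × ℕ)),
    (∀ x, 0 ≤ σ x) → (∀ y, 0 ≤ τ y) → 0 ≤ A → 0 ≤ B → E ⊆ X ×ˢ Y →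
    (∀ e ∈ E, 0 < e.1 ∧ 0 < e.2 ∧ e.1 * τ e.2 ≤ A ∧ e.2 * σ e.1 ≤ B) →
    ∑ e ∈ E, σ e.1 * τ e.2 * (primeWeight e.1 * primeWeight e.2) ≤
      K * fourthRoot (A * B) *
        (fourthRoot (∑ x ∈ X, σ x) * fourthRoot (∑ y ∈ Y, τ y)) ^ 3 := by
  obtain ⟨C, hC, h⟩ := exists_sum_primeWeight_left_le
  refine ⟨√(2 * C), Real.sqrt_pos.2 (by positivity), ?_⟩
  intro σ τ A B X Y E hσ hτ hA hB hE hEB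
  set m := ∑ x ∈ X, σ x with hm
  set m' := ∑ y ∈ Y, τ y with hm'
  have hm0 : 0 ≤ m := Finset.sum_nonneg fun x _ => hσ x
  have hm0' : 0 ≤ m' := Finset.sum_nonneg fun y _ => hτ y
  set S := ∑ e ∈ E, σ e.1 * τ e.2 * (primeWeight e.1 * primeWeight e.2) with hS
  have hS0 : 0 ≤ S := Finset.sum_nonneg fun e _ =>
    mul_nonneg (mul_nonneg (hσ _) (hτ _))
      (mul_nonneg (primeWeight_nonneg _) (primeWeight_nonneg _))
  have hright : ∀ κ : ℝ, 0 < κ → ∑ e ∈ E, σ e.1 * τ e.2 * primeWeight e.2 ^ 4 ≤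
      C * (κ⁻¹ * B * m' + κ * A * m) := by
    intro κ hκ
    have h1 := h τ σ B A κ⁻¹ Y X (E.image Prod.swap) hτ hσ hB hA (inv_pos.2 hκ) ?_ ?_
    · rw [inv_inv, Finset.sum_image fun e _ e' _ h => Prod.swap_injective h] at h1
      refine le_trans (le_of_eq ?_) h1
      exact Finset.sum_congr rfl fun e _ => by rw [Prod.fst_swap, Prod.snd_swap]; ring
    · intro e he
      obtain ⟨e, he', rfl⟩ := Finset.mem_image.1 he
      have := Finset.mem_product.1 (hE he')
      exact Finset.mem_product.2 ⟨this.2, this.1⟩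
    · intro e he
      obtain ⟨e, he', rfl⟩ := Finset.mem_image.1 he
      obtain ⟨h1, h2, h3, h4⟩ := hEB e he'
      exact ⟨h2, h1, h4, h3⟩
  have hsq : ∑ e ∈ E, σ e.1 * τ e.2 * (primeWeight e.1 * primeWeight e.2) ^ 2 ≤
      2 * C * √(A * m * (B * m')) := by
    refine le_sqrt_of_forall_le (by positivity) (by positivity) hC.le fun κ hκ => ?_
    have h1 := h σ τ A B κ X Y E hσ hτ hA hB hκ hE hEB
    have h2 := hright κ hκ
    have h3 : ∑ e ∈ E, σ e.1 * τ e.2 * (primeWeight e.1 * primeWeight e.2) ^ 2 ≤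
        (∑ e ∈ E, σ e.1 * τ e.2 * primeWeight e.1 ^ 4 +
          ∑ e ∈ E, σ e.1 * τ e.2 * primeWeight e.2 ^ 4) / 2 := by
      rw [← Finset.sum_add_distrib, Finset.sum_div]
      refine Finset.sum_le_sum fun e _ => ?_
      have := mul_nonneg (hσ e.1) (hτ e.2)
      nlinarith [mul_nonneg this (sq_nonneg (primeWeight e.1 ^ 2 - primeWeight e.2 ^ 2))]
    linarith
  have hone : ∑ e ∈ E, σ e.1 * τ e.2 ≤ m * m' := by
    rw [hm, hm', Finset.sum_mul_sum, ← Finset.sum_product']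
    exact Finset.sum_le_sum_of_subset_of_nonneg hE fun e _ _ => mul_nonneg (hσ _) (hτ _)
  have hcs : S ^ 2 ≤ (∑ e ∈ E, σ e.1 * τ e.2) *
      ∑ e ∈ E, σ e.1 * τ e.2 * (primeWeight e.1 * primeWeight e.2) ^ 2 := by
    refine Finset.sum_sq_le_sum_mul_sum_of_sq_le_mul E
      (fun e _ => mul_nonneg (hσ _) (hτ _)) (fun e _ => ?_) fun e _ => le_of_eq (by ring)
    exact mul_nonneg (mul_nonneg (hσ _) (hτ _)) (sq_nonneg _)
  have hfin : S ^ 2 ≤ (√(2 * C) * fourthRoot (A * B) *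
      (fourthRoot m * fourthRoot m') ^ 3) ^ 2 := by
    calc S ^ 2 ≤ m * m' * (2 * C * √(A * m * (B * m'))) := by
          refine hcs.trans (mul_le_mul hone hsq (Finset.sum_nonneg fun e _ => ?_) (by positivity))
          exact mul_nonneg (mul_nonneg (hσ _) (hτ _)) (sq_nonneg _)
      _ = _ := by
          have e1 : √(A * m * (B * m')) =
              √(A * B) * (fourthRoot m ^ 2 * fourthRoot m' ^ 2) := by
            rw [fourthRoot_sq, fourthRoot_sq, ← Real.sqrt_mul hm0, ← Real.sqrt_mul (by positivity)]
            congr 1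
            ring
          have e2 : fourthRoot m ^ 4 = m := fourthRoot_pow hm0
          have e3 : fourthRoot m' ^ 4 = m' := fourthRoot_pow hm0'
          have e4 : fourthRoot (A * B) ^ 2 = √(A * B) := fourthRoot_sq _
          have e5 : √(2 * C) ^ 2 = 2 * C := Real.sq_sqrt (by positivity)
          calc _ = fourthRoot m ^ 4 * fourthRoot m' ^ 4 * (√(2 * C) ^ 2 *
                (fourthRoot (A * B) ^ 2 * (fourthRoot m ^ 2 * fourthRoot m' ^ 2))) := by
                rw [e2, e3, e4, e5, e1]
            _ = _ := by ring
  refine (sq_le_sq₀ hS0 ?_).1 hfin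
  have := fourthRoot_nonneg m
  have := fourthRoot_nonneg m'
  have := fourthRoot_nonneg (A * B)
  positivity

/-- The density `∏_{p ∣ n} (1 - 1/p) = φ(n)/n`. -/
noncomputable def totientRatio (n : ℕ) : ℝ := ∏ p ∈ n.primeFactors, (1 - (p : ℝ)⁻¹)

lemma one_sub_inv_pos {p : ℕ} (hp : p.Prime) : 0 < 1 - (p : ℝ)⁻¹ := by
  have : (1 : ℝ) < p := by exact_mod_cast hp.one_lt
  linarith [inv_lt_one_of_one_lt₀ this]

lemma one_sub_inv_le (p : ℕ) : 1 - (p : ℝ)⁻¹ ≤ 1 := by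
  have : (0 : ℝ) ≤ (p : ℝ)⁻¹ := by positivity
  linarith

lemma totientRatio_pos (n : ℕ) : 0 < totientRatio n :=
  Finset.prod_pos fun _ hp => one_sub_inv_pos (Nat.prime_of_mem_primeFactors hp)

lemma prod_one_sub_inv_le_of_subset {S T : Finset ℕ} (hST : S ⊆ T) (hT : ∀ p ∈ T, p.Prime) :
    ∏ p ∈ T, (1 - (p : ℝ)⁻¹) ≤ ∏ p ∈ S, (1 - (p : ℝ)⁻¹) := by
  rw [← Finset.prod_sdiff hST]
  refine mul_le_of_le_one_left
    (Finset.prod_nonneg fun p hp => (one_sub_inv_pos (hT p (hST hp))).le) ?_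
  exact Finset.prod_le_one
    (fun p hp => (one_sub_inv_pos (hT p (Finset.mem_sdiff.1 hp).1)).le) fun p _ => one_sub_inv_le p

lemma totientRatio_le_one (n : ℕ) : totientRatio n ≤ 1 :=
  Finset.prod_le_one (fun _ hp => (one_sub_inv_pos (Nat.prime_of_mem_primeFactors hp)).le)
    fun p _ => one_sub_inv_le p

lemma totientRatio_le_of_dvd {m n : ℕ} (hn : n ≠ 0) (h : m ∣ n) :
    totientRatio n ≤ totientRatio m :=
  prod_one_sub_inv_le_of_subset (Nat.primeFactors_mono h hn)
    fun _ hp => Nat.prime_of_mem_primeFactors hp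

lemma totient_eq_mul_totientRatio (n : ℕ) : (n.totient : ℝ) = n * totientRatio n := by
  have h := Nat.totient_eq_mul_prod_factors n
  have h2 : ((n.totient : ℚ) : ℝ) = ((n * ∏ p ∈ n.primeFactors, (1 - (p : ℚ)⁻¹) : ℚ) : ℝ) := by
    rw [h]
  push_cast at h2
  exact h2

lemma primeWeight_mul_le {m n : ℕ} (hm : m ≠ 0) (hn : n ≠ 0) :
    primeWeight (m * n) ≤ primeWeight m * primeWeight n := by
  unfold primeWeight
  rw [Nat.primeFactors_mul hm hn, ← Finset.prod_union_inter]
  refine le_mul_of_one_le_right (Finset.prod_nonneg fun p _ => by positivity)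
    (Finset.one_le_prod fun p _ => le_add_of_nonneg_right (by positivity))

/-- `primeWeight` of the product of the two cofactors of the gcd. -/
noncomputable def pairWeight (v w : ℕ) : ℝ := primeWeight (v / v.gcd w * (w / v.gcd w))

lemma one_le_pairWeight (v w : ℕ) : 1 ≤ pairWeight v w := one_le_primeWeight _

lemma pairWeight_le_prod {a b : ℕ} (ha : 0 < a) (hb : 0 < b) :
    pairWeight a b ≤ ∏ p ∈ (a * b).primeFactors,
      (if a.factorization p = b.factorization p then 1 else 1 + primeBeta p ^ 4) := by
  have hsub : (a / a.gcd b * (b / a.gcd b)).primeFactors ⊆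
      (a * b).primeFactors.filter fun p => ¬ a.factorization p = b.factorization p := by
    intro p hp
    have hpp := Nat.prime_of_mem_primeFactors hp
    have hpd := Nat.dvd_of_mem_primeFactors hp
    have hga := Nat.gcd_dvd_left a b
    have hgb := Nat.gcd_dvd_right a b
    rw [Finset.mem_filter]
    refine ⟨Nat.mem_primeFactors.2 ⟨hpp, hpd.trans
      (mul_dvd_mul (Nat.div_dvd_of_dvd hga) (Nat.div_dvd_of_dvd hgb)), by positivity⟩, ?_⟩
    intro heq
    have h1 : (a.gcd b).factorization p = a.factorization p := by
      rw [Nat.factorization_gcd ha.ne' hb.ne']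
      simp [heq]
    have ha' : 0 < a / a.gcd b := Nat.div_pos (Nat.le_of_dvd ha hga) (Nat.gcd_pos_of_pos_left _ ha)
    have hb' : 0 < b / a.gcd b := Nat.div_pos (Nat.le_of_dvd hb hgb) (Nat.gcd_pos_of_pos_left _ ha)
    rcases hpp.dvd_mul.1 hpd with h | h
    · have := hpp.factorization_pos_of_dvd ha'.ne' h
      rw [Nat.factorization_div hga, Finsupp.tsub_apply] at this
      omega
    · have := hpp.factorization_pos_of_dvd hb'.ne' h
      rw [Nat.factorization_div hgb, Finsupp.tsub_apply] at this
      omega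
  rw [Finset.prod_ite, Finset.prod_const_one, one_mul, pairWeight, primeWeight,
    ← Finset.prod_sdiff hsub]
  simp only [primeBeta_pow_four]
  refine le_mul_of_one_le_left (Finset.prod_nonneg fun p _ => by positivity)
    (Finset.one_le_prod fun p _ => le_add_of_nonneg_right (by positivity))

lemma prod_pow_factorization_of_subset {n : ℕ} (hn : n ≠ 0) {S : Finset ℕ}
    (hS : n.primeFactors ⊆ S) : ∏ p ∈ S, (p : ℝ) ^ n.factorization p = n := by
  conv_rhs => rw [← Nat.prod_factorization_pow_eq_self hn]
  rw [Finsupp.prod_of_support_subset (s := S) _ (by simpa using hS) _ (by simp), Nat.cast_prod]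
  simp

lemma totientRatio_eq_prod_ite {n : ℕ} {S : Finset ℕ} (hS : n.primeFactors ⊆ S)
    (hS' : ∀ p ∈ S, p.Prime) (hn : n ≠ 0) :
    totientRatio n = ∏ p ∈ S, (1 - (p : ℝ)⁻¹) ^ (if n.factorization p = 0 then 0 else 1) := by
  have h : ∏ p ∈ S, (1 - (p : ℝ)⁻¹) ^ (if n.factorization p = 0 then 0 else 1) =
      ∏ p ∈ S, if p ∈ n.primeFactors then 1 - (p : ℝ)⁻¹ else 1 := by
    refine Finset.prod_congr rfl fun p hp => ?_
    by_cases hpn : p ∣ n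
    · rw [if_pos (Nat.mem_primeFactors.2 ⟨hS' p hp, hpn, hn⟩), if_neg, pow_one]
      exact ((hS' p hp).factorization_pos_of_dvd hn hpn).ne'
    · rw [if_neg fun h => hpn (Nat.dvd_of_mem_primeFactors h),
        if_pos (Nat.factorization_eq_zero_of_not_dvd hpn), pow_zero]
  rw [h, Finset.prod_ite_mem, Finset.inter_eq_right.2 hS, totientRatio]

lemma fourthRoot_mul_pairWeight_le_kernelProd {a b : ℕ} (ha : 0 < a) (hb : 0 < b) :
    fourthRoot (totientRatio b * ((a.gcd b : ℕ) / a) * (totientRatio a * ((a.gcd b : ℕ) / b))) *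
      pairWeight a b ≤ kernelProd a b := by
  set S := (a * b).primeFactors with hS
  have hSp : ∀ p ∈ S, p.Prime := fun p hp => Nat.prime_of_mem_primeFactors hp
  have hab : a * b ≠ 0 := by positivity
  have haS : a.primeFactors ⊆ S := Nat.primeFactors_mono (dvd_mul_right a b) hab
  have hbS : b.primeFactors ⊆ S := Nat.primeFactors_mono (dvd_mul_left b a) hab
  have hg : 0 < a.gcd b := Nat.gcd_pos_of_pos_left _ ha
  have hgS : (a.gcd b).primeFactors ⊆ S :=
    (Nat.primeFactors_mono (Nat.gcd_dvd_left a b) ha.ne').trans haS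
  set Q : ℝ := ∏ p ∈ S, primeLam p ^ ((if a.factorization p = 0 then 0 else 1) +
    (if b.factorization p = 0 then 0 else 1)) *
      primeBeta p ^ (2 * Nat.dist (a.factorization p) (b.factorization p)) with hQ
  have hQ0 : 0 ≤ Q := Finset.prod_nonneg fun p _ => by
    have := primeBeta_nonneg p
    have := primeLam_nonneg p
    positivity
  have hQ4 : totientRatio b * ((a.gcd b : ℕ) / a) * (totientRatio a * ((a.gcd b : ℕ) / b)) =
      Q ^ 4 := by
    rw [totientRatio_eq_prod_ite haS hSp ha.ne', totientRatio_eq_prod_ite hbS hSp hb.ne',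
      ← prod_pow_factorization_of_subset hg.ne' hgS,
      ← prod_pow_factorization_of_subset ha.ne' haS, ← prod_pow_factorization_of_subset hb.ne' hbS]
    simp only [← Finset.prod_mul_distrib, ← Finset.prod_div_distrib, hQ, ← Finset.prod_pow]
    refine Finset.prod_congr rfl fun p hp => ?_
    have hp0 : (p : ℝ) ≠ 0 := by exact_mod_cast (hSp p hp).ne_zero
    have hlam := primeLam_pow (hSp p hp).one_le
    have hbeta := primeBeta_pow p
    rw [Nat.factorization_gcd ha.ne' hb.ne', Finsupp.inf_apply, mul_pow, ← pow_mul, ← pow_mul,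
      mul_comm _ 4, pow_mul, hlam, show 2 * Nat.dist (a.factorization p) (b.factorization p) * 4 =
        8 * Nat.dist (a.factorization p) (b.factorization p) by ring, pow_mul, hbeta, pow_add]
    have key : ∀ i j : ℕ, (p : ℝ) ^ (i ⊓ j) / (p : ℝ) ^ i * ((p : ℝ) ^ (i ⊓ j) / (p : ℝ) ^ j) =
        (p : ℝ)⁻¹ ^ Nat.dist i j := by
      intro i j
      rcases le_total i j with h | h
      · rw [inf_eq_left.2 h, Nat.dist_eq_sub_of_le h, div_self (pow_ne_zero _ hp0), one_mul,
          inv_pow, pow_sub₀ _ hp0 h]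
        field_simp
      · rw [inf_eq_right.2 h, Nat.dist_eq_sub_of_le_right h, div_self (pow_ne_zero _ hp0), mul_one,
          inv_pow, pow_sub₀ _ hp0 h]
        field_simp
    rw [← key]
    ring
  have hQfr : fourthRoot (Q ^ 4) = Q := by
    have h1 := fourthRoot_pow (pow_nonneg hQ0 4)
    exact (pow_left_inj₀ (fourthRoot_nonneg _) hQ0 (by norm_num)).1 h1
  rw [hQ4, hQfr, kernelProd]
  calc Q * pairWeight a b ≤ Q * _ :=
        mul_le_mul_of_nonneg_left (pairWeight_le_prod ha hb) hQ0
    _ = _ := by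
        rw [hQ, ← Finset.prod_mul_distrib]
        exact Finset.prod_congr rfl fun p _ => rfl

/-- Pairs whose weighted cofactors are at most `T`. -/
def CofactorBound (s : ℕ → ℝ) (T : ℝ) : Set (ℕ × ℕ) :=
  {e | ((e.1 / e.1.gcd e.2 : ℕ) : ℝ) * (s e.2 / totientRatio e.2) ≤ T ∧
    ((e.2 / e.1.gcd e.2 : ℕ) : ℝ) * (s e.1 / totientRatio e.1) ≤ T}

lemma gcd_eq_of_min_factorization_eq {a b v w : ℕ} (ha : 0 < a) (hb : 0 < b) (hv : 0 < v)
    (hw : 0 < w) (h : ∀ p, p.Prime → min (v.factorization p) (w.factorization p) =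
      min (a.factorization p) (b.factorization p)) : v.gcd w = a.gcd b := by
  refine Nat.eq_of_factorization_eq (Nat.gcd_pos_of_pos_left _ hv).ne'
    (Nat.gcd_pos_of_pos_left _ ha).ne' fun p => ?_
  rw [Nat.factorization_gcd hv.ne' hw.ne', Nat.factorization_gcd ha.ne' hb.ne']
  by_cases hp : p.Prime
  · exact h p hp
  · simp [Nat.factorization_eq_zero_of_not_prime, hp]

lemma sum_image_div_le {s : ℕ → ℝ} (hs : ∀ v, 0 ≤ s v) {a : ℕ} (ha : 0 < a) (V : Finset ℕ) :
    ∑ x ∈ (V.filter (a ∣ ·)).image (· / a), s (a * x) ≤ ∑ v ∈ V, s v := by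
  have hinj : Set.InjOn (fun x : ℕ => x / a) ((V.filter (a ∣ ·) : Finset ℕ) : Set ℕ) := by
    intro x hx y hy hxy
    rw [Finset.mem_coe, Finset.mem_filter] at hx hy
    obtain ⟨x, rfl⟩ := hx.2
    obtain ⟨y, rfl⟩ := hy.2
    simp only [Nat.mul_div_cancel_left _ ha] at hxy
    rw [hxy]
  rw [Finset.sum_image hinj]
  calc _ = ∑ v ∈ V with a ∣ v, s v := Finset.sum_congr rfl fun v hv => by
        rw [Nat.mul_div_cancel' (Finset.mem_filter.1 hv).2]
    _ ≤ _ := Finset.sum_le_sum_of_subset_of_nonneg (Finset.filter_subset _ _) fun v _ _ => hs v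

lemma exists_localBound_empty : ∃ K : ℝ, 0 < K ∧ ∀ (s : ℕ → ℝ) (T : ℝ), (∀ v, 0 ≤ s v) → 0 ≤ T →
    LocalBound s (fun e => s e.1 * s e.2 * pairWeight e.1 e.2) (CofactorBound s T) (K * √T) ∅ := by
  obtain ⟨K, hK, h⟩ := exists_sum_primeWeight_mul_le
  refine ⟨K, hK, fun s T hs hT a b ha hb _ V W E hE hEA => ?_⟩
  have hmem : ∀ e ∈ E, ∃ x y : ℕ, 0 < x ∧ 0 < y ∧ e = (a * x, b * y) ∧
      (a * x).gcd (b * y) = a.gcd b ∧ a * x ∈ V ∧ b * y ∈ W ∧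
      (a * x, b * y) ∈ CofactorBound s T := by
    intro e he
    obtain ⟨hA, h1, h2, ⟨x, hx⟩, ⟨y, hy⟩, h5⟩ := hEA e he
    have heq : e = (a * x, b * y) := Prod.ext hx hy
    subst heq
    have hVW := Finset.mem_product.1 (hE he)
    exact ⟨x, y, Nat.pos_of_mul_pos_left h1, Nat.pos_of_mul_pos_left h2, rfl,
      gcd_eq_of_min_factorization_eq ha hb h1 h2 fun p hp => h5 p hp (Finset.notMem_empty p),
      hVW.1, hVW.2, hA⟩
  set g := a.gcd b with hg
  have hg0 : 0 < g := Nat.gcd_pos_of_pos_left _ ha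
  have hga : g ∣ a := Nat.gcd_dvd_left a b
  have hgb : g ∣ b := Nat.gcd_dvd_right a b
  have ha' : (0 : ℝ) < a := by exact_mod_cast ha
  have hb' : (0 : ℝ) < b := by exact_mod_cast hb
  have hg' : (0 : ℝ) < g := by exact_mod_cast hg0
  have hra := totientRatio_pos a
  have hrb := totientRatio_pos b
  set A := T * (totientRatio b * (g / a)) with hA
  set B := T * (totientRatio a * (g / b)) with hB
  have hinj : Set.InjOn (fun e : ℕ × ℕ => (e.1 / a, e.2 / b)) (E : Set (ℕ × ℕ)) := by
    intro e he e' he' hee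
    obtain ⟨x, y, hx, hy, rfl, -⟩ := hmem e he
    obtain ⟨x', y', hx', hy', rfl, -⟩ := hmem e' he'
    simp only [Nat.mul_div_cancel_left _ ha, Nat.mul_div_cancel_left _ hb, Prod.mk.injEq] at hee
    rw [hee.1, hee.2]
  have hmain := h (fun x => s (a * x)) (fun y => s (b * y)) A B
    ((V.filter (a ∣ ·)).image (· / a)) ((W.filter (b ∣ ·)).image (· / b))
    (E.image fun e : ℕ × ℕ => (e.1 / a, e.2 / b)) (fun _ => hs _) (fun _ => hs _)
    (by positivity) (by positivity) ?_ ?_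
  · rw [Finset.sum_image hinj] at hmain
    have hfr := fourthRoot_mul_pairWeight_le_kernelProd ha hb
    have hAB : fourthRoot (A * B) = √T * fourthRoot (totientRatio b * ((g : ℕ) / a) *
        (totientRatio a * ((g : ℕ) / b))) := by
      rw [show A * B = T ^ 2 * (totientRatio b * ((g : ℕ) / a) *
        (totientRatio a * ((g : ℕ) / b))) by rw [hA, hB]; ring, fourthRoot_mul (by positivity)]
      congr 1
      rw [fourthRoot, Real.sqrt_sq hT]
    have hV := fourthRoot_le (sum_image_div_le hs ha V)
    have hW := fourthRoot_le (sum_image_div_le hs hb W)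
    have hw0 : 0 ≤ pairWeight a b := zero_le_one.trans (one_le_pairWeight a b)
    have hF : ∑ e ∈ E, s e.1 * s e.2 * pairWeight e.1 e.2 ≤
        pairWeight a b * ∑ e ∈ E, s (a * (e.1 / a)) * s (b * (e.2 / b)) *
          (primeWeight (e.1 / a) * primeWeight (e.2 / b)) := by
      rw [Finset.mul_sum]
      refine Finset.sum_le_sum fun e he => ?_
      obtain ⟨x, y, hx, hy, rfl, hgcd, -⟩ := hmem e he
      simp only [Nat.mul_div_cancel_left _ ha, Nat.mul_div_cancel_left _ hb]
      have hpw : pairWeight (a * x) (b * y) ≤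
          pairWeight a b * (primeWeight x * primeWeight y) := by
        have ha1 : a / g ≠ 0 := (Nat.div_pos (Nat.le_of_dvd ha hga) hg0).ne'
        have hb1 : b / g ≠ 0 := (Nat.div_pos (Nat.le_of_dvd hb hgb) hg0).ne'
        calc pairWeight (a * x) (b * y) = primeWeight ((a / g * (b / g)) * (x * y)) := by
              rw [pairWeight, hgcd, Nat.mul_div_right_comm hga, Nat.mul_div_right_comm hgb]
              congr 1
              ring
          _ ≤ pairWeight a b * primeWeight (x * y) :=
              primeWeight_mul_le (mul_ne_zero ha1 hb1) (by positivity)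
          _ ≤ _ := mul_le_mul_of_nonneg_left (primeWeight_mul_le hx.ne' hy.ne') hw0
      have := mul_nonneg (hs (a * x)) (hs (b * y))
      calc _ ≤ s (a * x) * s (b * y) * (pairWeight a b * (primeWeight x * primeWeight y)) :=
            mul_le_mul_of_nonneg_left hpw this
        _ = _ := by ring
    have n1 := fourthRoot_nonneg (∑ x ∈ (V.filter (a ∣ ·)).image (· / a), s (a * x))
    have n2 := fourthRoot_nonneg (∑ x ∈ (W.filter (b ∣ ·)).image (· / b), s (b * x))
    have n3 := fourthRoot_nonneg (∑ v ∈ V, s v)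
    have n4 := fourthRoot_nonneg (∑ v ∈ W, s v)
    have n5 := kernelProd_nonneg a b
    refine hF.trans ((mul_le_mul_of_nonneg_left hmain hw0).trans ?_)
    rw [hAB]
    calc _ = K * √T * (fourthRoot (totientRatio b * ((g : ℕ) / a) *
          (totientRatio a * ((g : ℕ) / b))) * pairWeight a b) *
          (fourthRoot (∑ x ∈ (V.filter (a ∣ ·)).image (· / a), s (a * x)) *
            fourthRoot (∑ x ∈ (W.filter (b ∣ ·)).image (· / b), s (b * x))) ^ 3 := by ring
      _ ≤ _ := by gcongr
  · intro e' he'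
    obtain ⟨e, he, rfl⟩ := Finset.mem_image.1 he'
    obtain ⟨x, y, hx, hy, rfl, hgcd, hxV, hyW, -⟩ := hmem e he
    exact Finset.mem_product.2
      ⟨Finset.mem_image_of_mem _ (Finset.mem_filter.2 ⟨hxV, dvd_mul_right a x⟩),
        Finset.mem_image_of_mem _ (Finset.mem_filter.2 ⟨hyW, dvd_mul_right b y⟩)⟩
  · intro e' he'
    obtain ⟨e, he, rfl⟩ := Finset.mem_image.1 he'
    obtain ⟨x, y, hx, hy, rfl, hgcd, hxV, hyW, hC1, hC2⟩ := hmem e he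
    simp only [Nat.mul_div_cancel_left _ ha, Nat.mul_div_cancel_left _ hb]
    have cof : ∀ c z : ℕ, g ∣ c → ((c * z / g : ℕ) : ℝ) = c * z / g := by
      intro c z hgc
      rw [Nat.cast_div (hgc.mul_right z) hg'.ne']
      push_cast
      rfl
    simp only [hgcd] at hC1 hC2
    rw [cof a x hga] at hC1
    rw [cof b y hgb] at hC2
    have hrw := totientRatio_pos (b * y)
    have hrv := totientRatio_pos (a * x)
    have hle1 := totientRatio_le_of_dvd (Nat.mul_ne_zero hb.ne' hy.ne') (dvd_mul_right b y)
    have hle2 := totientRatio_le_of_dvd (Nat.mul_ne_zero ha.ne' hx.ne') (dvd_mul_right a x)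
    refine ⟨hx, hy, ?_, ?_⟩
    · calc (x : ℝ) * s (b * y) = (a * x / g * (s (b * y) / totientRatio (b * y))) *
            (totientRatio (b * y) * (g / a)) := by field_simp
        _ ≤ T * (totientRatio b * (g / a)) := by gcongr
    · calc (y : ℝ) * s (a * x) = (b * y / g * (s (a * x) / totientRatio (a * x))) *
            (totientRatio (a * x) * (g / b)) := by field_simp
        _ ≤ T * (totientRatio a * (g / b)) := by gcongr

/-- The bilinear estimate over pairs with bounded weighted cofactors. -/
lemma exists_sum_pairWeight_le : ∃ K : ℝ, 0 < K ∧ ∀ (s : ℕ → ℝ) (T : ℝ) (V : Finset ℕ)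
    (E : Finset (ℕ × ℕ)), (∀ v, 0 ≤ s v) → 0 ≤ T → (∀ v ∈ V, 0 < v) → E ⊆ V ×ˢ V →
    (∀ e ∈ E, e ∈ CofactorBound s T) →
    ∑ e ∈ E, s e.1 * s e.2 * pairWeight e.1 e.2 ≤
      K * √T * ((∑ v ∈ V, s v) * √(∑ v ∈ V, s v)) := by
  obtain ⟨K, hK, hbase⟩ := exists_localBound_empty
  obtain ⟨L, hL, hstep⟩ := exists_localBound_prod
  obtain ⟨C, hC, hprod⟩ := exists_prod_local_loss_le L hL
  refine ⟨K * C, by positivity, fun s T V E hs hT hV hE hEA => ?_⟩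
  set m := ∑ v ∈ V, s v with hm
  have hm0 : 0 ≤ m := Finset.sum_nonneg fun v _ => hs v
  set 𝒬 := V.biUnion Nat.primeFactors with h𝒬
  have hp𝒬 : ∀ q ∈ 𝒬, q.Prime := by
    intro q hq
    obtain ⟨v, _, hqv⟩ := Finset.mem_biUnion.1 hq
    exact Nat.prime_of_mem_primeFactors hqv
  have h := hstep s _ _ _ hs (by positivity) (hbase s T hs hT) 𝒬 hp𝒬 1 1 one_pos one_pos
    (fun p hp => ⟨(hp𝒬 p hp).not_dvd_one, (hp𝒬 p hp).not_dvd_one⟩) V V E hE ?_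
  · rw [kernelProd_one, mul_one] at h
    refine h.trans ?_
    have h1 : (fourthRoot m * fourthRoot m) ^ 3 = m * √m := by
      rw [← fourthRoot_sq]
      nth_rewrite 3 [← fourthRoot_pow hm0]
      ring
    rw [h1, show K * C * √T = K * √T * C by ring]
    have := hprod 𝒬
    gcongr
  · intro e he
    have hVV := Finset.mem_product.1 (hE he)
    refine ⟨hEA e he, hV _ hVV.1, hV _ hVV.2, one_dvd _, one_dvd _, fun p hp hp𝒬' => ?_⟩
    have : ¬ p ∣ e.1 := fun hd => hp𝒬' (Finset.mem_biUnion.2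
      ⟨e.1, hVV.1, Nat.mem_primeFactors.2 ⟨hp, hd, (hV _ hVV.1).ne'⟩⟩)
    simp [Nat.factorization_eq_zero_of_not_dvd this]

lemma sum_log_primeFactors_le {k : ℕ} (hk : 0 < k) :
    ∑ p ∈ k.primeFactors, Real.log p ≤ Real.log k := by
  rw [← Real.log_prod fun p hp => by exact_mod_cast (Nat.prime_of_mem_primeFactors hp).ne_zero]
  refine Real.log_le_log (Finset.prod_pos fun p hp => by
    exact_mod_cast (Nat.prime_of_mem_primeFactors hp).pos) ?_
  rw [← Nat.cast_prod]
  exact Nat.cast_le.2 (Nat.le_of_dvd hk (Nat.prod_primeFactors_dvd k))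

/-- The primes up to `n`. -/
def primesUpTo (n : ℕ) : Finset ℕ := (Finset.Icc 1 n).filter Nat.Prime

lemma mem_primesUpTo {n p : ℕ} : p ∈ primesUpTo n ↔ p.Prime ∧ p ≤ n := by
  rw [primesUpTo, Finset.mem_filter, Finset.mem_Icc]
  exact ⟨fun h => ⟨h.2, h.1.2⟩, fun h => ⟨⟨h.1.one_le, h.2⟩, h.1⟩⟩

lemma sum_log_primesUpTo_le (n : ℕ) : ∑ p ∈ primesUpTo n, Real.log p ≤ Real.log 4 * n := by
  have h := Chebyshev.theta_le_log4_mul_x (x := n) (by positivity)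
  rw [Chebyshev.theta_eq_sum_Icc, Nat.floor_natCast] at h
  refine le_trans (Finset.sum_le_sum_of_subset_of_nonneg ?_ fun p _ _ => ?_) h
  · intro p hp
    obtain ⟨h1, h2⟩ := mem_primesUpTo.1 hp
    exact Finset.mem_filter.2 ⟨Finset.mem_Icc.2 ⟨Nat.zero_le _, h2⟩, h1⟩
  · exact Real.log_natCast_nonneg p

lemma sum_log_div_le {n : ℕ} (hn : 0 < n) :
    ∑ p ∈ primesUpTo n, Real.log p / p ≤ Real.log n + Real.log 4 := by
  have hn' : (0 : ℝ) < n := by exact_mod_cast hn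
  have h1 : ∑ p ∈ primesUpTo n, Real.log p * ((n / p : ℕ) : ℝ) ≤ n * Real.log n := by
    calc _ = ∑ p ∈ primesUpTo n, ∑ k ∈ Finset.Ioc 0 n with p ∣ k, Real.log p := by
          refine Finset.sum_congr rfl fun p _ => ?_
          rw [Finset.sum_const, Nat.Ioc_filter_dvd_card_eq_div, nsmul_eq_mul, mul_comm]
      _ = ∑ k ∈ Finset.Ioc 0 n, ∑ p ∈ primesUpTo n with p ∣ k, Real.log p := by
          simp only [Finset.sum_filter]
          exact Finset.sum_comm
      _ ≤ ∑ k ∈ Finset.Ioc 0 n, Real.log n := by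
          refine Finset.sum_le_sum fun k hk => ?_
          obtain ⟨hk0, hkn⟩ := Finset.mem_Ioc.1 hk
          refine le_trans (Finset.sum_le_sum_of_subset_of_nonneg ?_ fun p _ _ =>
            Real.log_natCast_nonneg p) ((sum_log_primeFactors_le hk0).trans
              (Real.log_le_log (by exact_mod_cast hk0) (by exact_mod_cast hkn)))
          intro p hp
          obtain ⟨h1, h2⟩ := Finset.mem_filter.1 hp
          exact Nat.mem_primeFactors.2 ⟨(mem_primesUpTo.1 h1).1, h2, hk0.ne'⟩
      _ = n * Real.log n := by simp
  have h2 : ∑ p ∈ primesUpTo n, Real.log p / p * n ≤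
      ∑ p ∈ primesUpTo n, (Real.log p * ((n / p : ℕ) : ℝ) + Real.log p) := by
    refine Finset.sum_le_sum fun p hp => ?_
    have hp0 : (0 : ℝ) < p := by exact_mod_cast (mem_primesUpTo.1 hp).1.pos
    have h3 : (n : ℝ) / p ≤ ((n / p : ℕ) : ℝ) + 1 := by
      rw [← Nat.floor_div_eq_div (K := ℝ)]
      exact (Nat.lt_floor_add_one _).le
    have h4 := Real.log_natCast_nonneg p
    calc _ = Real.log p * (n / p) := by ring
      _ ≤ Real.log p * (((n / p : ℕ) : ℝ) + 1) := by gcongr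
      _ = _ := by ring
  rw [Finset.sum_add_distrib, ← Finset.sum_mul] at h2
  have h5 := sum_log_primesUpTo_le n
  rw [← mul_le_mul_iff_left₀ hn']
  nlinarith

lemma primesUpTo_succ (n : ℕ) : primesUpTo (n + 1) =
    if (n + 1).Prime then insert (n + 1) (primesUpTo n) else primesUpTo n := by
  ext p
  split_ifs with h
  · rw [Finset.mem_insert, mem_primesUpTo, mem_primesUpTo]
    constructor
    · rintro ⟨h1, h2⟩
      rcases Nat.lt_or_ge n p with h3 | h3
      · exact Or.inl (by omega)
      · exact Or.inr ⟨h1, h3⟩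
    · rintro (rfl | h1)
      · exact ⟨h, le_rfl⟩
      · exact ⟨h1.1, by omega⟩
  · rw [mem_primesUpTo, mem_primesUpTo]
    refine ⟨fun h1 => ⟨h1.1, ?_⟩, fun h1 => ⟨h1.1, by omega⟩⟩
    have : p ≠ n + 1 := fun h2 => h (h2 ▸ h1.1)
    omega

/-- Mertens' second theorem, upper bound. -/
lemma sum_inv_primesUpTo_le {n : ℕ} (hn : 2 ≤ n) :
    ∑ p ∈ primesUpTo n, (p : ℝ)⁻¹ ≤
      Real.log (Real.log n) + (3 - Real.log (Real.log 2)) := by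
  have hl4 : Real.log 4 = 2 * Real.log 2 := by
    rw [show (4 : ℝ) = 2 ^ 2 by norm_num, Real.log_pow]
    norm_num
  have hl2 : 0 < Real.log 2 := Real.log_pos (by norm_num)
  set A : ℕ → ℝ := fun n => ∑ p ∈ primesUpTo n, Real.log p / p with hA
  have key : ∑ p ∈ primesUpTo n, (p : ℝ)⁻¹ - A n / Real.log n ≤
      Real.log (Real.log n) - Real.log 4 / Real.log n + (2 - Real.log (Real.log 2)) := by
    induction n, hn using Nat.le_induction with
    | base =>
      have : primesUpTo 2 = {2} := by decide
      simp only [hA, this, Finset.sum_singleton, Nat.cast_ofNat]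
      rw [hl4]
      field_simp
      linarith
    | succ n hn ih =>
      have hln : 0 < Real.log n := Real.log_pos (by exact_mod_cast hn)
      have hlt : Real.log n < Real.log (n + 1 : ℕ) :=
        Real.log_lt_log (by positivity) (by push_cast; linarith)
      have hln' : 0 < Real.log (n + 1 : ℕ) := hln.trans hlt
      have hstep : ∑ p ∈ primesUpTo (n + 1), (p : ℝ)⁻¹ - A (n + 1) / Real.log (n + 1 : ℕ) =
          ∑ p ∈ primesUpTo n, (p : ℝ)⁻¹ - A n / Real.log (n + 1 : ℕ) := by
        simp only [hA]
        rw [primesUpTo_succ]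
        split_ifs with h
        · have hnot : n + 1 ∉ primesUpTo n := fun h => by
            have := (mem_primesUpTo.1 h).2
            omega
          rw [Finset.sum_insert hnot, Finset.sum_insert hnot, add_div]
          have : Real.log (n + 1 : ℕ) / ((n + 1 : ℕ) : ℝ) / Real.log (n + 1 : ℕ) =
              ((n + 1 : ℕ) : ℝ)⁻¹ := by field_simp
          rw [this]
          ring
        · rfl
      have hAn : A n ≤ Real.log n + Real.log 4 := sum_log_div_le (by omega)
      have hinv : 0 ≤ (Real.log n)⁻¹ - (Real.log (n + 1 : ℕ))⁻¹ :=
        sub_nonneg.2 (inv_anti₀ hln hlt.le)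
      have hmul := mul_le_mul_of_nonneg_right hAn hinv
      have hu : 1 - Real.log n / Real.log (n + 1 : ℕ) ≤
          Real.log (Real.log (n + 1 : ℕ)) - Real.log (Real.log n) := by
        have := Real.log_le_sub_one_of_pos (div_pos hln hln')
        rw [Real.log_div hln.ne' hln'.ne'] at this
        linarith
      rw [hstep]
      have e1 : Real.log n * ((Real.log n)⁻¹ - (Real.log (n + 1 : ℕ))⁻¹) =
          1 - Real.log n / Real.log (n + 1 : ℕ) := by
        field_simp
      simp only [div_eq_mul_inv] at *
      nlinarith
  have hln : 0 < Real.log n := Real.log_pos (by exact_mod_cast hn)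
  have hAn : A n / Real.log n ≤ 1 + Real.log 4 / Real.log n := by
    rw [← div_self hln.ne', ← add_div]
    exact div_le_div_of_nonneg_right (sum_log_div_le (by omega)) hln.le
  linarith

lemma inv_one_sub_inv_le {p : ℕ} (hp : p.Prime) :
    (1 - (p : ℝ)⁻¹)⁻¹ ≤ Real.exp ((p : ℝ)⁻¹ + 2 * ((p : ℝ) ^ 2)⁻¹) := by
  have hp2 : (2 : ℝ) ≤ p := by exact_mod_cast hp.two_le
  refine le_trans ?_ (Real.add_one_le_exp _)
  set x := (p : ℝ)⁻¹ with hx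
  have hx0 : 0 < x := by positivity
  have hx1 : x ≤ 1 / 2 := by
    rw [hx, one_div]
    exact inv_anti₀ (by norm_num) hp2
  rw [← inv_pow, ← hx, inv_le_iff_one_le_mul₀ (by linarith)]
  nlinarith [mul_nonneg (sq_nonneg x) (by linarith : (0:ℝ) ≤ 1 - 2 * x)]

/-- Mertens' third theorem, upper bound. -/
lemma exists_prod_inv_primesUpTo_le : ∃ C : ℝ, 0 < C ∧ ∀ n : ℕ, 2 ≤ n →
    ∏ p ∈ primesUpTo n, (1 - (p : ℝ)⁻¹)⁻¹ ≤ C * Real.log n := by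
  have hsum : Summable fun p : ℕ => 2 * ((p : ℝ) ^ 2)⁻¹ :=
    (Real.summable_nat_pow_inv.2 one_lt_two).mul_left 2
  refine ⟨Real.exp ((3 - Real.log (Real.log 2)) + ∑' p : ℕ, 2 * ((p : ℝ) ^ 2)⁻¹),
    Real.exp_pos _, fun n hn => ?_⟩
  have hln : 0 < Real.log n := Real.log_pos (by exact_mod_cast hn)
  calc _ ≤ ∏ p ∈ primesUpTo n, Real.exp ((p : ℝ)⁻¹ + 2 * ((p : ℝ) ^ 2)⁻¹) :=
        Finset.prod_le_prod
          (fun p hp => inv_nonneg.2 (one_sub_inv_pos (mem_primesUpTo.1 hp).1).le)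
          fun p hp => inv_one_sub_inv_le (mem_primesUpTo.1 hp).1
    _ = Real.exp (∑ p ∈ primesUpTo n, (p : ℝ)⁻¹ + ∑ p ∈ primesUpTo n, 2 * ((p : ℝ) ^ 2)⁻¹) := by
        rw [← Real.exp_sum, Finset.sum_add_distrib]
    _ ≤ Real.exp (Real.log (Real.log n) + (3 - Real.log (Real.log 2)) +
          ∑' p : ℕ, 2 * ((p : ℝ) ^ 2)⁻¹) := by
        refine Real.exp_le_exp.2 (add_le_add (sum_inv_primesUpTo_le hn)
          (hsum.sum_le_tsum _ fun p _ => by positivity))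
    _ = _ := by
        rw [add_assoc, Real.exp_add, Real.exp_log hln, mul_comm]

lemma inv_one_sub_inv_nonneg (p : ℕ) : 0 ≤ (1 - (p : ℝ)⁻¹)⁻¹ := by
  rcases Nat.eq_zero_or_pos p with rfl | hp
  · simp
  have : (1 : ℝ) ≤ p := by exact_mod_cast hp
  exact inv_nonneg.2 (sub_nonneg.2 (inv_le_one_of_one_le₀ this))

lemma one_le_inv_one_sub_inv {p : ℕ} (hp : p.Prime) : 1 ≤ (1 - (p : ℝ)⁻¹)⁻¹ :=
  (one_le_inv₀ (one_sub_inv_pos hp)).2 (one_sub_inv_le p)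

lemma inv_totientRatio (n : ℕ) :
    (totientRatio n)⁻¹ = ∏ p ∈ n.primeFactors, (1 - (p : ℝ)⁻¹)⁻¹ := by
  rw [totientRatio, Finset.prod_inv_distrib]

lemma inv_one_sub_inv_le_of_lt {p : ℕ} {y : ℝ} (hy : 0 < y) (hp : y + 1 ≤ p) :
    (1 - (p : ℝ)⁻¹)⁻¹ ≤ Real.exp (y⁻¹) := by
  have hp0 : (0 : ℝ) < p := by linarith
  have h1 : (0 : ℝ) < p - 1 := by linarith
  have : (1 - (p : ℝ)⁻¹)⁻¹ = (p - 1 : ℝ)⁻¹ + 1 := by field_simp; ring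
  rw [this]
  have h2 : (p - 1 : ℝ)⁻¹ ≤ y⁻¹ := inv_anti₀ hy (by linarith)
  exact (by linarith : (p - 1 : ℝ)⁻¹ + 1 ≤ y⁻¹ + 1).trans (Real.add_one_le_exp _)

/-- The classical lower bound for Euler's function. -/
lemma exists_inv_totientRatio_le : ∃ C : ℝ, 0 < C ∧ ∀ n : ℕ, 0 < n →
    (totientRatio n)⁻¹ ≤ C * max 1 (Real.log (max 1 (Real.log n))) := by
  obtain ⟨C, hC, h⟩ := exists_prod_inv_primesUpTo_le
  have hl2 : 0 < Real.log 2 := Real.log_pos (by norm_num)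
  refine ⟨C * (Real.log 4 + 1) * Real.exp ((Real.log 2)⁻¹), ?_, fun n hn => ?_⟩
  · have : 0 < Real.log 4 := Real.log_pos (by norm_num)
    positivity
  have hlogn : 0 ≤ Real.log n := Real.log_natCast_nonneg n
  set L := max 1 (Real.log n) with hL
  have hL1 : 1 ≤ L := le_max_left _ _
  set y : ℕ := ⌈Real.log n⌉₊ + 2 with hy
  have hy2 : 2 ≤ y := by omega
  have hylog : Real.log n ≤ y := by
    rw [hy]
    push_cast
    linarith [Nat.le_ceil (Real.log n)]
  have hy3 : (y : ℝ) ≤ 4 * L := by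
    rw [hy]
    push_cast
    have := Nat.ceil_lt_add_one hlogn
    have : Real.log n ≤ L := le_max_right _ _
    linarith
  have hy0 : (0 : ℝ) < y := by positivity
  set S := n.primeFactors.filter fun p => p ≤ y with hS
  set B := n.primeFactors.filter fun p => ¬ p ≤ y with hB
  have hsmall : ∏ p ∈ S, (1 - (p : ℝ)⁻¹)⁻¹ ≤ C * Real.log y := by
    refine le_trans (Finset.prod_le_prod_of_subset_of_one_le ?_
      (fun p _ => inv_one_sub_inv_nonneg p) fun p hp _ =>
        one_le_inv_one_sub_inv (mem_primesUpTo.1 hp).1) (h y hy2)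
    intro p hp
    obtain ⟨h1, h2⟩ := Finset.mem_filter.1 hp
    exact mem_primesUpTo.2 ⟨Nat.prime_of_mem_primeFactors h1, h2⟩
  have hlogy : Real.log y ≤ (Real.log 4 + 1) * max 1 (Real.log L) := by
    have h1 : Real.log y ≤ Real.log 4 + Real.log L := by
      rw [← Real.log_mul (by norm_num) (by positivity)]
      exact Real.log_le_log hy0 hy3
    have h2 : (1 : ℝ) ≤ max 1 (Real.log L) := le_max_left _ _
    have h3 : Real.log L ≤ max 1 (Real.log L) := le_max_right _ _
    have h4 : 0 < Real.log 4 := Real.log_pos (by norm_num)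
    nlinarith
  have hcard : (B.card : ℝ) * Real.log 2 ≤ y := by
    have h1 : (B.card : ℝ) * Real.log 2 ≤ ∑ p ∈ B, Real.log p := by
      rw [← nsmul_eq_mul]
      refine Finset.card_nsmul_le_sum _ _ _ fun p hp => ?_
      refine Real.log_le_log (by norm_num) ?_
      exact_mod_cast (Nat.prime_of_mem_primeFactors (Finset.mem_filter.1 hp).1).two_le
    have h2 : ∑ p ∈ B, Real.log p ≤ ∑ p ∈ n.primeFactors, Real.log p :=
      Finset.sum_le_sum_of_subset_of_nonneg (Finset.filter_subset _ _) fun p _ _ =>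
        Real.log_natCast_nonneg p
    linarith [sum_log_primeFactors_le hn]
  have hlarge : ∏ p ∈ B, (1 - (p : ℝ)⁻¹)⁻¹ ≤ Real.exp ((Real.log 2)⁻¹) := by
    calc _ ≤ ∏ p ∈ B, Real.exp ((y : ℝ)⁻¹) :=
          Finset.prod_le_prod (fun p _ => inv_one_sub_inv_nonneg p) fun p hp => by
            refine inv_one_sub_inv_le_of_lt hy0 ?_
            exact_mod_cast not_le.1 (Finset.mem_filter.1 hp).2
      _ = Real.exp (B.card * (y : ℝ)⁻¹) := by
          rw [Finset.prod_const, ← Real.exp_nat_mul]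
      _ ≤ _ := by
          refine Real.exp_le_exp.2 ?_
          rw [← div_eq_mul_inv, ← one_div, div_le_div_iff₀ hy0 hl2]
          linarith
  rw [inv_totientRatio, ← Finset.prod_filter_mul_prod_filter_not n.primeFactors (fun p => p ≤ y)]
  have hB0 : 0 ≤ ∏ p ∈ B, (1 - (p : ℝ)⁻¹)⁻¹ :=
    Finset.prod_nonneg fun p _ => inv_one_sub_inv_nonneg p
  have hm : 0 ≤ max 1 (Real.log L) := zero_le_one.trans (le_max_left _ _)
  have hl4 : 0 < Real.log 4 := Real.log_pos (by norm_num)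
  calc _ ≤ C * Real.log y * Real.exp ((Real.log 2)⁻¹) :=
        mul_le_mul hsmall hlarge hB0 (mul_nonneg hC.le (Real.log_natCast_nonneg y))
    _ ≤ C * ((Real.log 4 + 1) * max 1 (Real.log L)) * Real.exp ((Real.log 2)⁻¹) := by gcongr
    _ = _ := by ring

lemma inv_totientRatio_mul_le {m n : ℕ} (hm : m ≠ 0) (hn : n ≠ 0) :
    (totientRatio (m * n))⁻¹ ≤ (totientRatio m)⁻¹ * (totientRatio n)⁻¹ := by
  simp only [inv_totientRatio]
  rw [Nat.primeFactors_mul hm hn, ← Finset.prod_union_inter]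
  refine le_mul_of_one_le_right (Finset.prod_nonneg fun p _ => inv_one_sub_inv_nonneg p)
    (Finset.one_le_prod fun p hp => one_le_inv_one_sub_inv ?_)
  exact Nat.prime_of_mem_primeFactors (Finset.mem_inter.1 hp).1

lemma inv_totientRatio_isPrimePow_le {d : ℕ} (hd : IsPrimePow d) : (totientRatio d)⁻¹ ≤ 2 := by
  obtain ⟨p, k, hp, hk, rfl⟩ := (isPrimePow_nat_iff d).1 hd
  rw [inv_totientRatio, Nat.primeFactors_prime_pow hk.ne' hp, Finset.prod_singleton,
    inv_le_comm₀ (one_sub_inv_pos hp) (by norm_num)]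
  have : (p : ℝ)⁻¹ ≤ 2⁻¹ := inv_anti₀ (by norm_num) (by exact_mod_cast hp.two_le)
  linarith

lemma inv_totientRatio_le_primeWeight_sq (n : ℕ) : (totientRatio n)⁻¹ ≤ primeWeight n ^ 2 := by
  rw [inv_totientRatio, primeWeight, ← Finset.prod_pow]
  refine Finset.prod_le_prod (fun p _ => inv_one_sub_inv_nonneg p) fun p hp => ?_
  have hpp := Nat.prime_of_mem_primeFactors hp
  have hp2 : (2 : ℝ) ≤ p := by exact_mod_cast hpp.two_le
  set x := (√(p : ℝ))⁻¹ with hx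
  have hx0 : 0 ≤ x := by positivity
  have hx2 : x ^ 2 = (p : ℝ)⁻¹ := by rw [hx, inv_pow, Real.sq_sqrt (by positivity)]
  have hx3 : x ^ 2 ≤ 1 / 2 := by
    rw [hx2, one_div]
    exact inv_anti₀ (by norm_num) hp2
  rw [← hx2, inv_le_iff_one_le_mul₀ (by linarith)]
  have hx1 : x ≤ 3 / 4 := by nlinarith
  nlinarith [mul_nonneg hx0 hx0, mul_nonneg hx0 (sub_nonneg.2 hx3),
    mul_nonneg (mul_nonneg hx0 hx0) (sub_nonneg.2 hx3)]

/-- The reciprocal as a multiplicative map. -/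
noncomputable def natInvHom : ℕ →* ℝ where
  toFun n := (n : ℝ)⁻¹
  map_one' := by simp
  map_mul' m n := by rw [Nat.cast_mul, mul_inv]

lemma sum_inv_le_prod {U S : Finset ℕ} (hS : ∀ p ∈ S, p.Prime)
    (hU : ∀ e ∈ U, e ≠ 0 ∧ ∀ p, p.Prime → p ∣ e → p ∈ S) :
    ∑ e ∈ U, (e : ℝ)⁻¹ ≤ ∏ p ∈ S, (1 - (p : ℝ)⁻¹)⁻¹ := by
  have h := (EulerProduct.summable_and_hasSum_factoredNumbers_prod_filter_prime_geometric
    (f := natInvHom) (fun {p} hp => ?_) S).2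
  · rw [Finset.filter_true_of_mem hS] at h
    have hmem : ∀ e ∈ U, e ∈ Nat.factoredNumbers S := fun e he =>
      Nat.mem_factoredNumbers'.2 (hU e he).2
    have := sum_le_hasSum (U.attach.image fun e : {x // x ∈ U} =>
      (⟨e.1, hmem e.1 e.2⟩ : Nat.factoredNumbers S)) (fun i _ => ?_) h
    · rw [Finset.sum_image, Finset.sum_attach U fun e => natInvHom e] at this
      · exact this
      · intro x _ y _ hxy
        exact Subtype.ext (Subtype.mk.inj hxy)
    · exact inv_nonneg.2 (Nat.cast_nonneg _)
  · change ‖(p : ℝ)⁻¹‖ < 1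
    have : (1 : ℝ) < p := by exact_mod_cast hp.one_lt
    rw [Real.norm_of_nonneg (by positivity)]
    exact inv_lt_one_of_one_lt₀ this

/-- The integers in `[1, N]` coprime to `m`. -/
def coprimeUpTo (m N : ℕ) : Finset ℕ := (Finset.Icc 1 N).filter fun n => n.Coprime m

lemma mem_coprimeUpTo {m N n : ℕ} : n ∈ coprimeUpTo m N ↔ 0 < n ∧ n ≤ N ∧ n.Coprime m := by
  rw [coprimeUpTo, Finset.mem_filter, Finset.mem_Icc, and_assoc]
  rfl

lemma exists_sum_inv_totientRatio_div_le : ∃ C : ℝ, 0 < C ∧ ∀ m N : ℕ,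
    ∑ e ∈ coprimeUpTo m N, (totientRatio e)⁻¹ / e ≤ C * ∑ e ∈ coprimeUpTo m N, (e : ℝ)⁻¹ := by
  obtain ⟨C, hC, h⟩ := exists_sum_primeWeight_pow_le 2
  refine ⟨C, hC, fun m N => ?_⟩
  have h1 := h (coprimeUpTo m N) (fun e => (e : ℝ)⁻¹) (∑ e ∈ coprimeUpTo m N, (e : ℝ)⁻¹)
    (fun e he => (mem_coprimeUpTo.1 he).1) (fun _ _ => by positivity) fun d hd => ?_
  · refine le_trans (Finset.sum_le_sum fun e _ => ?_) h1
    rw [div_eq_inv_mul]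
    exact mul_le_mul_of_nonneg_left (inv_totientRatio_le_primeWeight_sq e) (by positivity)
  · have hinj : Set.InjOn (fun x : ℕ => x / d)
        (((coprimeUpTo m N).filter (d ∣ ·) : Finset ℕ) : Set ℕ) := by
      intro x hx y hy hxy
      rw [Finset.mem_coe, Finset.mem_filter] at hx hy
      obtain ⟨x, rfl⟩ := hx.2
      obtain ⟨y, rfl⟩ := hy.2
      simp only [Nat.mul_div_cancel_left _ hd] at hxy
      rw [hxy]
    calc _ = ∑ e ∈ coprimeUpTo m N with d ∣ e, (d : ℝ)⁻¹ * ((e / d : ℕ) : ℝ)⁻¹ := by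
          refine Finset.sum_congr rfl fun e he => ?_
          obtain ⟨y, rfl⟩ := (Finset.mem_filter.1 he).2
          rw [Nat.mul_div_cancel_left _ hd, Nat.cast_mul, mul_inv]
      _ = (∑ y ∈ ((coprimeUpTo m N).filter (d ∣ ·)).image fun x => x / d, (y : ℝ)⁻¹) / d := by
          rw [Finset.sum_image hinj, ← Finset.mul_sum, div_eq_inv_mul]
      _ ≤ _ := by
          refine div_le_div_of_nonneg_right (Finset.sum_le_sum_of_subset_of_nonneg ?_
            fun _ _ _ => by positivity) (by positivity)
          intro y hy
          obtain ⟨x, hx, rfl⟩ := Finset.mem_image.1 hy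
          obtain ⟨hx1, x, rfl⟩ := Finset.mem_filter.1 hx
          rw [Nat.mul_div_cancel_left _ hd]
          obtain ⟨h2, h3, h4⟩ := mem_coprimeUpTo.1 hx1
          exact mem_coprimeUpTo.2 ⟨Nat.pos_of_mul_pos_left h2,
            (Nat.le_mul_of_pos_left x hd).trans h3, h4.coprime_dvd_left (dvd_mul_left x d)⟩

open ArithmeticFunction in
lemma exists_sum_inv_totientRatio_mul_log_le : ∃ C : ℝ, 0 < C ∧ ∀ m N : ℕ, 0 < N →
    (∑ n ∈ coprimeUpTo m N, (totientRatio n)⁻¹) * Real.log N ≤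
      C * N * ∑ e ∈ coprimeUpTo m N, (totientRatio e)⁻¹ / e := by
  have hl4 : 0 < Real.log 4 := Real.log_pos (by norm_num)
  refine ⟨1 + 2 * (Real.log 4 + 4), by positivity, fun m N hN => ?_⟩
  set U := coprimeUpTo m N with hU
  have hr : ∀ n, 0 < (totientRatio n)⁻¹ := fun n => inv_pos.2 (totientRatio_pos n)
  have hN' : (0 : ℝ) < N := by exact_mod_cast hN
  have h1 : ∑ n ∈ U, (totientRatio n)⁻¹ * Real.log (N / n) ≤
      N * ∑ e ∈ U, (totientRatio e)⁻¹ / e := by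
    rw [Finset.mul_sum]
    refine Finset.sum_le_sum fun n hn => ?_
    have hn0 : (0 : ℝ) < n := by exact_mod_cast (mem_coprimeUpTo.1 hn).1
    calc _ ≤ (totientRatio n)⁻¹ * (N / n) :=
          mul_le_mul_of_nonneg_left (Real.log_le_self (by positivity)) (hr n).le
      _ = _ := by ring
  have h2 : ∑ n ∈ U, (totientRatio n)⁻¹ * Real.log n ≤
      2 * (Real.log 4 + 4) * N * ∑ e ∈ U, (totientRatio e)⁻¹ / e := by
    calc _ ≤ ∑ n ∈ U, ∑ e ∈ U, if e ∣ n then 2 * (totientRatio e)⁻¹ * Λ (n / e) else 0 := by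
          refine Finset.sum_le_sum fun n hn => ?_
          obtain ⟨hn0, hnN, hnm⟩ := mem_coprimeUpTo.1 hn
          have hdiv : n.divisors = U.filter fun e => e ∣ n := by
            ext e
            rw [Nat.mem_divisors, Finset.mem_filter, mem_coprimeUpTo]
            exact ⟨fun h => ⟨⟨Nat.pos_of_dvd_of_pos h.1 hn0, (Nat.le_of_dvd hn0 h.1).trans hnN,
              hnm.coprime_dvd_left h.1⟩, h.1⟩, fun h => ⟨h.2, hn0.ne'⟩⟩
          rw [← Finset.sum_filter, ← hdiv, ← vonMangoldt_sum, Finset.mul_sum,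
            ← Nat.sum_div_divisors n fun d => 2 * (totientRatio d)⁻¹ * Λ (n / d)]
          refine Finset.sum_le_sum fun d hd => ?_
          obtain ⟨hdn, -⟩ := Nat.mem_divisors.1 hd
          rw [Nat.div_div_self hdn hn0.ne']
          by_cases hpp : IsPrimePow d
          · refine mul_le_mul_of_nonneg_right ?_ vonMangoldt_nonneg
            obtain ⟨e, rfl⟩ := hdn
            have hd0 := Nat.pos_of_mul_pos_right hn0
            have he0 := Nat.pos_of_mul_pos_left hn0
            rw [Nat.mul_div_cancel_left _ hd0]
            exact (inv_totientRatio_mul_le hd0.ne' he0.ne').trans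
              (mul_le_mul_of_nonneg_right (inv_totientRatio_isPrimePow_le hpp) (hr e).le)
          · rw [vonMangoldt_eq_zero_iff.2 hpp, mul_zero, mul_zero]
      _ = ∑ e ∈ U, 2 * (totientRatio e)⁻¹ * ∑ n ∈ U with e ∣ n, Λ (n / e) := by
          rw [Finset.sum_comm]
          refine Finset.sum_congr rfl fun e _ => ?_
          rw [← Finset.sum_filter, Finset.mul_sum]
      _ ≤ ∑ e ∈ U, 2 * (totientRatio e)⁻¹ * ((Real.log 4 + 4) * (N / e)) := by
          refine Finset.sum_le_sum fun e he => mul_le_mul_of_nonneg_left ?_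
            (mul_nonneg (by norm_num) (hr e).le)
          have he0 := (mem_coprimeUpTo.1 he).1
          have hinj : Set.InjOn (fun x : ℕ => x / e)
              ((U.filter (e ∣ ·) : Finset ℕ) : Set ℕ) := by
            intro x hx y hy hxy
            rw [Finset.mem_coe, Finset.mem_filter] at hx hy
            obtain ⟨x, rfl⟩ := hx.2
            obtain ⟨y, rfl⟩ := hy.2
            simp only [Nat.mul_div_cancel_left _ he0] at hxy
            rw [hxy]
          refine le_trans ?_ (Chebyshev.psi_le_const_mul_self (x := (N : ℝ) / e) (by positivity))
          rw [← Finset.sum_image (f := fun d : ℕ => Λ d) hinj, Chebyshev.psi]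
          refine Finset.sum_le_sum_of_subset_of_nonneg ?_ fun _ _ _ => vonMangoldt_nonneg
          intro d hd
          obtain ⟨x, hx, rfl⟩ := Finset.mem_image.1 hd
          obtain ⟨hx1, x, rfl⟩ := Finset.mem_filter.1 hx
          obtain ⟨h3, h4, -⟩ := mem_coprimeUpTo.1 hx1
          rw [Nat.mul_div_cancel_left _ he0, Finset.mem_Ioc, Nat.floor_div_eq_div]
          exact ⟨Nat.pos_of_mul_pos_left h3, (Nat.le_div_iff_mul_le he0).2 (by linarith)⟩
      _ = _ := by
          rw [Finset.mul_sum]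
          exact Finset.sum_congr rfl fun e _ => by ring
  have h3 : (∑ n ∈ U, (totientRatio n)⁻¹) * Real.log N =
      ∑ n ∈ U, (totientRatio n)⁻¹ * Real.log (N / n) +
        ∑ n ∈ U, (totientRatio n)⁻¹ * Real.log n := by
    rw [Finset.sum_mul, ← Finset.sum_add_distrib]
    refine Finset.sum_congr rfl fun n hn => ?_
    have hn0 : (n : ℝ) ≠ 0 := by exact_mod_cast (mem_coprimeUpTo.1 hn).1.ne'
    rw [Real.log_div hN'.ne' hn0]
    ring
  rw [h3]
  linarith

/-- Upper-bound sieve for integers coprime to `m`, with weight `n / φ(n)`. -/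
lemma exists_sum_coprime_inv_totientRatio_le : ∃ C : ℝ, 0 < C ∧ ∀ m N : ℕ, 0 < m → 0 < N →
    ∑ n ∈ coprimeUpTo m N, (totientRatio n)⁻¹ ≤
      C * N * ∏ p ∈ m.primeFactors with p ≤ N, (1 - (p : ℝ)⁻¹) := by
  obtain ⟨C₁, hC₁, h₁⟩ := exists_sum_inv_totientRatio_mul_log_le
  obtain ⟨C₂, hC₂, h₂⟩ := exists_sum_inv_totientRatio_div_le
  obtain ⟨C₃, hC₃, h₃⟩ := exists_prod_inv_primesUpTo_le
  refine ⟨max 1 (C₁ * C₂ * C₃), by positivity, fun m N hm hN => ?_⟩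
  have hP0 : 0 ≤ ∏ p ∈ m.primeFactors with p ≤ N, (1 - (p : ℝ)⁻¹) :=
    Finset.prod_nonneg fun p hp =>
      (one_sub_inv_pos (Nat.prime_of_mem_primeFactors (Finset.mem_filter.1 hp).1)).le
  rcases Nat.lt_or_ge 1 N with hN2 | hN1
  · have hln : 0 < Real.log N := Real.log_pos (by exact_mod_cast hN2)
    have hN' : (0 : ℝ) < N := by exact_mod_cast hN
    set S := (primesUpTo N).filter fun p => ¬ p ∣ m with hS
    have hsplit : (∏ p ∈ S, (1 - (p : ℝ)⁻¹)⁻¹) =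
        (∏ p ∈ primesUpTo N, (1 - (p : ℝ)⁻¹)⁻¹) *
          ∏ p ∈ m.primeFactors with p ≤ N, (1 - (p : ℝ)⁻¹) := by
      have heq : (m.primeFactors.filter fun p => p ≤ N) =
          (primesUpTo N).filter fun p => p ∣ m := by
        ext p
        rw [Finset.mem_filter, Finset.mem_filter, mem_primesUpTo, Nat.mem_primeFactors]
        exact ⟨fun h => ⟨⟨h.1.1, h.2⟩, h.1.2.1⟩, fun h => ⟨⟨h.1.1, h.2, hm.ne'⟩, h.1.2⟩⟩
      have hone : ∏ p ∈ m.primeFactors with p ≤ N,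
          ((1 - (p : ℝ)⁻¹)⁻¹ * (1 - (p : ℝ)⁻¹)) = 1 :=
        Finset.prod_eq_one fun p hp => inv_mul_cancel₀
          (one_sub_inv_pos (Nat.prime_of_mem_primeFactors (Finset.mem_filter.1 hp).1)).ne'
      rw [← Finset.prod_filter_mul_prod_filter_not (primesUpTo N) (fun p => p ∣ m), ← heq,
        mul_right_comm, ← Finset.prod_mul_distrib, hone, one_mul]
    have hharm : ∑ e ∈ coprimeUpTo m N, (e : ℝ)⁻¹ ≤ ∏ p ∈ S, (1 - (p : ℝ)⁻¹)⁻¹ := by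
      refine sum_inv_le_prod (fun p hp => (mem_primesUpTo.1 (Finset.mem_filter.1 hp).1).1) ?_
      intro e he
      obtain ⟨h1, h2, h3⟩ := mem_coprimeUpTo.1 he
      refine ⟨h1.ne', fun p hp hpe => Finset.mem_filter.2
        ⟨mem_primesUpTo.2 ⟨hp, (Nat.le_of_dvd h1 hpe).trans h2⟩, fun hpm => ?_⟩⟩
      exact hp.not_dvd_one (h3 ▸ Nat.dvd_gcd hpe hpm)
    rw [← mul_le_mul_iff_left₀ hln]
    calc _ ≤ C₁ * N * ∑ e ∈ coprimeUpTo m N, (totientRatio e)⁻¹ / e := h₁ m N hN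
      _ ≤ C₁ * N * (C₂ * ((C₃ * Real.log N) *
            ∏ p ∈ m.primeFactors with p ≤ N, (1 - (p : ℝ)⁻¹))) := by
          refine mul_le_mul_of_nonneg_left ((h₂ m N).trans ?_) (by positivity)
          refine mul_le_mul_of_nonneg_left (hharm.trans ?_) hC₂.le
          rw [hsplit]
          exact mul_le_mul_of_nonneg_right (h₃ N hN2) hP0
      _ = C₁ * C₂ * C₃ * N * (∏ p ∈ m.primeFactors with p ≤ N, (1 - (p : ℝ)⁻¹)) *
            Real.log N := by ring
      _ ≤ _ := by
          gcongr
          exact le_max_right _ _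
  · obtain rfl : N = 1 := by omega
    have h1 : m.primeFactors.filter (fun p => p ≤ 1) = ∅ :=
      Finset.filter_eq_empty_iff.2 fun p hp h =>
        absurd (Nat.prime_of_mem_primeFactors hp).two_le (by omega)
    have h2 : coprimeUpTo m 1 = {1} := by
      ext n
      rw [mem_coprimeUpTo, Finset.mem_singleton]
      exact ⟨fun h => by omega, fun h => by subst h; simp⟩
    rw [h1, h2]
    simp [totientRatio]

lemma card_le_prod_card_residues {g : ℕ} (hg : 0 < g) {S : Finset ℕ} (hS : ∀ k ∈ S, k < g)
    {G : ℕ → Finset ℕ} (hG : ∀ k ∈ S, ∀ p ∈ g.primeFactors, k % p ∈ G p) :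
    (S.card : ℝ) ≤ g * ∏ p ∈ g.primeFactors, ((G p).card : ℝ) / p := by
  obtain ⟨m, hm⟩ := Nat.prod_primeFactors_dvd g
  set Q := ∏ p ∈ g.primeFactors, p with hQ
  have hQ0 : 0 < Q := Nat.pos_of_ne_zero fun h => by rw [h, zero_mul] at hm; omega
  have hcard : S.card ≤ (Finset.range m ×ˢ g.primeFactors.pi G).card := by
    refine Finset.card_le_card_of_injOn (fun k => (k / Q, fun p _ => k % p)) ?_ ?_
    · intro k hk
      rw [Finset.mem_coe] at hk
      rw [Finset.mem_coe, Finset.mem_product]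
      refine ⟨Finset.mem_range.2 ?_, Finset.mem_pi.2 fun p hp => hG k hk p hp⟩
      exact Nat.div_lt_of_lt_mul (hm ▸ hS k hk)
    · intro k _ k' _ h
      obtain ⟨h1, h2⟩ := Prod.mk.inj h
      have h3 : ∀ p ∈ g.primeFactors, (p : ℤ) ∣ (k' : ℤ) - k := fun p hp =>
        (Nat.modEq_iff_dvd (n := p)).1 (congrFun (congrFun h2 p) hp)
      have h4 : (∏ p ∈ g.primeFactors, (p : ℤ)) ∣ (k' : ℤ) - k := by
        refine Finset.prod_dvd_of_coprime (fun p hp q hq hpq => ?_) h3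
        exact Nat.isCoprime_iff_coprime.2 ((Nat.coprime_primes
          (Nat.prime_of_mem_primeFactors hp) (Nat.prime_of_mem_primeFactors hq)).2 hpq)
      rw [← Nat.cast_prod, ← Nat.modEq_iff_dvd] at h4
      rw [← Nat.div_add_mod k Q, ← Nat.div_add_mod k' Q, h1]
      exact congrArg _ h4
  rw [Finset.card_product, Finset.card_range, Finset.card_pi] at hcard
  have hgQ : (g : ℝ) = Q * m := by exact_mod_cast hm
  have hQ1 : (Q : ℝ) ≠ 0 := by exact_mod_cast hQ0.ne'
  have hQc : ∏ p ∈ g.primeFactors, (p : ℝ) = Q := by rw [hQ, Nat.cast_prod]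
  rw [Finset.prod_div_distrib, hQc, hgQ,
    show (Q : ℝ) * m * ((∏ p ∈ g.primeFactors, ((G p).card : ℝ)) / Q) =
      m * ∏ p ∈ g.primeFactors, ((G p).card : ℝ) by
        rw [mul_right_comm, mul_div_cancel₀ _ hQ1, mul_comm]]
  exact_mod_cast hcard

lemma exists_dvd_add_mul {p : ℕ} (hp : p.Prime) (r u : ℤ) (hu : ¬ (p : ℤ) ∣ u) :
    ∃ x < p, (p : ℤ) ∣ r + u * (x : ℤ) := by
  have := Fact.mk hp
  refine ⟨(-(r : ZMod p) / u).val, ZMod.val_lt _, ?_⟩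
  rw [← ZMod.intCast_zmod_eq_zero_iff_dvd]
  have : (u : ZMod p) ≠ 0 := fun h => hu ((ZMod.intCast_zmod_eq_zero_iff_dvd _ _).1 h)
  push_cast
  rw [ZMod.natCast_zmod_val]
  field_simp
  ring

/-- Residues `x` modulo `p` for which neither `r + u x` nor `c + w x` vanishes. -/
def admissibleResidues (r u c w : ℤ) (p : ℕ) : Finset ℕ :=
  (Finset.range p).filter fun x => ¬ (p : ℤ) ∣ r + u * (x : ℤ) ∧ ¬ (p : ℤ) ∣ c + w * (x : ℤ)

lemma card_admissibleResidues_div_le {p : ℕ} (hp : p.Prime) {r u c w : ℤ}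
    (h : ¬ (p : ℤ) ∣ u ∨ ¬ (p : ℤ) ∣ w) :
    ((admissibleResidues r u c w p).card : ℝ) / p ≤ 1 - (p : ℝ)⁻¹ := by
  have hp0 : (0 : ℝ) < p := by exact_mod_cast hp.pos
  obtain ⟨x, hx, hdvd⟩ : ∃ x < p, (p : ℤ) ∣ r + u * (x : ℤ) ∨ (p : ℤ) ∣ c + w * (x : ℤ) := by
    rcases h with h | h
    · obtain ⟨x, hx, h1⟩ := exists_dvd_add_mul hp r u h
      exact ⟨x, hx, Or.inl h1⟩
    · obtain ⟨x, hx, h1⟩ := exists_dvd_add_mul hp c w h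
      exact ⟨x, hx, Or.inr h1⟩
  have hsub : (admissibleResidues r u c w p).card < p := by
    have h1 : admissibleResidues r u c w p ⊂ Finset.range p :=
      Finset.filter_ssubset.2 ⟨x, Finset.mem_range.2 hx, by tauto⟩
    simpa using Finset.card_lt_card h1
  have h1 : ((admissibleResidues r u c w p).card : ℝ) + 1 ≤ p := by exact_mod_cast hsub
  rw [div_le_iff₀ hp0, sub_mul, inv_mul_cancel₀ hp0.ne']
  linarith

lemma card_admissibleResidues_div_le_sq {p : ℕ} (hp : p.Prime) {r u c w : ℤ}
    (hu : ¬ (p : ℤ) ∣ u) (hw : ¬ (p : ℤ) ∣ w) (hd : ¬ (p : ℤ) ∣ r * w - c * u) :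
    ((admissibleResidues r u c w p).card : ℝ) / p ≤ (1 - (p : ℝ)⁻¹) * (1 - (p : ℝ)⁻¹) := by
  have hp0 : (0 : ℝ) < p := by exact_mod_cast hp.pos
  obtain ⟨x, hx, h1⟩ := exists_dvd_add_mul hp r u hu
  obtain ⟨y, hy, h2⟩ := exists_dvd_add_mul hp c w hw
  have hxy : x ≠ y := by
    rintro rfl
    refine hd ?_
    have := dvd_sub (h1.mul_right w) (h2.mul_right u)
    rwa [show (r + u * (x : ℤ)) * w - (c + w * (x : ℤ)) * u = r * w - c * u by ring] at this
  have hsub : (admissibleResidues r u c w p) ⊆ Finset.range p \ {x, y} := by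
    intro z hz
    obtain ⟨hz1, hz2, hz3⟩ := Finset.mem_filter.1 hz
    rw [Finset.mem_sdiff, Finset.mem_insert, Finset.mem_singleton]
    refine ⟨hz1, ?_⟩
    rintro (rfl | rfl)
    · exact hz2 h1
    · exact hz3 h2
  have hcard : (admissibleResidues r u c w p).card + 2 ≤ p := by
    have h3 : ({x, y} : Finset ℕ) ⊆ Finset.range p := by
      intro z hz
      rw [Finset.mem_insert, Finset.mem_singleton] at hz
      rcases hz with rfl | rfl <;> exact Finset.mem_range.2 ‹_›
    have h4 := Finset.card_sdiff_add_card_eq_card h3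
    rw [Finset.card_pair hxy, Finset.card_range] at h4
    have := Finset.card_le_card hsub
    omega
  have h1 : ((admissibleResidues r u c w p).card : ℝ) + 2 ≤ p := by exact_mod_cast hcard
  rw [div_le_iff₀ hp0]
  have h5 : (p : ℝ)⁻¹ * p = 1 := inv_mul_cancel₀ hp0.ne'
  have h6 : 0 < (p : ℝ)⁻¹ := by positivity
  nlinarith

/-- Pairs of reduced residues modulo `g x` and `g y` with prescribed cross difference. -/
def reducedPairs (g x y : ℕ) (n : ℤ) : Finset (ℕ × ℕ) :=
  (Finset.range (g * x) ×ˢ Finset.range (g * y)).filter fun e =>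
    e.1.Coprime (g * x) ∧ e.2.Coprime (g * y) ∧
      ((g * x * y : ℕ) : ℤ) ∣ (e.1 : ℤ) * y - (e.2 : ℤ) * x - n

lemma mem_reducedPairs {g x y : ℕ} {n : ℤ} {e : ℕ × ℕ} :
    e ∈ reducedPairs g x y n ↔ e.1 < g * x ∧ e.2 < g * y ∧ e.1.Coprime (g * x) ∧
      e.2.Coprime (g * y) ∧ ((g * x * y : ℕ) : ℤ) ∣ (e.1 : ℤ) * y - (e.2 : ℤ) * x - n := by
  rw [reducedPairs, Finset.mem_filter, Finset.mem_product, Finset.mem_range, Finset.mem_range,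
    and_assoc]

lemma card_reducedPairs_le {g x y : ℕ} (hg : 0 < g) (hx : 0 < x) (hy : 0 < y)
    (hxy : x.Coprime y) (n : ℤ) :
    ((reducedPairs g x y n).card : ℝ) ≤
      g * ∏ p ∈ g.primeFactors, ((1 - (p : ℝ)⁻¹) *
        if (p : ℤ) ∣ x * y * n then 1 else 1 - (p : ℝ)⁻¹) := by
  rcases (reducedPairs g x y n).eq_empty_or_nonempty with hE | ⟨⟨a₀, b₀⟩, h₀⟩
  · rw [hE, Finset.card_empty, Nat.cast_zero]
    refine mul_nonneg (Nat.cast_nonneg g) (Finset.prod_nonneg fun p hp => ?_)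
    have := (one_sub_inv_pos (Nat.prime_of_mem_primeFactors hp)).le
    split_ifs <;> positivity
  have hx0 : (x : ℤ) ≠ 0 := by exact_mod_cast hx.ne'
  have hy0 : (y : ℤ) ≠ 0 := by exact_mod_cast hy.ne'
  have hcop : IsCoprime (x : ℤ) (y : ℤ) := Nat.isCoprime_iff_coprime.2 hxy
  have hdx : ∀ e ∈ reducedPairs g x y n, (x : ℤ) ∣ (e.1 : ℤ) * y - n := by
    intro e he
    have h := (mem_reducedPairs.1 he).2.2.2.2
    have h1 : (x : ℤ) ∣ (e.1 : ℤ) * y - (e.2 : ℤ) * x - n :=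
      dvd_trans ⟨(g * y : ℤ), by push_cast; ring⟩ h
    have := dvd_add h1 (dvd_mul_left (x : ℤ) e.2)
    rwa [show (e.1 : ℤ) * y - (e.2 : ℤ) * x - n + (e.2 : ℤ) * x = (e.1 : ℤ) * y - n by ring]
      at this
  have hmod : ∀ e ∈ reducedPairs g x y n, e.1 % x = a₀ % x := by
    intro e he
    have h1 := dvd_sub (hdx _ h₀) (hdx e he)
    rw [show ((a₀ : ℕ) : ℤ) * y - n - ((e.1 : ℤ) * y - n) = ((a₀ : ℤ) - e.1) * y by ring] at h1
    exact (Nat.modEq_iff_dvd (n := x)).2 (hcop.dvd_of_dvd_mul_right h1)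
  set r := a₀ % x with hr
  have hfst : ∀ e ∈ reducedPairs g x y n, e.1 = r + x * (e.1 / x) := fun e he => by
    rw [← hmod e he, Nat.mod_add_div]
  obtain ⟨c, hc⟩ : (x : ℤ) ∣ (r : ℤ) * y - n := by
    have h1 := hdx _ h₀
    have h2 := hfst _ h₀
    simp only at h1 h2
    rw [h2] at h1
    have := dvd_sub h1 (dvd_mul_right (x : ℤ) ((a₀ / x : ℕ) * y))
    push_cast at this
    rwa [show ((r : ℤ) + x * ((a₀ : ℤ) / x)) * y - n - x * ((a₀ : ℤ) / x * y) = r * y - n by ring]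
      at this
  have hsnd : ∀ e ∈ reducedPairs g x y n,
      ((g * y : ℕ) : ℤ) ∣ c + y * ((e.1 / x : ℕ) : ℤ) - e.2 := by
    intro e he
    have h := (mem_reducedPairs.1 he).2.2.2.2
    have h2 : (e.1 : ℤ) = r + x * ((e.1 / x : ℕ) : ℤ) := by exact_mod_cast hfst e he
    rw [h2, show ((r : ℤ) + x * ((e.1 / x : ℕ) : ℤ)) * y - (e.2 : ℤ) * x - n =
      (r * y - n) + x * (y * ((e.1 / x : ℕ) : ℤ) - e.2) by ring, hc, ← mul_add,
      show ((g * x * y : ℕ) : ℤ) = x * ((g * y : ℕ) : ℤ) by push_cast; ring] at h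
    rw [add_sub_assoc]
    exact Int.dvd_of_mul_dvd_mul_left hx0 h
  set S := (reducedPairs g x y n).image fun e => e.1 / x with hS
  have hinj : Set.InjOn (fun e : ℕ × ℕ => e.1 / x) (reducedPairs g x y n : Set (ℕ × ℕ)) := by
    intro e he e' he' h
    rw [Finset.mem_coe] at he he'
    simp only at h
    have h1 : e.1 = e'.1 := by rw [hfst e he, hfst e' he', h]
    have h2 := dvd_sub (hsnd e he) (hsnd e' he')
    rw [h, show c + (y : ℤ) * ((e'.1 / x : ℕ) : ℤ) - e.2 -
      (c + (y : ℤ) * ((e'.1 / x : ℕ) : ℤ) - e'.2) = (e'.2 : ℤ) - e.2 by ring,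
      ← Nat.modEq_iff_dvd] at h2
    exact Prod.ext h1 (Nat.ModEq.eq_of_lt_of_lt h2 (mem_reducedPairs.1 he).2.1
      (mem_reducedPairs.1 he').2.1)
  have hcardS : (reducedPairs g x y n).card = S.card := (Finset.card_image_of_injOn hinj).symm
  rw [hcardS]
  refine (card_le_prod_card_residues hg (G := admissibleResidues r x c y) ?_ ?_).trans ?_
  · intro k hk
    obtain ⟨e, he, rfl⟩ := Finset.mem_image.1 hk
    exact Nat.div_lt_of_lt_mul (by rw [mul_comm]; exact (mem_reducedPairs.1 he).1)
  · intro k hk p hp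
    obtain ⟨e, he, rfl⟩ := Finset.mem_image.1 hk
    have hpp := Nat.prime_of_mem_primeFactors hp
    have hpg := Nat.dvd_of_mem_primeFactors hp
    obtain ⟨-, -, hc1, hc2, -⟩ := mem_reducedPairs.1 he
    have hkp : ∀ z : ℤ, (p : ℤ) ∣ z * ((e.1 / x : ℕ) : ℤ) - z * ((e.1 / x % p : ℕ) : ℤ) := by
      intro z
      rw [← mul_sub]
      refine Dvd.dvd.mul_left ?_ z
      exact (Nat.modEq_iff_dvd (n := p)).1 (Nat.mod_modEq _ p)
    refine Finset.mem_filter.2 ⟨Finset.mem_range.2 (Nat.mod_lt _ hpp.pos), fun h => ?_,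
      fun h => ?_⟩
    · have h1 := dvd_add h (hkp x)
      rw [show (r : ℤ) + x * ((e.1 / x % p : ℕ) : ℤ) + (x * ((e.1 / x : ℕ) : ℤ) -
        x * ((e.1 / x % p : ℕ) : ℤ)) = ((r + x * (e.1 / x) : ℕ) : ℤ) by push_cast; ring,
        ← hfst e he, Int.natCast_dvd_natCast] at h1
      exact Nat.Prime.not_coprime_iff_dvd.2 ⟨p, hpp, h1, hpg.mul_right x⟩ hc1
    · have h1 := dvd_add h (hkp y)
      have h2 : (p : ℤ) ∣ c + y * ((e.1 / x : ℕ) : ℤ) - e.2 :=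
        (Int.natCast_dvd_natCast.2 (hpg.mul_right y)).trans (hsnd e he)
      have h3 := dvd_sub h1 h2
      rw [show c + (y : ℤ) * ((e.1 / x % p : ℕ) : ℤ) + (y * ((e.1 / x : ℕ) : ℤ) -
        y * ((e.1 / x % p : ℕ) : ℤ)) - (c + y * ((e.1 / x : ℕ) : ℤ) - e.2) = (e.2 : ℤ) by ring,
        Int.natCast_dvd_natCast] at h3
      exact Nat.Prime.not_coprime_iff_dvd.2 ⟨p, hpp, h3, hpg.mul_right y⟩ hc2
  · refine mul_le_mul_of_nonneg_left (Finset.prod_le_prod (fun p _ => by positivity)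
      fun p hp => ?_) (Nat.cast_nonneg g)
    have hpp := Nat.prime_of_mem_primeFactors hp
    split_ifs with hdvd
    · rw [mul_one]
      refine card_admissibleResidues_div_le hpp ?_
      by_contra! h
      have h1 := hcop.isUnit_of_dvd' h.1 h.2
      exact hpp.not_dvd_one (Int.natCast_dvd_natCast.1 (by simpa using h1.dvd))
    · refine card_admissibleResidues_div_le_sq hpp
        (fun h => hdvd ((h.mul_right _).mul_right _)) (fun h => hdvd ((h.mul_left _).mul_right _))
        fun h => hdvd ?_
      rw [show (r : ℤ) * y - c * x = n by linear_combination hc] at h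
      exact h.mul_left _

lemma prod_one_sub_inv_mul_le_union {S T : Finset ℕ} (hS : ∀ p ∈ S, p.Prime)
    (hT : ∀ p ∈ T, p.Prime) :
    (∏ p ∈ S, (1 - (p : ℝ)⁻¹)) * ∏ p ∈ T, (1 - (p : ℝ)⁻¹) ≤ ∏ p ∈ S ∪ T, (1 - (p : ℝ)⁻¹) := by
  rw [← Finset.prod_union_inter]
  have h0 : ∀ p ∈ S ∪ T, 0 ≤ 1 - (p : ℝ)⁻¹ := fun p hp => by
    rcases Finset.mem_union.1 hp with h | h
    · exact (one_sub_inv_pos (hS p h)).le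
    · exact (one_sub_inv_pos (hT p h)).le
  refine mul_le_of_le_one_right (Finset.prod_nonneg h0) (Finset.prod_le_one (fun p hp => ?_)
    fun p _ => one_sub_inv_le p)
  exact (one_sub_inv_pos (hS p (Finset.mem_inter.1 hp).1)).le

lemma card_reducedPairs_le_totientRatio {g x y : ℕ} (hg : 0 < g) (hx : 0 < x) (hy : 0 < y)
    (hxy : x.Coprime y) {n : ℤ} (hn : n ≠ 0) :
    ((reducedPairs g x y n).card : ℝ) ≤ g * (totientRatio (g * x) * totientRatio (g * y)) *
      (totientRatio (x * y))⁻¹ * (totientRatio n.natAbs)⁻¹ := by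
  refine (card_reducedPairs_le hg hx hy hxy n).trans ?_
  set f : ℕ → ℝ := fun p => 1 - (p : ℝ)⁻¹ with hf
  set A := g.primeFactors with hA
  set Z := (x * y).primeFactors with hZ
  set M := n.natAbs.primeFactors with hM
  have hpA : ∀ p ∈ A, p.Prime := fun p hp => Nat.prime_of_mem_primeFactors hp
  have hpZ : ∀ p ∈ Z, p.Prime := fun p hp => Nat.prime_of_mem_primeFactors hp
  have hpM : ∀ p ∈ M, p.Prime := fun p hp => Nat.prime_of_mem_primeFactors hp
  have hpos : ∀ B : Finset ℕ, (∀ p ∈ B, p.Prime) → 0 < ∏ p ∈ B, f p := fun B hB =>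
    Finset.prod_pos fun p hp => one_sub_inv_pos (hB p hp)
  have hsplit : ∀ z : ℕ, z ≠ 0 → totientRatio (g * z) =
      (∏ p ∈ A, f p) * ∏ p ∈ z.primeFactors \ A, f p := by
    intro z hz
    rw [totientRatio, Nat.primeFactors_mul hg.ne' hz, ← Finset.union_sdiff_self_eq_union,
      Finset.prod_union Finset.disjoint_sdiff]
  have hZA : ∏ p ∈ Z \ A, f p =
      (∏ p ∈ x.primeFactors \ A, f p) * ∏ p ∈ y.primeFactors \ A, f p := by
    rw [hZ, Nat.primeFactors_mul hx.ne' hy.ne', Finset.union_sdiff_distrib, Finset.prod_union]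
    exact (hxy.disjoint_primeFactors.mono Finset.sdiff_subset Finset.sdiff_subset)
  have hZZ : totientRatio (x * y) = (∏ p ∈ Z ∩ A, f p) * ∏ p ∈ Z \ A, f p := by
    rw [totientRatio, ← Finset.prod_inter_mul_prod_sdiff Z A]
  set D := A.filter (fun p : ℕ => ¬ (p : ℤ) ∣ x * y * n) with hD
  have hite : (∏ p ∈ A, if (p : ℤ) ∣ x * y * n then 1 else f p) =
      ∏ p ∈ D, f p := by
    rw [hD, Finset.prod_filter]
    refine Finset.prod_congr rfl fun p _ => ?_
    split_ifs <;> rfl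
  have hkey : (∏ p ∈ D, f p) * (∏ p ∈ Z ∩ A, f p) * ∏ p ∈ M, f p ≤
      ∏ p ∈ A, f p := by
    have hpB : ∀ p ∈ D, p.Prime := fun p hp =>
      hpA p (Finset.mem_filter.1 hp).1
    have hpC : ∀ p ∈ Z ∩ A, p.Prime := fun p hp => hpA p (Finset.mem_inter.1 hp).2
    have hpBC : ∀ p ∈ D ∪ Z ∩ A, p.Prime := fun p hp =>
      (Finset.mem_union.1 hp).elim (hpB p) (hpC p)
    refine (mul_le_mul_of_nonneg_right (prod_one_sub_inv_mul_le_union hpB hpC)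
      (hpos M hpM).le).trans ((prod_one_sub_inv_mul_le_union hpBC hpM).trans ?_)
    refine prod_one_sub_inv_le_of_subset (fun p hp => ?_) fun p hp =>
      (Finset.mem_union.1 hp).elim (hpBC p) (hpM p)
    by_cases hd : (p : ℤ) ∣ x * y * n
    · rcases (Nat.prime_iff_prime_int.1 (hpA p hp)).dvd_or_dvd hd with h | h
      · refine Finset.mem_union_left _ (Finset.mem_union_right _ (Finset.mem_inter.2 ⟨?_, hp⟩))
        exact Nat.mem_primeFactors.2 ⟨hpA p hp, by exact_mod_cast h, (Nat.mul_pos hx hy).ne'⟩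
      · refine Finset.mem_union_right _ (Nat.mem_primeFactors.2 ⟨hpA p hp, ?_, ?_⟩)
        · exact Int.natCast_dvd.1 h
        · exact Int.natAbs_ne_zero.2 hn
    · exact Finset.mem_union_left _ (Finset.mem_union_left _ (Finset.mem_filter.2 ⟨hp, hd⟩))
  have hR : totientRatio (g * x) * totientRatio (g * y) =
      (∏ p ∈ A, f p) * (∏ p ∈ A, f p) * ∏ p ∈ Z \ A, f p := by
    rw [hsplit x hx.ne', hsplit y hy.ne', hZA]
    ring
  have hM0 : totientRatio n.natAbs = ∏ p ∈ M, f p := rfl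
  rw [Finset.prod_mul_distrib, hite, hR, hZZ, hM0, mul_assoc, mul_assoc]
  refine mul_le_mul_of_nonneg_left ?_ (Nat.cast_nonneg g)
  have h1 := hpos A hpA
  have h2 := hpos (Z \ A) fun p hp => hpZ p (Finset.mem_sdiff.1 hp).1
  have h3 := hpos (Z ∩ A) fun p hp => hpZ p (Finset.mem_inter.1 hp).1
  have h4 := hpos M hpM
  rw [← mul_inv, ← div_eq_mul_inv, le_div_iff₀ (by positivity)]
  calc _ = (∏ p ∈ A, f p) * (∏ p ∈ Z \ A, f p) * ((∏ p ∈ D, f p) *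
        (∏ p ∈ Z ∩ A, f p) * ∏ p ∈ M, f p) := by ring
    _ ≤ (∏ p ∈ A, f p) * (∏ p ∈ Z \ A, f p) * ∏ p ∈ A, f p :=
        mul_le_mul_of_nonneg_left hkey (by positivity)
    _ = _ := by ring

/-- The Euler factors of `m` at primes exceeding `T`. -/
noncomputable def tailProd (m T : ℕ) : ℝ :=
  ∏ p ∈ m.primeFactors with ¬ p ≤ T, (1 - (p : ℝ)⁻¹)⁻¹

lemma tailProd_nonneg (m T : ℕ) : 0 ≤ tailProd m T :=
  Finset.prod_nonneg fun p _ => inv_one_sub_inv_nonneg p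

lemma inv_totientRatio_mul_prod_le (m T : ℕ) :
    (totientRatio m)⁻¹ * ∏ p ∈ m.primeFactors with p ≤ T, (1 - (p : ℝ)⁻¹) = tailProd m T := by
  rw [inv_totientRatio, ← Finset.prod_filter_mul_prod_filter_not m.primeFactors (fun p => p ≤ T),
    mul_right_comm, ← Finset.prod_mul_distrib, Finset.prod_eq_one, one_mul, tailProd]
  exact fun p hp => inv_mul_cancel₀
    (one_sub_inv_pos (Nat.prime_of_mem_primeFactors (Finset.mem_filter.1 hp).1)).ne'

/-- Pairs of reduced residues modulo `g x` and `g y` whose cross difference is at most `T` in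
absolute value. -/
def closePairs (g x y T : ℕ) : Finset (ℕ × ℕ) :=
  (coprimeUpTo (x * y) T).biUnion fun n => reducedPairs g x y n ∪ reducedPairs g x y (-n)

lemma mem_closePairs {g x y T : ℕ} (hxy : x.Coprime y) (hne : x ≠ y) {e : ℕ × ℕ} {n : ℤ}
    (hn : n.natAbs ≤ T) (he : e ∈ reducedPairs g x y n) : e ∈ closePairs g x y T := by
  obtain ⟨-, -, h1, h2, k, hk⟩ := mem_reducedPairs.1 he
  have hcx : IsCoprime n x := by
    have h3 : IsCoprime ((e.1 : ℤ) * y) x := IsCoprime.mul_left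
      (Nat.isCoprime_iff_coprime.2 (h1.coprime_dvd_right (dvd_mul_left x g)))
      (Nat.isCoprime_iff_coprime.2 hxy.symm)
    have h4 := h3.add_mul_left_left (-e.2 - g * y * k)
    rwa [show (e.1 : ℤ) * y + x * (-e.2 - g * y * k) = n by
      push_cast at hk; linear_combination hk] at h4
  have hcy : IsCoprime n y := by
    have h3 : IsCoprime (-(e.2 : ℤ) * x) y := IsCoprime.mul_left
      (Nat.isCoprime_iff_coprime.2 (h2.coprime_dvd_right (dvd_mul_left y g))).neg_left
      (Nat.isCoprime_iff_coprime.2 hxy)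
    have h4 := h3.add_mul_left_left (e.1 - g * x * k)
    rwa [show -(e.2 : ℤ) * x + y * (e.1 - g * x * k) = n by
      push_cast at hk; linear_combination hk] at h4
  have hn0 : n ≠ 0 := by
    rintro rfl
    rw [isCoprime_zero_left, Int.isUnit_iff_natAbs_eq, Int.natAbs_natCast] at hcx hcy
    exact hne (hcx.trans hcy.symm)
  refine Finset.mem_biUnion.2 ⟨n.natAbs, mem_coprimeUpTo.2 ⟨Int.natAbs_pos.2 hn0, hn, ?_⟩, ?_⟩
  · have := Int.isCoprime_iff_gcd_eq_one.1 (hcx.mul_right hcy)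
    rw [Int.gcd, Int.natAbs_mul, Int.natAbs_natCast, Int.natAbs_natCast] at this
    exact this
  · rw [Finset.mem_union]
    rcases Int.natAbs_eq n with h | h
    · left; rwa [← h]
    · right; rwa [← h]

lemma exists_card_closePairs_le : ∃ C : ℝ, 0 < C ∧ ∀ g x y T : ℕ, 0 < g → 0 < x → 0 < y →
    x.Coprime y → ((closePairs g x y T).card : ℝ) ≤
      C * T * (g * (totientRatio (g * x) * totientRatio (g * y))) * tailProd (x * y) T := by
  obtain ⟨C, hC, h⟩ := exists_sum_coprime_inv_totientRatio_le
  refine ⟨2 * C, by positivity, fun g x y T hg hx hy hxy => ?_⟩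
  rcases Nat.eq_zero_or_pos T with rfl | hT
  · simp [closePairs, coprimeUpTo]
  have hr := fun n => (totientRatio_pos n).le
  set R := (g : ℝ) * (totientRatio (g * x) * totientRatio (g * y)) with hR
  have hR0 : 0 ≤ R := mul_nonneg (Nat.cast_nonneg g) (mul_nonneg (hr _) (hr _))
  have h1 : ∀ n ∈ coprimeUpTo (x * y) T,
      ((reducedPairs g x y n ∪ reducedPairs g x y (-n)).card : ℝ) ≤
        2 * R * (totientRatio (x * y))⁻¹ * (totientRatio n)⁻¹ := by
    intro n hn
    have hn0 : (n : ℤ) ≠ 0 := by exact_mod_cast (mem_coprimeUpTo.1 hn).1.ne'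
    have h2 := card_reducedPairs_le_totientRatio hg hx hy hxy hn0
    have h3 := card_reducedPairs_le_totientRatio hg hx hy hxy (neg_ne_zero.2 hn0)
    rw [Int.natAbs_neg] at h3
    rw [Int.natAbs_natCast] at h2 h3
    have h4 : ((reducedPairs g x y n ∪ reducedPairs g x y (-n)).card : ℝ) ≤
        (reducedPairs g x y n).card + (reducedPairs g x y (-n)).card := by
      exact_mod_cast Finset.card_union_le _ _
    linarith
  calc ((closePairs g x y T).card : ℝ)
      ≤ ∑ n ∈ coprimeUpTo (x * y) T,
          ((reducedPairs g x y n ∪ reducedPairs g x y (-n)).card : ℝ) := by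
        exact_mod_cast Finset.card_biUnion_le
    _ ≤ ∑ n ∈ coprimeUpTo (x * y) T,
          2 * R * (totientRatio (x * y))⁻¹ * (totientRatio n)⁻¹ := Finset.sum_le_sum h1
    _ ≤ 2 * R * (totientRatio (x * y))⁻¹ *
          (C * T * ∏ p ∈ (x * y).primeFactors with p ≤ T, (1 - (p : ℝ)⁻¹)) := by
        rw [← Finset.mul_sum]
        refine mul_le_mul_of_nonneg_left (h _ _ (Nat.mul_pos hx hy) hT) ?_
        exact mul_nonneg (by linarith) (inv_nonneg.2 (hr _))
    _ = _ := by
        rw [← inv_totientRatio_mul_prod_le]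
        ring

lemma tailProd_le_two_mul_primeWeight (m T : ℕ) : tailProd m T ≤ 2 * primeWeight m := by
  have h1 : tailProd m T ≤ ∏ p ∈ m.primeFactors, (1 - (p : ℝ)⁻¹)⁻¹ :=
    Finset.prod_le_prod_of_subset_of_one_le (Finset.filter_subset _ _)
      (fun p _ => inv_one_sub_inv_nonneg p) fun p hp _ =>
        one_le_inv_one_sub_inv (Nat.prime_of_mem_primeFactors hp)
  refine h1.trans ?_
  calc _ ≤ ∏ p ∈ m.primeFactors, (if p = 2 then (2 : ℝ) else 1) * (1 + (√(p : ℝ))⁻¹) := by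
        refine Finset.prod_le_prod (fun p _ => inv_one_sub_inv_nonneg p) fun p hp => ?_
        have hpp := Nat.prime_of_mem_primeFactors hp
        have hs : 0 ≤ (√(p : ℝ))⁻¹ := by positivity
        split_ifs with h2
        · have : (1 - (p : ℝ)⁻¹)⁻¹ = 2 := by rw [h2]; norm_num
          linarith
        · have hp3 : (3 : ℝ) ≤ p := by
            have := hpp.two_le
            exact_mod_cast (by omega : 3 ≤ p)
          rw [one_mul, inv_le_iff_one_le_mul₀ (one_sub_inv_pos hpp)]
          set x := (√(p : ℝ))⁻¹ with hx
          have hx2 : x ^ 2 = (p : ℝ)⁻¹ := by rw [hx, inv_pow, Real.sq_sqrt (by positivity)]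
          have hx3 : x ^ 2 ≤ 1 / 3 := by
            rw [hx2, one_div]
            exact inv_anti₀ (by norm_num) hp3
          rw [← hx2]
          have : x ≤ 3 / 5 := by nlinarith
          nlinarith [mul_nonneg hs hs]
    _ = (∏ p ∈ m.primeFactors, if p = 2 then (2 : ℝ) else 1) * primeWeight m := by
        rw [Finset.prod_mul_distrib, primeWeight]
    _ ≤ _ := by
        refine mul_le_mul_of_nonneg_right ?_ (primeWeight_nonneg m)
        rw [Finset.prod_ite_eq']
        split_ifs <;> norm_num

lemma exp_half_le_one_add {x : ℝ} (h0 : 0 ≤ x) (h1 : x ≤ 1) : Real.exp (x / 2) ≤ 1 + x := by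
  have h2 := Real.one_sub_le_exp_neg (x / 2)
  have h3 : 0 < 1 - x / 2 := by linarith
  rw [← inv_inv (Real.exp (x / 2)), ← Real.exp_neg]
  refine (inv_anti₀ h3 h2).trans ?_
  rw [inv_le_iff_one_le_mul₀ h3]
  nlinarith

lemma exists_tailProd_le : ∃ K : ℝ, 0 < K ∧ ∀ m T : ℕ, 0 < T →
    tailProd m T ≤ K * (1 + primeWeight m / T) := by
  refine ⟨8 * Real.exp 2 + 32, by positivity, fun m T hT => ?_⟩
  have hT0 : (1 : ℝ) ≤ T := by exact_mod_cast hT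
  have hW := primeWeight_nonneg m
  have hE : 0 < Real.exp 2 := Real.exp_pos 2
  have hWT : 0 ≤ primeWeight m / T := by positivity
  set B := m.primeFactors.filter fun p => ¬ p ≤ T with hB
  have hpB : ∀ p ∈ B, p.Prime ∧ T < p := fun p hp =>
    ⟨Nat.prime_of_mem_primeFactors (Finset.mem_filter.1 hp).1, not_le.1 (Finset.mem_filter.1 hp).2⟩
  set L := ∑ p ∈ B, (p : ℝ)⁻¹ with hL
  have h1 : tailProd m T ≤ Real.exp (2 * L) := by
    rw [hL, Finset.mul_sum, Real.exp_sum, tailProd]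
    refine Finset.prod_le_prod (fun p _ => inv_one_sub_inv_nonneg p) fun p hp => ?_
    refine (inv_one_sub_inv_le (hpB p hp).1).trans (Real.exp_le_exp.2 ?_)
    have hp2 : (2 : ℝ) ≤ p := by exact_mod_cast (hpB p hp).1.two_le
    have h2 : (p : ℝ)⁻¹ ≤ 2⁻¹ := inv_anti₀ (by norm_num) hp2
    have h3 : 0 ≤ (p : ℝ)⁻¹ := by positivity
    rw [← inv_pow]
    nlinarith
  rcases le_or_gt L 1 with hL1 | hL1
  · calc _ ≤ Real.exp 2 := h1.trans (Real.exp_le_exp.2 (by linarith))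
      _ ≤ _ := by nlinarith
  rcases le_or_gt T 16 with hT16 | hT16
  · have hT1 : (T : ℝ) ≤ 16 := by exact_mod_cast hT16
    have h2 : primeWeight m ≤ 16 * (primeWeight m / T) := by
      rw [← mul_div_assoc, le_div_iff₀ (by linarith)]
      nlinarith
    have := tailProd_le_two_mul_primeWeight m T
    nlinarith
  · have hT1 : (16 : ℝ) ≤ T := by exact_mod_cast hT16.le
    have h2 : Real.exp (√T / 2 * L) ≤ primeWeight m := by
      calc _ ≤ ∏ p ∈ B, (1 + (√(p : ℝ))⁻¹) := by
            rw [hL, Finset.mul_sum, Real.exp_sum]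
            refine Finset.prod_le_prod (fun p _ => (Real.exp_pos _).le) fun p hp => ?_
            have hp1 : (1 : ℝ) ≤ √(p : ℝ) := Real.one_le_sqrt.2
              (by exact_mod_cast (hpB p hp).1.one_le)
            refine le_trans (Real.exp_le_exp.2 ?_)
              (exp_half_le_one_add (by positivity) (inv_le_one_of_one_le₀ hp1))
            have h3 : √(T : ℝ) ≤ √(p : ℝ) := Real.sqrt_le_sqrt
              (by exact_mod_cast (hpB p hp).2.le)
            have h4 : (p : ℝ)⁻¹ = (√(p : ℝ))⁻¹ * (√(p : ℝ))⁻¹ := by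
              rw [← mul_inv, Real.mul_self_sqrt (by positivity)]
            have h5 : √(T : ℝ) * (√(p : ℝ))⁻¹ ≤ 1 := by
              rw [← div_eq_mul_inv]
              exact div_le_one_of_le₀ h3 (by positivity)
            have h6 : 0 < (√(p : ℝ))⁻¹ := by positivity
            rw [h4]
            nlinarith
        _ ≤ _ := Finset.prod_le_prod_of_subset_of_one_le (Finset.filter_subset _ _)
            (fun p _ => by positivity) fun p _ _ => by
              have : 0 ≤ (√(p : ℝ))⁻¹ := by positivity
              linarith
    have h3 : (4 : ℝ) ≤ √T := Real.le_sqrt_of_sq_le (by linarith)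
    have h4 : (T : ℝ) / 8 ≤ Real.exp (√T / 2) := by
      have := Real.quadratic_le_exp_of_nonneg (x := √T / 2) (by positivity)
      have h5 : √(T : ℝ) ^ 2 = T := Real.sq_sqrt (by linarith)
      nlinarith
    have h5 : Real.exp (2 * L) * Real.exp (√T / 2) ≤ Real.exp 2 * primeWeight m := by
      calc _ = Real.exp (2 * L + √T / 2) := by rw [Real.exp_add]
        _ ≤ Real.exp (2 + √T / 2 * L) := Real.exp_le_exp.2 (by nlinarith)
        _ ≤ _ := by
            rw [Real.exp_add]
            exact mul_le_mul_of_nonneg_left h2 hE.le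
    have h6 : Real.exp (2 * L) ≤ 8 * Real.exp 2 * (primeWeight m / T) := by
      rw [← mul_div_assoc, le_div_iff₀ (by linarith)]
      have := mul_le_mul_of_nonneg_left h4 (Real.exp_pos (2 * L)).le
      nlinarith
    nlinarith

lemma volume_approxAddOrderOf_inter_le {g x y : ℕ} (hg : 0 < g) (hx : 0 < x) (hy : 0 < y)
    (hxy : x.Coprime y) (hne : x ≠ y) {d e : ℝ} :
    volume.real (approxAddOrderOf UnitAddCircle (g * x) d ∩
      approxAddOrderOf UnitAddCircle (g * y) e) ≤
      (closePairs g x y ⌊g * x * y * (d + e)⌋₊).card * (2 * min |d| |e|) := by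
  set T := ⌊g * x * y * (d + e)⌋₊ with hT
  have hfin : ∀ s : Set UnitAddCircle, volume s ≠ ⊤ := fun s => measure_ne_top _ s
  have hsub : approxAddOrderOf UnitAddCircle (g * x) d ∩
      approxAddOrderOf UnitAddCircle (g * y) e ⊆ ⋃ p ∈ closePairs g x y T,
        (Metric.closedBall (((p.1 : ℝ) / (g * x : ℕ) : ℝ) : UnitAddCircle) |d| ∩
          Metric.closedBall (((p.2 : ℝ) / (g * y : ℕ) : ℝ) : UnitAddCircle) |e|) := by
    rintro z ⟨h1, h2⟩
    obtain ⟨a, ha, hac, h1⟩ := (UnitAddCircle.mem_approxAddOrderOf_iff (Nat.mul_pos hg hx)).1 h1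
    obtain ⟨b, hb, hbc, h2⟩ := (UnitAddCircle.mem_approxAddOrderOf_iff (Nat.mul_pos hg hy)).1 h2
    refine Set.mem_biUnion (x := (a, b)) ?_ ⟨?_, ?_⟩
    · set u : ℝ := (a : ℝ) / (g * x : ℕ) - (b : ℝ) / (g * y : ℕ) with hu
      have h3 : ‖(u : UnitAddCircle)‖ < d + e := by
        have h4 : (u : UnitAddCircle) = (z - ((b : ℝ) / (g * y : ℕ) : ℝ)) -
            (z - ((a : ℝ) / (g * x : ℕ) : ℝ)) := by
          rw [hu, AddCircle.coe_sub]
          abel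
        rw [h4]
        linarith [norm_sub_le (z - (((b : ℝ) / (g * y : ℕ) : ℝ) : UnitAddCircle))
          (z - (((a : ℝ) / (g * x : ℕ) : ℝ) : UnitAddCircle))]
      rw [UnitAddCircle.norm_eq] at h3
      have hg' : (0 : ℝ) < g := by exact_mod_cast hg
      have hx' : (0 : ℝ) < x := by exact_mod_cast hx
      have hy' : (0 : ℝ) < y := by exact_mod_cast hy
      have h5 : (((a : ℤ) * y - b * x - g * x * y * round u : ℤ) : ℝ) =
          g * x * y * (u - round u) := by
        rw [hu]
        push_cast
        field_simp
      refine mem_closePairs hxy hne (n := (a : ℤ) * y - b * x - g * x * y * round u) ?_ ?_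
      · rw [hT]
        refine Nat.le_floor ?_
        rw [Nat.cast_natAbs, Int.cast_abs, h5, abs_mul, abs_of_nonneg (by positivity)]
        exact mul_le_mul_of_nonneg_left h3.le (by positivity)
      · refine mem_reducedPairs.2 ⟨ha, hb, hac, hbc, round u, ?_⟩
        push_cast
        ring
    · rw [mem_closedBall_iff_norm]
      exact h1.le.trans (le_abs_self d)
    · rw [mem_closedBall_iff_norm]
      exact h2.le.trans (le_abs_self e)
  refine (measureReal_mono hsub (hfin _)).trans ((measureReal_biUnion_finset_le _ _).trans ?_)
  rw [← nsmul_eq_mul]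
  refine Finset.sum_le_card_nsmul _ _ _ fun p _ => ?_
  have hball : ∀ (c : UnitAddCircle) (r : ℝ), 0 ≤ r →
      volume.real (Metric.closedBall c r) ≤ 2 * r := by
    intro c r hr
    rw [Measure.real, AddCircle.volume_closedBall, ENNReal.toReal_ofReal (by positivity)]
    exact min_le_right _ _
  rw [mul_min_of_nonneg _ _ (by norm_num : (0 : ℝ) ≤ 2)]
  exact le_min
    ((measureReal_mono Set.inter_subset_left (hfin _)).trans (hball _ _ (abs_nonneg d)))
    ((measureReal_mono Set.inter_subset_right (hfin _)).trans (hball _ _ (abs_nonneg e)))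

/-- The approximation radius at denominator `v` giving total length `2 s`. -/
noncomputable def approxRadius (s : ℕ → ℝ) (v : ℕ) : ℝ := s v / (v * totientRatio v)

lemma approxRadius_nonneg {s : ℕ → ℝ} (hs : ∀ v, 0 ≤ s v) (v : ℕ) : 0 ≤ approxRadius s v :=
  div_nonneg (hs v) (mul_nonneg (Nat.cast_nonneg v) (totientRatio_pos v).le)

/-- Points within `approxRadius s v` of a fraction of exact denominator `v`. -/
noncomputable def approxSet (s : ℕ → ℝ) (v : ℕ) : Set UnitAddCircle :=
  approxAddOrderOf UnitAddCircle v (approxRadius s v)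

/-- The least common multiple times the sum of the radii. -/
noncomputable def overlapScale (s : ℕ → ℝ) (v w : ℕ) : ℝ :=
  ((w / v.gcd w : ℕ) : ℝ) * (s v / totientRatio v) +
    ((v / v.gcd w : ℕ) : ℝ) * (s w / totientRatio w)

lemma exists_volume_inter_le : ∃ C : ℝ, 0 < C ∧ ∀ s : ℕ → ℝ, (∀ v, 0 ≤ s v) →
    ∀ v w : ℕ, 0 < v → 0 < w → v ≠ w →
      volume.real (approxSet s v ∩ approxSet s w) ≤
        if ⌊overlapScale s v w⌋₊ = 0 then 0 else
          C * (s v * s w * (1 + pairWeight v w / ⌊overlapScale s v w⌋₊)) := by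
  obtain ⟨C, hC, h⟩ := exists_card_closePairs_le
  obtain ⟨K, hK, hK'⟩ := exists_tailProd_le
  refine ⟨4 * C * K, by positivity, fun s hs v w hv hw hvw => ?_⟩
  set g := v.gcd w with hg
  set x := v / g with hx
  set y := w / g with hy
  have hg0 : 0 < g := Nat.gcd_pos_of_pos_left w hv
  have hv' : g * x = v := Nat.mul_div_cancel' (Nat.gcd_dvd_left v w)
  have hw' : g * y = w := Nat.mul_div_cancel' (Nat.gcd_dvd_right v w)
  have hx0 : 0 < x := Nat.pos_of_ne_zero fun h => by rw [h, mul_zero] at hv'; omega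
  have hy0 : 0 < y := Nat.pos_of_ne_zero fun h => by rw [h, mul_zero] at hw'; omega
  have hxy : x.Coprime y := Nat.coprime_div_gcd_div_gcd hg0
  have hne : x ≠ y := fun h => hvw (by rw [← hv', ← hw', h])
  have hgr : (0 : ℝ) < g := by exact_mod_cast hg0
  have hxr : (0 : ℝ) < x := by exact_mod_cast hx0
  have hyr : (0 : ℝ) < y := by exact_mod_cast hy0
  set d := approxRadius s v with hd
  set e := approxRadius s w with he
  have hd0 : 0 ≤ d := approxRadius_nonneg hs v
  have he0 : 0 ≤ e := approxRadius_nonneg hs w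
  have hrv := totientRatio_pos v
  have hrw := totientRatio_pos w
  have hdv : g * x * d * totientRatio v = s v := by
    rw [hd, approxRadius, ← hv']
    rw [← hv'] at hrv
    push_cast
    field_simp
  have hew : g * y * e * totientRatio w = s w := by
    rw [he, approxRadius, ← hw']
    rw [← hw'] at hrw
    push_cast
    field_simp
  have hscale : g * x * y * (d + e) = overlapScale s v w := by
    rw [overlapScale, ← hg, ← hx, ← hy, ← hdv, ← hew]
    field_simp
  have h1 := volume_approxAddOrderOf_inter_le (d := d) (e := e) hg0 hx0 hy0 hxy hne
  rw [abs_of_nonneg hd0, abs_of_nonneg he0, hscale, hv', hw'] at h1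
  set T := ⌊overlapScale s v w⌋₊ with hT
  split_ifs with hT0
  · rw [hT0] at h1
    refine h1.trans_eq ?_
    simp [closePairs, coprimeUpTo]
  have hTpos : 0 < T := Nat.pos_of_ne_zero hT0
  have hTr : (0 : ℝ) < T := by exact_mod_cast hTpos
  have hTle : (T : ℝ) ≤ g * x * y * (d + e) := by
    rw [hscale]
    refine Nat.floor_le ?_
    rw [← hscale]
    positivity
  have h2 := h g x y T hg0 hx0 hy0 hxy
  rw [hv', hw'] at h2
  have hmin : (T : ℝ) * (2 * min d e) ≤ 4 * (g * x * y) * (d * e) := by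
    have h3 : (d + e) * min d e ≤ 2 * (d * e) := by
      rcases le_total d e with h | h
      · rw [min_eq_left h]; nlinarith
      · rw [min_eq_right h]; nlinarith
    have h4 : 0 ≤ min d e := le_min hd0 he0
    have h5 := mul_le_mul_of_nonneg_right hTle h4
    have h6 := mul_le_mul_of_nonneg_left h3 (by positivity : 0 ≤ (g : ℝ) * x * y)
    nlinarith
  have htail := hK' (x * y) T hTpos
  have htail0 := tailProd_nonneg (x * y) T
  calc _ ≤ (C * T * (g * (totientRatio v * totientRatio w)) * tailProd (x * y) T) *
          (2 * min d e) := h1.trans (mul_le_mul_of_nonneg_right h2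
            (mul_nonneg (by norm_num) (le_min hd0 he0)))
    _ = C * (g * (totientRatio v * totientRatio w)) * tailProd (x * y) T *
          (T * (2 * min d e)) := by ring
    _ ≤ C * (g * (totientRatio v * totientRatio w)) * tailProd (x * y) T *
          (4 * (g * x * y) * (d * e)) := mul_le_mul_of_nonneg_left hmin (by positivity)
    _ = 4 * C * (s v * s w) * tailProd (x * y) T := by
        rw [← hdv, ← hew]
        ring
    _ ≤ 4 * C * (s v * s w) * (K * (1 + primeWeight (x * y) / T)) :=
        mul_le_mul_of_nonneg_left htail
          (mul_nonneg (by positivity) (mul_nonneg (hs v) (hs w)))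
    _ = _ := by
        rw [pairWeight]
        ring

/-- Sum of the pairwise overlaps in terms of the total mass. -/
lemma exists_sum_volume_inter_le : ∃ C : ℝ, 0 < C ∧ ∀ (s : ℕ → ℝ) (V : Finset ℕ),
    (∀ v, 0 ≤ s v) → (∀ v ∈ V, 0 < v) →
      ∑ e ∈ V.offDiag, volume.real (approxSet s e.1 ∩ approxSet s e.2) ≤
        C * ((∑ v ∈ V, s v) ^ 2 + (∑ v ∈ V, s v) * √(∑ v ∈ V, s v)) := by
  obtain ⟨C, hC, h⟩ := exists_volume_inter_le
  obtain ⟨K, hK, hK'⟩ := exists_sum_pairWeight_le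
  set r : ℝ := √2 / 2 with hr
  have hr0 : 0 ≤ r := by positivity
  have hr1 : r < 1 := by
    have : √(2 : ℝ) < 2 := by
      rw [Real.sqrt_lt' (by norm_num)]
      norm_num
    rw [hr]
    linarith
  set G := ∑' n : ℕ, r ^ n with hG
  have hG0 : 0 ≤ G := tsum_nonneg fun n => by positivity
  refine ⟨C * (1 + K * √2 * G), by positivity, fun s V hs hV => ?_⟩
  set m := ∑ v ∈ V, s v with hm
  have hm0 : 0 ≤ m := Finset.sum_nonneg fun v _ => hs v
  set T : ℕ × ℕ → ℕ := fun e => ⌊overlapScale s e.1 e.2⌋₊ with hT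
  set E := V.offDiag.filter fun e => T e ≠ 0 with hE
  have hEmem : ∀ e ∈ E, e.1 ∈ V ∧ e.2 ∈ V ∧ e.1 ≠ e.2 ∧ T e ≠ 0 := fun e he => by
    obtain ⟨h1, h2⟩ := Finset.mem_filter.1 he
    obtain ⟨h3, h4, h5⟩ := Finset.mem_offDiag.1 h1
    exact ⟨h3, h4, h5, h2⟩
  have hEV : E ⊆ V ×ˢ V := fun e he =>
    Finset.mem_product.2 ⟨(hEmem e he).1, (hEmem e he).2.1⟩
  have hss : ∀ e : ℕ × ℕ, 0 ≤ s e.1 * s e.2 := fun e => mul_nonneg (hs _) (hs _)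
  have hpw : ∀ e : ℕ × ℕ, 0 ≤ pairWeight e.1 e.2 := fun e =>
    zero_le_one.trans (one_le_pairWeight _ _)
  have h1 : ∑ e ∈ V.offDiag, volume.real (approxSet s e.1 ∩ approxSet s e.2) ≤
      ∑ e ∈ E, C * (s e.1 * s e.2 * (1 + pairWeight e.1 e.2 / T e)) := by
    rw [hE, Finset.sum_filter]
    refine Finset.sum_le_sum fun e he => ?_
    obtain ⟨h3, h4, h5⟩ := Finset.mem_offDiag.1 he
    have := h s hs e.1 e.2 (hV _ h3) (hV _ h4) h5
    rw [ite_not]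
    exact this
  have h2 : ∑ e ∈ E, s e.1 * s e.2 ≤ m ^ 2 := by
    rw [sq, hm, Finset.sum_mul_sum, ← Finset.sum_product']
    exact Finset.sum_le_sum_of_subset_of_nonneg hEV fun e _ _ => hss e
  have h3 : ∀ k : ℕ, ∑ e ∈ E with Nat.log 2 (T e) = k,
      s e.1 * s e.2 * (pairWeight e.1 e.2 / T e) ≤ K * √2 * (m * √m) * r ^ k := by
    intro k
    have h4 := hK' s ((2 : ℝ) ^ (k + 1)) V (E.filter fun e => Nat.log 2 (T e) = k) hs
      (by positivity) hV ((Finset.filter_subset _ _).trans hEV) fun e he => ?_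
    · have h2k : (0 : ℝ) < 2 ^ k := by positivity
      have h5 : √((2 : ℝ) ^ (k + 1)) = √2 ^ k * √2 := by
        rw [← pow_succ, Real.sqrt_eq_iff_mul_self_eq (by positivity) (by positivity), ← mul_pow,
          Real.mul_self_sqrt (by norm_num)]
      calc _ ≤ ∑ e ∈ E with Nat.log 2 (T e) = k,
            ((2 : ℝ) ^ k)⁻¹ * (s e.1 * s e.2 * pairWeight e.1 e.2) := by
            refine Finset.sum_le_sum fun e he => ?_
            obtain ⟨he1, rfl⟩ := Finset.mem_filter.1 he
            have h6 : ((2 : ℝ) ^ Nat.log 2 (T e)) ≤ T e := by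
              exact_mod_cast Nat.pow_log_le_self 2 (hEmem e he1).2.2.2
            rw [div_eq_inv_mul, mul_left_comm]
            exact mul_le_mul_of_nonneg_right (inv_anti₀ h2k h6)
              (mul_nonneg (hss e) (hpw e))
        _ ≤ ((2 : ℝ) ^ k)⁻¹ * (K * √((2 : ℝ) ^ (k + 1)) * (m * √m)) := by
            rw [← Finset.mul_sum]
            exact mul_le_mul_of_nonneg_left h4 (by positivity)
        _ = _ := by
            rw [h5, hr, div_pow]
            ring
    · obtain ⟨he1, he2⟩ := Finset.mem_filter.1 he
      have h6 : overlapScale s e.1 e.2 ≤ (2 : ℝ) ^ (k + 1) := by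
        have h7 : T e + 1 ≤ 2 ^ (k + 1) := by
          rw [← he2]
          exact Nat.lt_pow_succ_log_self one_lt_two (T e)
        have h8 : ((T e : ℝ) + 1) ≤ 2 ^ (k + 1) := by exact_mod_cast h7
        exact (Nat.lt_floor_add_one _).le.trans h8
      rw [overlapScale] at h6
      have hq : ∀ v w : ℕ, 0 ≤ (w : ℝ) * (s v / totientRatio v) := fun v w =>
        mul_nonneg (Nat.cast_nonneg w) (div_nonneg (hs v) (totientRatio_pos v).le)
      exact ⟨by linarith [hq e.1 (e.2 / e.1.gcd e.2)], by linarith [hq e.2 (e.1 / e.1.gcd e.2)]⟩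
  have h4 : ∑ e ∈ E, s e.1 * s e.2 * (pairWeight e.1 e.2 / T e) ≤ K * √2 * (m * √m) * G := by
    rw [← Finset.sum_fiberwise_of_maps_to (t := E.image fun e => Nat.log 2 (T e))
      fun e he => Finset.mem_image_of_mem _ he]
    refine (Finset.sum_le_sum fun k _ => h3 k).trans ?_
    rw [← Finset.mul_sum]
    exact mul_le_mul_of_nonneg_left ((summable_geometric_of_lt_one hr0 hr1).sum_le_tsum _
      fun k _ => by positivity) (by positivity)
  have h5 : ∑ e ∈ E, C * (s e.1 * s e.2 * (1 + pairWeight e.1 e.2 / T e)) =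
      C * (∑ e ∈ E, s e.1 * s e.2 + ∑ e ∈ E, s e.1 * s e.2 * (pairWeight e.1 e.2 / T e)) := by
    rw [← Finset.sum_add_distrib, Finset.mul_sum]
    exact Finset.sum_congr rfl fun e _ => by ring
  rw [h5] at h1
  refine h1.trans ?_
  rw [mul_assoc C]
  refine mul_le_mul_of_nonneg_left ?_ hC.le
  have h6 : 0 ≤ K * √2 * G * m ^ 2 := by positivity
  have h7 : 0 ≤ m * √m := by positivity
  nlinarith

lemma approxSet_eq_biUnion (s : ℕ → ℝ) {v : ℕ} (hv : 0 < v) :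
    approxSet s v = ⋃ a ∈ (Finset.range v).filter (fun a => v.Coprime a),
      Metric.ball (((a : ℝ) / v : ℝ) : UnitAddCircle) (approxRadius s v) := by
  ext z
  rw [approxSet, UnitAddCircle.mem_approxAddOrderOf_iff hv]
  simp only [Set.mem_iUnion, Finset.mem_filter, Finset.mem_range, mem_ball_iff_norm, exists_prop]
  exact ⟨fun ⟨a, h1, h2, h3⟩ => ⟨a, ⟨h1, Nat.coprime_comm.1 h2⟩, h3⟩,
    fun ⟨a, ⟨h1, h2⟩, h3⟩ => ⟨a, h1, Nat.coprime_comm.1 h2, h3⟩⟩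

lemma inv_le_norm_sub_of_ne {v a b : ℕ} (ha : a < v) (hb : b < v) (hab : a ≠ b) :
    (v : ℝ)⁻¹ ≤ ‖(((a : ℝ) / v : ℝ) : UnitAddCircle) - (((b : ℝ) / v : ℝ) : UnitAddCircle)‖ := by
  have hv : (0 : ℝ) < v := by exact_mod_cast (Nat.zero_le a).trans_lt ha
  rw [← AddCircle.coe_sub, UnitAddCircle.norm_eq, ← sub_div]
  set k := round (((a : ℝ) - b) / v) with hk
  have h1 : ((a : ℝ) - b) / v - k = ((a - b - v * k : ℤ) : ℝ) / v := by
    push_cast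
    field_simp
  have h2 : (a - b - v * k : ℤ) ≠ 0 := by
    intro h
    have h3 : (v : ℤ) ∣ a - b := ⟨k, by linarith⟩
    have h4 := Int.eq_zero_of_abs_lt_dvd h3 (by rw [abs_lt]; omega)
    omega
  have h5 : (1 : ℝ) ≤ |((a - b - v * k : ℤ) : ℝ)| := by exact_mod_cast Int.one_le_abs h2
  rw [h1, abs_div, abs_of_pos hv, inv_eq_one_div]
  exact div_le_div_of_nonneg_right h5 hv.le

lemma volume_approxSet {s : ℕ → ℝ} (hs : ∀ v, 0 ≤ s v) {v : ℕ} (hv : 0 < v)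
    (h : s v / totientRatio v ≤ 1 / 2) : volume.real (approxSet s v) = 2 * s v := by
  have hv' : (0 : ℝ) < v := by exact_mod_cast hv
  have hr := totientRatio_pos v
  set d := approxRadius s v with hd
  have hd0 : 0 ≤ d := approxRadius_nonneg hs v
  have hdv : v * d = s v / totientRatio v := by
    rw [hd, approxRadius]
    field_simp
  have hd2 : 2 * d ≤ (v : ℝ)⁻¹ := by
    rw [← hdv] at h
    rw [← one_div, le_div_iff₀ hv']
    linarith
  have hball : ∀ c : UnitAddCircle, volume.real (Metric.ball c d) = 2 * d := by
    intro c
    rw [← measureReal_congr AddCircle.closedBall_ae_eq_ball, Measure.real,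
      AddCircle.volume_closedBall, ENNReal.toReal_ofReal (le_min zero_le_one (by positivity)),
      min_eq_right]
    exact hd2.trans (inv_le_one_of_one_le₀ (by exact_mod_cast hv))
  rw [approxSet_eq_biUnion s hv, measureReal_biUnion_finset ?_
    (fun b _ => Metric.isOpen_ball.measurableSet) (fun b _ => measure_ne_top _ _)]
  · rw [Finset.sum_congr rfl fun a _ => hball _, Finset.sum_const, ← Nat.totient_eq_card_coprime,
      nsmul_eq_mul, totient_eq_mul_totientRatio]
    have : s v = v * d * totientRatio v := by
      rw [hdv]
      field_simp
    rw [this]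
    ring
  · intro a ha b hb hab
    rw [Finset.mem_coe, Finset.mem_filter, Finset.mem_range] at ha hb
    refine Set.disjoint_left.2 fun z hz1 hz2 => ?_
    rw [mem_ball_iff_norm] at hz1 hz2
    have h1 := inv_le_norm_sub_of_ne ha.1 hb.1 hab
    have h2 := norm_sub_le (z - (((b : ℝ) / v : ℝ) : UnitAddCircle))
      (z - (((a : ℝ) / v : ℝ) : UnitAddCircle))
    rw [sub_sub_sub_cancel_left] at h2
    linarith

/-- Second-moment lower bound for the measure of a finite union. -/
lemma two_mul_sum_sub_le_measureReal_biUnion {X ι : Type*} [MeasurableSpace X] {μ : Measure X}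
    [IsFiniteMeasure μ] (V : Finset ι) {A : ι → Set X} (hA : ∀ i, MeasurableSet (A i)) (t : ℝ) :
    2 * t * ∑ i ∈ V, μ.real (A i) - t ^ 2 * ∑ i ∈ V, ∑ j ∈ V, μ.real (A i ∩ A j) ≤
      μ.real (⋃ i ∈ V, A i) := by
  have hU : MeasurableSet (⋃ i ∈ V, A i) := Finset.measurableSet_biUnion V fun i _ => hA i
  have hint : ∀ B : Set X, MeasurableSet B → Integrable (B.indicator (1 : X → ℝ)) μ := fun B hB =>
    (integrable_const (1 : ℝ)).indicator hB
  have h1 : Integrable (fun z => ∑ i ∈ V, (A i).indicator (1 : X → ℝ) z) μ :=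
    integrable_finsetSum _ fun i _ => hint _ (hA i)
  have h2 : Integrable (fun z => ∑ i ∈ V, ∑ j ∈ V, (A i ∩ A j).indicator (1 : X → ℝ) z) μ :=
    integrable_finsetSum _ fun i _ => integrable_finsetSum _ fun j _ =>
      hint _ ((hA i).inter (hA j))
  have e1 : ∫ z, ∑ i ∈ V, (A i).indicator (1 : X → ℝ) z ∂μ = ∑ i ∈ V, μ.real (A i) := by
    rw [integral_finsetSum _ fun i _ => hint _ (hA i)]
    exact Finset.sum_congr rfl fun i _ => integral_indicator_one (hA i)
  have e2 : ∫ z, ∑ i ∈ V, ∑ j ∈ V, (A i ∩ A j).indicator (1 : X → ℝ) z ∂μ =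
      ∑ i ∈ V, ∑ j ∈ V, μ.real (A i ∩ A j) := by
    rw [integral_finsetSum _ fun i _ => integrable_finsetSum _ fun j _ =>
      hint _ ((hA i).inter (hA j))]
    refine Finset.sum_congr rfl fun i _ => ?_
    rw [integral_finsetSum _ fun j _ => hint _ ((hA i).inter (hA j))]
    exact Finset.sum_congr rfl fun j _ => integral_indicator_one ((hA i).inter (hA j))
  rw [← e1, ← e2, ← integral_const_mul, ← integral_const_mul,
    ← integral_sub (h1.const_mul _) (h2.const_mul _), ← integral_indicator_one hU]
  refine integral_mono ((h1.const_mul _).sub (h2.const_mul _)) (hint _ hU) fun z => ?_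
  have h3 : ∑ i ∈ V, ∑ j ∈ V, (A i ∩ A j).indicator (1 : X → ℝ) z =
      (∑ i ∈ V, (A i).indicator (1 : X → ℝ) z) ^ 2 := by
    rw [sq, Finset.sum_mul_sum]
    refine Finset.sum_congr rfl fun i _ => Finset.sum_congr rfl fun j _ => ?_
    rw [Set.inter_indicator_one, Pi.mul_apply]
  simp only
  rw [h3]
  set f := ∑ i ∈ V, (A i).indicator (1 : X → ℝ) z with hf
  by_cases hz : z ∈ ⋃ i ∈ V, A i
  · rw [Set.indicator_of_mem hz, Pi.one_apply]
    nlinarith [sq_nonneg (t * f - 1)]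
  · rw [Set.indicator_of_notMem hz]
    have : f = 0 := by
      rw [hf]
      refine Finset.sum_eq_zero fun i hi => Set.indicator_of_notMem (fun h => hz ?_) _
      exact Set.mem_biUnion hi h
    rw [this]
    simp

lemma exists_block {s : ℕ → ℝ} (hs : ∀ v, 0 ≤ s v) (h1 : ∀ v, s v ≤ 1) (hsum : ¬ Summable s)
    (N : ℕ) : ∃ V : Finset ℕ, (∀ v ∈ V, N ≤ v) ∧ 1 ≤ ∑ v ∈ V, s v ∧ ∑ v ∈ V, s v ≤ 2 := by
  have h2 : ¬ Summable fun n => s (n + N) := fun h => hsum ((summable_nat_add_iff N).1 h)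
  have h3 := (not_summable_iff_tendsto_nat_atTop_of_nonneg fun n => hs (n + N)).1 h2
  have hex : ∃ n, 1 ≤ ∑ i ∈ Finset.range n, s (i + N) := (h3.eventually_ge_atTop 1).exists
  classical
  have hn := Nat.find_spec hex
  have hmin := fun m => Nat.find_min (m := m) hex
  set n := Nat.find hex
  have hsumeq : ∑ v ∈ (Finset.range n).image (· + N), s v = ∑ i ∈ Finset.range n, s (i + N) :=
    Finset.sum_image fun a _ b _ h => Nat.add_right_cancel h
  refine ⟨(Finset.range n).image (· + N), fun v hv => ?_, hsumeq ▸ hn, ?_⟩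
  · obtain ⟨i, -, rfl⟩ := Finset.mem_image.1 hv
    exact Nat.le_add_left N i
  · rw [hsumeq]
    rcases Nat.eq_zero_or_pos n with h0 | h0
    · rw [h0, Finset.sum_range_zero]
      norm_num
    · obtain ⟨k, hk⟩ := Nat.exists_eq_succ_of_ne_zero h0.ne'
      have h4 := hmin k (by omega)
      rw [hk, Finset.sum_range_succ]
      linarith [h1 (k + N), not_le.1 h4]

/-- Divergence case of the metric theorem for reduced fractions. -/
theorem ae_infinite_mem_approxSet {s : ℕ → ℝ} (hs : ∀ v, 0 ≤ s v)
    (hhalf : ∀ v, s v / totientRatio v ≤ 1 / 2) (hsum : ¬ Summable s) :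
    ∀ᵐ x : UnitAddCircle, {v : ℕ | 0 < v ∧ x ∈ approxSet s v}.Infinite := by
  obtain ⟨C, hC, hov⟩ := exists_sum_volume_inter_le
  have hle1 : ∀ v, s v ≤ 1 := by
    intro v
    have h1 := hhalf v
    rw [div_le_iff₀ (totientRatio_pos v)] at h1
    linarith [totientRatio_le_one v]
  have hmeas : ∀ v, MeasurableSet (approxSet s v) := fun v =>
    Metric.isOpen_thickening.measurableSet
  have hlim : Tendsto (approxRadius s) atTop (nhds 0) := by
    refine squeeze_zero (approxRadius_nonneg hs) (fun v => ?_)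
      (tendsto_inv_atTop_nhds_zero_nat (𝕜 := ℝ))
    rw [approxRadius, mul_comm, ← div_div, div_eq_mul_inv]
    exact mul_le_of_le_one_left (by positivity) ((hhalf v).trans (by norm_num))
  have hmem : ∀ x : UnitAddCircle, x ∈ addWellApproximable UnitAddCircle (approxRadius s) ↔
      {v : ℕ | 0 < v ∧ x ∈ approxSet s v}.Infinite := by
    intro x
    rw [UnitAddCircle.mem_addWellApproximable_iff]
    refine iff_of_eq (congrArg _ (Set.ext fun v => ?_))
    rcases Nat.eq_zero_or_pos v with rfl | hv
    · simp
    · exact ((UnitAddCircle.mem_approxAddOrderOf_iff hv).symm.trans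
        (and_iff_right hv).symm)
  rcases AddCircle.addWellApproximable_ae_empty_or_univ (T := 1) (approxRadius s) hlim with h | h
  swap
  · filter_upwards [h] with x hx using (hmem x).1 hx
  exfalso
  set c := (4 + 8 * C)⁻¹ with hc
  have hc0 : 0 < c := by positivity
  set B : ℕ → Set UnitAddCircle := fun N => ⋃ v ≥ N + 1, approxSet s v with hB
  have hBmeas : ∀ N, MeasurableSet (B N) := fun N =>
    MeasurableSet.iUnion fun v => MeasurableSet.iUnion fun _ => hmeas v
  have hBc : ∀ N, c ≤ volume.real (B N) := by
    intro N
    obtain ⟨V, hV, hV1, hV2⟩ := exists_block hs hle1 hsum (N + 1)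
    have hV0 : ∀ v ∈ V, 0 < v := fun v hv => (Nat.succ_pos N).trans_le (hV v hv)
    set m := ∑ v ∈ V, s v with hm
    have hA : ∑ v ∈ V, volume.real (approxSet s v) = 2 * m := by
      rw [hm, Finset.mul_sum]
      exact Finset.sum_congr rfl fun v hv => volume_approxSet hs (hV0 v hv) (hhalf v)
    have hQ : ∑ v ∈ V, ∑ w ∈ V, volume.real (approxSet s v ∩ approxSet s w) ≤ 4 + 8 * C := by
      have h3 := hov s V hs hV0
      rw [← Finset.sum_product' (f := fun v w => volume.real (approxSet s v ∩ approxSet s w)),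
        ← Finset.diag_union_offDiag, Finset.sum_union (Finset.disjoint_diag_offDiag V),
        Finset.sum_diag]
      simp only [Set.inter_self]
      rw [hA]
      have h4 : √m ≤ 2 := Real.sqrt_le_iff.2 ⟨by norm_num, by linarith⟩
      have h5 : m ^ 2 + m * √m ≤ 8 := by nlinarith [Real.sqrt_nonneg m]
      nlinarith
    have h6 := two_mul_sum_sub_le_measureReal_biUnion (μ := volume) V hmeas c
    rw [hA] at h6
    have h7 : volume.real (⋃ v ∈ V, approxSet s v) ≤ volume.real (B N) :=
      measureReal_mono (Set.biUnion_mono (fun v hv => hV v hv) fun _ _ => subset_rfl)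
        (measure_ne_top _ _)
    have h8 : c * (4 + 8 * C) = 1 := inv_mul_cancel₀ (by positivity)
    have h9 : c ^ 2 * ∑ v ∈ V, ∑ w ∈ V, volume.real (approxSet s v ∩ approxSet s w) ≤ c := by
      calc _ ≤ c ^ 2 * (4 + 8 * C) := mul_le_mul_of_nonneg_left hQ (by positivity)
        _ = c * (c * (4 + 8 * C)) := by ring
        _ = c := by rw [h8, mul_one]
    nlinarith
  have hanti : Antitone B := fun N M hNM =>
    Set.biUnion_mono (fun v hv => le_trans (Nat.succ_le_succ hNM) hv) fun _ _ => subset_rfl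
  have htend := tendsto_measure_iInter_atTop (μ := volume)
    (fun N => (hBmeas N).nullMeasurableSet) hanti ⟨0, measure_ne_top _ _⟩
  have hzero : volume (⋂ N, B N) = 0 := by
    refine measure_mono_null (fun x hx => ?_) h
    rw [Set.mem_compl_iff, Set.mem_ofPred, not_not, hmem]
    refine Set.infinite_of_not_bddAbove fun ⟨M, hM⟩ => ?_
    obtain ⟨v, hv, hxv⟩ := Set.mem_iUnion₂.1 (Set.mem_iInter.1 hx M)
    have : v ≤ M := hM ⟨(Nat.succ_pos M).trans_le hv, hxv⟩
    exact absurd (hv : M + 1 ≤ v) (by omega)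
  rw [hzero] at htend
  have hge : ENNReal.ofReal c ≤ 0 := ge_of_tendsto' htend fun N =>
    (ENNReal.ofReal_le_iff_le_toReal (measure_ne_top _ _)).2 (hBc N)
  exact absurd (ENNReal.ofReal_eq_zero.1 (le_antisymm hge bot_le)) (not_le.2 hc0)

lemma nint_nonneg (x : ℝ) : 0 ≤ nint x := abs_nonneg _

lemma nint_lt_of_mem_approxSet {s : ℕ → ℝ} {v : ℕ} (hv : 0 < v) {α : ℝ}
    (h : (α : UnitAddCircle) ∈ approxSet s v) : nint (α * v) < s v / totientRatio v := by
  obtain ⟨a, -, -, h1⟩ := (UnitAddCircle.mem_approxAddOrderOf_iff hv).1 h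
  have hv' : (0 : ℝ) < v := by exact_mod_cast hv
  rw [← AddCircle.coe_sub, UnitAddCircle.norm_eq] at h1
  set k := round (α - a / v) with hk
  have h2 : α * v - ((a + k * v : ℤ) : ℝ) = v * (α - a / v - k) := by
    push_cast
    field_simp
    ring
  refine (round_le (α * v) (a + k * v : ℤ)).trans_lt ?_
  rw [h2, abs_mul, abs_of_pos hv']
  refine (mul_lt_mul_of_pos_left h1 hv').trans_eq ?_
  have := totientRatio_pos v
  rw [approxRadius]
  field_simp

lemma ae_infinite_nint_lt {s : ℕ → ℝ} (hs : ∀ v, 0 ≤ s v)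
    (hhalf : ∀ v, s v / totientRatio v ≤ 1 / 2) (hsum : ¬ Summable s) :
    ∀ᵐ α ∂(volume.restrict (Set.Icc (0 : ℝ) 1)),
      {v : ℕ | 0 < v ∧ nint (α * v) < s v / totientRatio v}.Infinite := by
  have h := (AddCircle.measurePreserving_mk 1 0).quasiMeasurePreserving.ae
    (ae_infinite_mem_approxSet hs hhalf hsum)
  rw [zero_add, Measure.restrict_congr_set Ioc_ae_eq_Icc] at h
  filter_upwards [h] with α hα
  exact hα.mono fun v hv => ⟨hv.1, nint_lt_of_mem_approxSet hv.1 hv.2⟩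

lemma one_le_Log (x : ℝ) : 1 ≤ Log x := le_max_left _ _

lemma Log_pos (x : ℝ) : 0 < Log x := zero_lt_one.trans_le (one_le_Log x)

lemma Log_mono {x y : ℝ} (hx : 0 < x) (hxy : x ≤ y) : Log x ≤ Log y :=
  max_le_max le_rfl (Real.log_le_log hx hxy)

lemma Log2_pos (x : ℝ) : 0 < Log2 x := Log_pos _

lemma Log2_mono {x y : ℝ} (hx : 0 < x) (hxy : x ≤ y) : Log2 x ≤ Log2 y :=
  Log_mono (Log_pos x) (Log_mono hx hxy)

lemma Log_two_pow_le (k : ℕ) (hk : 0 < k) : Log ((2 : ℝ) ^ k) ≤ k := by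
  have hk1 : (1 : ℝ) ≤ k := by exact_mod_cast hk
  refine max_le hk1 ?_
  rw [Real.log_pow]
  have : Real.log 2 ≤ 1 := by linarith [Real.log_two_lt_d9]
  nlinarith

lemma not_summable_inv_mul_Log : ¬ Summable fun k : ℕ => ((k : ℝ) * Log k)⁻¹ := by
  rw [← summable_condensed_iff_of_nonneg (fun k => inv_nonneg.2
    (mul_nonneg (Nat.cast_nonneg k) (Log_pos _).le))]
  · refine fun h => Real.not_summable_natCast_inv (h.of_nonneg_of_le (fun k => by positivity)
      fun k => ?_)
    rcases Nat.eq_zero_or_pos k with rfl | hk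
    · rw [Nat.cast_zero, inv_zero]
      exact mul_nonneg (by positivity) (inv_nonneg.2 (mul_nonneg (by positivity) (Log_pos _).le))
    · rw [Nat.cast_pow, Nat.cast_ofNat, mul_inv, mul_inv_cancel_left₀ (by positivity)]
      exact inv_anti₀ (Log_pos _) (Log_two_pow_le k hk)
  · intro m n hm hmn
    have hm' : (0 : ℝ) < m := by exact_mod_cast hm
    have hmn' : (m : ℝ) ≤ n := by exact_mod_cast hmn
    exact inv_anti₀ (mul_pos hm' (Log_pos _))
      (mul_le_mul hmn' (Log_mono hm' hmn') (Log_pos _).le (by positivity))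

lemma not_summable_inv_mul_Log_mul_Log2 :
    ¬ Summable fun k : ℕ => ((k : ℝ) * (Log k * Log2 k))⁻¹ := by
  rw [← summable_condensed_iff_of_nonneg (fun k => inv_nonneg.2
    (mul_nonneg (Nat.cast_nonneg k) (mul_pos (Log_pos _) (Log2_pos _)).le))]
  · refine fun h => not_summable_inv_mul_Log (h.of_nonneg_of_le (fun k => inv_nonneg.2
      (mul_nonneg (Nat.cast_nonneg k) (Log_pos _).le)) fun k => ?_)
    rcases Nat.eq_zero_or_pos k with rfl | hk
    · rw [Nat.cast_zero, zero_mul, inv_zero]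
      exact mul_nonneg (by positivity) (inv_nonneg.2
        (mul_nonneg (by positivity) (mul_pos (Log_pos _) (Log2_pos _)).le))
    · rw [Nat.cast_pow, Nat.cast_ofNat, mul_inv ((2 : ℝ) ^ k), mul_inv_cancel_left₀ (by positivity)]
      have h1 := Log_two_pow_le k hk
      exact inv_anti₀ (mul_pos (Log_pos _) (Log2_pos _))
        (mul_le_mul h1 (Log_mono (Log_pos _) h1) (Log2_pos _).le (Nat.cast_nonneg k))
  · intro m n hm hmn
    have hm' : (0 : ℝ) < m := by exact_mod_cast hm
    have hmn' : (m : ℝ) ≤ n := by exact_mod_cast hmn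
    exact inv_anti₀ (mul_pos hm' (mul_pos (Log_pos _) (Log2_pos _)))
      (mul_le_mul hmn' (mul_le_mul (Log_mono hm' hmn') (Log2_mono hm' hmn') (Log2_pos _).le
        (Log_pos _).le) (mul_pos (Log_pos _) (Log2_pos _)).le (by positivity))

/-- The floored differences among the first `N` terms, as natural numbers. -/
noncomputable def floorDiffs (a : ℕ → ℝ) (N : ℕ) : Finset ℕ :=
  (Finset.Icc 1 N).offDiag.image fun e => ⌊|a e.1 - a e.2|⌋₊

lemma mem_floorDiffs {a : ℕ → ℝ} {N q : ℕ} : q ∈ floorDiffs a N ↔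
    ∃ m n : ℕ, 1 ≤ m ∧ m ≤ N ∧ 1 ≤ n ∧ n ≤ N ∧ m ≠ n ∧ (q : ℤ) = ⌊|a m - a n|⌋ := by
  rw [floorDiffs, Finset.mem_image]
  constructor
  · rintro ⟨⟨m, n⟩, h, rfl⟩
    obtain ⟨h1, h2, h3⟩ := Finset.mem_offDiag.1 h
    rw [Finset.mem_Icc] at h1 h2
    exact ⟨m, n, h1.1, h1.2, h2.1, h2.2, h3, Int.natCast_floor_eq_floor (abs_nonneg _)⟩
  · rintro ⟨m, n, h1, h2, h3, h4, h5, h6⟩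
    refine ⟨(m, n), Finset.mem_offDiag.2 ⟨Finset.mem_Icc.2 ⟨h1, h2⟩,
      Finset.mem_Icc.2 ⟨h3, h4⟩, h5⟩, ?_⟩
    rw [← Int.natCast_floor_eq_floor (abs_nonneg _)] at h6
    exact_mod_cast h6.symm

lemma floorDiffs_mono (a : ℕ → ℝ) : Monotone (floorDiffs a) := fun _ _ h =>
  Finset.image_subset_image (Finset.offDiag_mono (Finset.Icc_subset_Icc_right h))

lemma setOf_floor_eq_image (a : ℕ → ℝ) (N : ℕ) :
    {k : ℤ | ∃ m n : ℕ, 1 ≤ m ∧ m ≤ N ∧ 1 ≤ n ∧ n ≤ N ∧ m ≠ n ∧ k = ⌊|a m - a n|⌋} =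
      ((floorDiffs a N).image fun q : ℕ => (q : ℤ) : Finset ℤ) := by
  ext k
  rw [Finset.mem_coe, Finset.mem_image]
  constructor
  · rintro ⟨m, n, h1, h2, h3, h4, h5, rfl⟩
    exact ⟨⌊|a m - a n|⌋₊, mem_floorDiffs.2 ⟨m, n, h1, h2, h3, h4, h5,
      Int.natCast_floor_eq_floor (abs_nonneg _)⟩, Int.natCast_floor_eq_floor (abs_nonneg _)⟩
  · rintro ⟨q, hq, rfl⟩
    exact mem_floorDiffs.1 hq

lemma Hcard_eq_card_floorDiffs (a : ℕ → ℝ) (N : ℕ) : Hcard a N = (floorDiffs a N).card := by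
  rw [Hcard, setOf_floor_eq_image, Set.ncard_coe_finset,
    Finset.card_image_of_injective _ Nat.cast_injective]

lemma le_sSup_floor {a : ℕ → ℝ} {N q : ℕ} (hq : q ∈ floorDiffs a N) :
    (q : ℝ) ≤ ((sSup {k : ℤ | ∃ m n : ℕ, 1 ≤ m ∧ m ≤ N ∧ 1 ≤ n ∧ n ≤ N ∧ m ≠ n ∧
      k = ⌊|a m - a n|⌋} : ℤ) : ℝ) := by
  rw [← Int.cast_natCast (R := ℝ), Int.cast_le]
  rw [setOf_floor_eq_image]
  exact le_csSup (Finset.bddAbove _) (Finset.mem_coe.2 (Finset.mem_image_of_mem _ hq))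

lemma floorDeltaMin_le {a : ℕ → ℝ} {N q : ℕ} (α : ℝ) (hq : q ∈ floorDiffs a N) :
    floorDeltaMin a α N ≤ nint (α * q) := by
  obtain ⟨m, n, h1, h2, h3, h4, h5, h6⟩ := mem_floorDiffs.1 hq
  refine csInf_le ⟨0, ?_⟩ ⟨m, n, h1, h2, h3, h4, h5, ?_⟩
  · rintro _ ⟨m, n, -, -, -, -, -, rfl⟩
    exact nint_nonneg _
  · rw [← h6, Int.cast_natCast]

lemma card_floorDiffs_succ_le (a : ℕ → ℝ) (N : ℕ) :
    (floorDiffs a (N + 1)).card ≤ (floorDiffs a N).card + N := by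
  have hsub : floorDiffs a (N + 1) ⊆ floorDiffs a N ∪
      (Finset.Icc 1 N).image fun n => ⌊|a (N + 1) - a n|⌋₊ := by
    intro q hq
    rw [floorDiffs, Finset.mem_image] at hq
    obtain ⟨⟨m, n⟩, h, rfl⟩ := hq
    obtain ⟨h1, h2, h3⟩ := Finset.mem_offDiag.1 h
    rw [Finset.mem_Icc] at h1 h2
    simp only at h1 h2 h3
    rw [Finset.mem_union]
    rcases Nat.lt_or_ge N m with hm | hm
    · obtain rfl : m = N + 1 := by omega
      exact Or.inr (Finset.mem_image_of_mem (fun n => ⌊|a (N + 1) - a n|⌋₊)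
        (Finset.mem_Icc.2 ⟨h2.1, by omega⟩))
    rcases Nat.lt_or_ge N n with hn | hn
    · obtain rfl : n = N + 1 := by omega
      right
      simp only
      rw [abs_sub_comm]
      exact Finset.mem_image_of_mem (fun n => ⌊|a (N + 1) - a n|⌋₊)
        (Finset.mem_Icc.2 ⟨h1.1, hm⟩)
    · exact Or.inl (Finset.mem_image.2 ⟨(m, n), Finset.mem_offDiag.2
        ⟨Finset.mem_Icc.2 ⟨h1.1, hm⟩, Finset.mem_Icc.2 ⟨h2.1, hn⟩, h3⟩, rfl⟩)
  refine (Finset.card_le_card hsub).trans ((Finset.card_union_le _ _).trans ?_)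
  refine Nat.add_le_add_left (Finset.card_image_le.trans ?_) _
  rw [Nat.card_Icc, Nat.add_sub_cancel]

lemma pos_of_mem_floorDiffs {a : ℕ → ℝ}
    (hsep : ∀ m n, 1 ≤ m → 1 ≤ n → m ≠ n → 1 ≤ |a m - a n|) {N q : ℕ}
    (hq : q ∈ floorDiffs a N) : 0 < q := by
  obtain ⟨m, n, h1, -, h3, -, h5, h6⟩ := mem_floorDiffs.1 hq
  have : (1 : ℤ) ≤ q := by
    rw [h6, Int.le_floor, Int.cast_one]
    exact hsep m n h1 h3 h5
  omega

lemma le_card_floorDiffs {a : ℕ → ℝ} (hmono : ∀ m n, 1 ≤ m → m < n → a m < a n)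
    (hsep : ∀ m n, 1 ≤ m → 1 ≤ n → m ≠ n → 1 ≤ |a m - a n|) (N : ℕ) :
    N ≤ (floorDiffs a N).card + 1 := by
  have hlt : ∀ m n, 1 ≤ m → m < n → ⌊|a m - a 1|⌋₊ < ⌊|a n - a 1|⌋₊ := by
    intro m n hm hmn
    have h1 := hsep n m (by omega) hm (by omega)
    rw [abs_of_pos (sub_pos.2 (hmono m n hm hmn))] at h1
    have h2 : a 1 ≤ a m := by
      rcases hm.eq_or_lt with rfl | h
      · exact le_rfl
      · exact (hmono 1 m le_rfl h).le
    rw [abs_of_nonneg (by linarith), abs_of_nonneg (by linarith), ← Nat.succ_le_iff]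
    refine Nat.le_floor ?_
    rw [Nat.succ_eq_add_one, Nat.cast_add, Nat.cast_one]
    linarith [Nat.floor_le (sub_nonneg.2 h2)]
  have h1 : (Finset.Icc 2 N).card ≤ (floorDiffs a N).card := by
    refine Finset.card_le_card_of_injOn (fun n => ⌊|a n - a 1|⌋₊) (fun n hn => ?_) ?_
    · obtain ⟨h2, h3⟩ := Finset.mem_Icc.1 (Finset.mem_coe.1 hn)
      refine Finset.mem_coe.2 (Finset.mem_image.2 ⟨(n, 1), Finset.mem_offDiag.2
        ⟨Finset.mem_Icc.2 ⟨by omega, h3⟩, Finset.mem_Icc.2 ⟨le_rfl, by omega⟩, ?_⟩, rfl⟩)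
      simp only
      omega
    · intro m hm n hn h
      have hm2 := (Finset.mem_Icc.1 (Finset.mem_coe.1 hm)).1
      have hn2 := (Finset.mem_Icc.1 (Finset.mem_coe.1 hn)).1
      simp only at h
      rcases lt_trichotomy m n with h1 | h1 | h1
      · exact absurd h (hlt m n (by omega) h1).ne
      · exact h1
      · exact absurd h (hlt n m (by omega) h1).ne'
  rw [Nat.card_Icc] at h1
  omega

/-- The least number of terms of `a` whose floored differences contain `q`; it is `0` when no
number of terms suffices. -/
noncomputable def firstIndex (a : ℕ → ℝ) (q : ℕ) : ℕ := sInf {N | q ∈ floorDiffs a N}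

lemma mem_floorDiffs_firstIndex {a : ℕ → ℝ} {q : ℕ} (h : 0 < firstIndex a q) :
    q ∈ floorDiffs a (firstIndex a q) :=
  Nat.sInf_mem (Nat.nonempty_of_pos_sInf h)

lemma lt_firstIndex {a : ℕ → ℝ} {N q : ℕ} (hq : 0 < firstIndex a q) (h : q ∉ floorDiffs a N) :
    N < firstIndex a q := by
  by_contra! hN
  exact h (floorDiffs_mono a hN (mem_floorDiffs_firstIndex hq))

lemma firstIndex_eq_succ {a : ℕ → ℝ} {N q : ℕ} (h1 : q ∈ floorDiffs a (N + 1))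
    (h : q ∉ floorDiffs a N) : firstIndex a q = N + 1 := by
  refine le_antisymm (Nat.sInf_le h1) (le_csInf ⟨_, h1⟩ fun M hM => ?_)
  by_contra! hN
  exact h (floorDiffs_mono a (Nat.le_of_lt_succ hN) hM)

/-- The size `c / (H_N log (N/4) log₂ (N/4))` of the approximation sets attached to the first `N`
terms. -/
noncomputable def weight (a : ℕ → ℝ) (c : ℝ) (N : ℕ) : ℝ :=
  c / ((floorDiffs a N).card * Log ((N : ℝ) / 4) * Log2 ((N : ℝ) / 4))

lemma weight_nonneg (a : ℕ → ℝ) {c : ℝ} (hc : 0 ≤ c) (N : ℕ) : 0 ≤ weight a c N :=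
  div_nonneg hc (mul_nonneg (mul_nonneg (Nat.cast_nonneg _) (Log_pos _).le) (Log2_pos _).le)

/-- The weight of `q` at its first index, if that exceeds `N₀`. -/
noncomputable def firstWeight (a : ℕ → ℝ) (c : ℝ) (N₀ q : ℕ) : ℝ :=
  if N₀ < firstIndex a q then weight a c (firstIndex a q) else 0

lemma firstWeight_nonneg (a : ℕ → ℝ) {c : ℝ} (hc : 0 ≤ c) (N₀ q : ℕ) :
    0 ≤ firstWeight a c N₀ q := by
  rw [firstWeight]
  split_ifs
  exacts [weight_nonneg a hc _, le_rfl]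

lemma le_weight_succ {a : ℕ → ℝ} (hmono : ∀ m n, 1 ≤ m → m < n → a m < a n)
    (hsep : ∀ m n, 1 ≤ m → 1 ≤ n → m ≠ n → 1 ≤ |a m - a n|) {c : ℝ} (hc : 0 ≤ c) {N j : ℕ}
    (hj : j ∈ Finset.Ioc (floorDiffs a N).card (floorDiffs a (N + 1)).card) :
    c / 2 * ((j : ℝ) * (Log j * Log2 j))⁻¹ ≤ weight a c (N + 1) := by
  obtain ⟨h1, h2⟩ := Finset.mem_Ioc.1 hj
  have h3 := le_card_floorDiffs hmono hsep N
  have h4 := card_floorDiffs_succ_le a N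
  have hj1 : (1 : ℝ) ≤ j := by exact_mod_cast (by omega : 1 ≤ j)
  have hN : ((N + 1 : ℕ) : ℝ) ≤ j + 1 := by exact_mod_cast (by omega : N + 1 ≤ j + 1)
  have hcard : ((floorDiffs a (N + 1)).card : ℝ) ≤ 2 * j := by
    exact_mod_cast (by omega : (floorDiffs a (N + 1)).card ≤ 2 * j)
  have hcard0 : (0 : ℝ) < (floorDiffs a (N + 1)).card := by
    exact_mod_cast (by omega : 0 < (floorDiffs a (N + 1)).card)
  have hN0 : (0 : ℝ) < ((N + 1 : ℕ) : ℝ) / 4 := by positivity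
  have hle : ((N + 1 : ℕ) : ℝ) / 4 ≤ j := by linarith
  have := Log_pos (((N + 1 : ℕ) : ℝ) / 4)
  have := Log2_pos (((N + 1 : ℕ) : ℝ) / 4)
  have := Log_pos j
  calc c / 2 * ((j : ℝ) * (Log j * Log2 j))⁻¹ = c / (2 * j * Log j * Log2 j) := by
        rw [div_mul_eq_mul_div, ← div_eq_mul_inv, div_div]
        ring_nf
    _ ≤ weight a c (N + 1) := div_le_div_of_nonneg_left hc (by positivity)
        (mul_le_mul (mul_le_mul hcard (Log_mono hN0 hle) (by positivity) (by positivity))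
          (Log2_mono hN0 hle) (by positivity) (by positivity))

lemma sum_Ioc_card_le {a : ℕ → ℝ} (hmono : ∀ m n, 1 ≤ m → m < n → a m < a n)
    (hsep : ∀ m n, 1 ≤ m → 1 ≤ n → m ≠ n → 1 ≤ |a m - a n|) {c : ℝ} (hc : 0 ≤ c) {N₀ N : ℕ}
    (hN : N₀ ≤ N) :
    ∑ j ∈ Finset.Ioc (floorDiffs a N₀).card (floorDiffs a N).card,
      c / 2 * ((j : ℝ) * (Log j * Log2 j))⁻¹ ≤
      ∑ q ∈ floorDiffs a N \ floorDiffs a N₀, firstWeight a c N₀ q := by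
  induction N, hN using Nat.le_induction with
  | base => simp
  | succ N hN ih =>
    have hsub := floorDiffs_mono a N.le_succ
    have hstep : ∑ j ∈ Finset.Ioc (floorDiffs a N).card (floorDiffs a (N + 1)).card,
        c / 2 * ((j : ℝ) * (Log j * Log2 j))⁻¹ ≤
        ∑ q ∈ floorDiffs a (N + 1) \ floorDiffs a N, firstWeight a c N₀ q := by
      have heq : ∀ q ∈ floorDiffs a (N + 1) \ floorDiffs a N,
          firstWeight a c N₀ q = weight a c (N + 1) := by
        intro q hq
        obtain ⟨h1, h2⟩ := Finset.mem_sdiff.1 hq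
        rw [firstWeight, firstIndex_eq_succ h1 h2, if_pos (Nat.lt_succ_of_le hN)]
      rw [Finset.sum_congr rfl heq, Finset.sum_const, Finset.card_sdiff_of_subset hsub,
        ← Nat.card_Ioc, ← Finset.sum_const]
      exact Finset.sum_le_sum fun j hj => le_weight_succ hmono hsep hc hj
    have hunion : floorDiffs a (N + 1) \ floorDiffs a N₀ =
        (floorDiffs a N \ floorDiffs a N₀) ∪ (floorDiffs a (N + 1) \ floorDiffs a N) := by
      have := floorDiffs_mono a hN
      ext q
      have h1 : q ∈ floorDiffs a N → q ∈ floorDiffs a (N + 1) := fun h => hsub h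
      have h2 : q ∈ floorDiffs a N₀ → q ∈ floorDiffs a N := fun h => this h
      simp only [Finset.mem_union, Finset.mem_sdiff]
      tauto
    rw [hunion, Finset.sum_union (Finset.disjoint_sdiff.mono_left Finset.sdiff_subset),
      ← Finset.Ioc_union_Ioc_eq_Ioc (Finset.card_le_card (floorDiffs_mono a hN))
        (Finset.card_le_card hsub),
      Finset.sum_union (Finset.Ioc_disjoint_Ioc_of_le le_rfl)]
    exact add_le_add ih hstep

lemma not_summable_firstWeight {a : ℕ → ℝ} (hmono : ∀ m n, 1 ≤ m → m < n → a m < a n)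
    (hsep : ∀ m n, 1 ≤ m → 1 ≤ n → m ≠ n → 1 ≤ |a m - a n|) {c : ℝ} (hc : 0 < c) (N₀ : ℕ) :
    ¬ Summable (firstWeight a c N₀) := by
  intro h
  refine not_summable_inv_mul_Log_mul_Log2 ((summable_mul_left_iff (half_pos hc).ne').1 ?_)
  have hnn : ∀ j : ℕ, 0 ≤ c / 2 * ((j : ℝ) * (Log j * Log2 j))⁻¹ := fun j =>
    mul_nonneg (half_pos hc).le (inv_nonneg.2 (mul_nonneg (Nat.cast_nonneg j)
      (mul_pos (Log_pos _) (Log2_pos _)).le))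
  refine summable_of_sum_range_le (c := ∑ j ∈ Finset.range ((floorDiffs a N₀).card + 1),
    c / 2 * ((j : ℝ) * (Log j * Log2 j))⁻¹ + ∑' q, firstWeight a c N₀ q) hnn fun n => ?_
  have hN := le_card_floorDiffs hmono hsep (max N₀ (n + 1))
  have hn := le_max_right N₀ (n + 1)
  calc ∑ j ∈ Finset.range n, c / 2 * ((j : ℝ) * (Log j * Log2 j))⁻¹
      ≤ ∑ j ∈ Finset.range ((floorDiffs a N₀).card + 1) ∪
          Finset.Ioc (floorDiffs a N₀).card (floorDiffs a (max N₀ (n + 1))).card,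
          c / 2 * ((j : ℝ) * (Log j * Log2 j))⁻¹ := by
        refine Finset.sum_le_sum_of_subset_of_nonneg (fun j hj => ?_) fun j _ _ => hnn j
        rw [Finset.mem_range] at hj
        rw [Finset.mem_union, Finset.mem_range, Finset.mem_Ioc]
        omega
    _ = _ := Finset.sum_union <| Finset.disjoint_left.2 fun j hj hj' => by
        rw [Finset.mem_range] at hj
        rw [Finset.mem_Ioc] at hj'
        omega
    _ ≤ _ := by
        gcongr
        exact (sum_Ioc_card_le hmono hsep hc.le (le_max_left _ _)).trans
          (h.sum_le_tsum _ fun q _ => firstWeight_nonneg a hc.le N₀ q)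

/-- The bound of the main theorem. -/
noncomputable def deltaBound (a : ℕ → ℝ) (N : ℕ) : ℝ :=
  3 * Log2 ((sSup {k : ℤ | ∃ m n : ℕ, 1 ≤ m ∧ m ≤ N ∧ 1 ≤ n ∧ n ≤ N ∧ m ≠ n ∧
    k = ⌊|a m - a n|⌋} : ℤ) : ℝ) /
    ((Hcard a N : ℝ) * Log ((N : ℝ) / 4) * Log2 ((N : ℝ) / 4))

lemma weight_div_totientRatio_le {a : ℕ → ℝ} {C : ℝ} (hC : 0 < C)
    (hCle : ∀ n : ℕ, 0 < n → (totientRatio n)⁻¹ ≤ C * Log2 n) {N q : ℕ} (hq0 : 0 < q)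
    (hq : q ∈ floorDiffs a N) : weight a (3 / C) N / totientRatio q ≤ deltaBound a N := by
  rw [weight, deltaBound, Hcard_eq_card_floorDiffs, div_right_comm]
  refine div_le_div_of_nonneg_right ?_ (mul_nonneg (mul_nonneg (Nat.cast_nonneg _)
    (Log_pos _).le) (Log2_pos _).le)
  calc 3 / C / totientRatio q = 3 / C * (totientRatio q)⁻¹ := div_eq_mul_inv _ _
    _ ≤ 3 / C * (C * Log2 q) := by
        gcongr
        exact hCle q hq0
    _ = 3 * Log2 q := by
        field_simp
    _ ≤ _ := by
        gcongr
        exact Log2_mono (by exact_mod_cast hq0) (le_sSup_floor hq)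

lemma floorDeltaMin_le_half {a : ℕ → ℝ} (α : ℝ) {N : ℕ} (hN : 2 ≤ N) :
    floorDeltaMin a α N ≤ 1 / 2 :=
  (floorDeltaMin_le α (mem_floorDiffs.2 ⟨1, 2, le_rfl, by omega, by omega, hN, by omega,
    Int.natCast_floor_eq_floor (abs_nonneg _)⟩)).trans (abs_sub_round _)

lemma ae_frequently_floorDeltaMin_le {a : ℕ → ℝ}
    (hmono : ∀ m n, 1 ≤ m → m < n → a m < a n)
    (hsep : ∀ m n, 1 ≤ m → 1 ≤ n → m ≠ n → 1 ≤ |a m - a n|) :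
    ∀ᵐ α ∂(volume.restrict (Set.Icc (0 : ℝ) 1)),
      ∃ᶠ N in atTop, floorDeltaMin a α N ≤ deltaBound a N := by
  by_cases hbig : ∃ᶠ N in atTop, 1 / 2 ≤ deltaBound a N
  · exact .of_forall fun α => (hbig.and_eventually (eventually_ge_atTop 2)).mono fun N hN =>
      (floorDeltaMin_le_half α hN.2).trans hN.1
  rw [not_frequently, eventually_atTop] at hbig
  obtain ⟨N₀, hN₀⟩ := hbig
  obtain ⟨C, hC, hCle⟩ := exists_inv_totientRatio_le
  have hc : 0 < 3 / C := by positivity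
  have hle : ∀ q, N₀ < firstIndex a q →
      firstWeight a (3 / C) N₀ q / totientRatio q ≤ deltaBound a (firstIndex a q) := by
    intro q hq
    have hmem := mem_floorDiffs_firstIndex (Nat.zero_lt_of_lt hq)
    rw [firstWeight, if_pos hq]
    exact weight_div_totientRatio_le hC hCle (pos_of_mem_floorDiffs hsep hmem) hmem
  have hhalf : ∀ q, firstWeight a (3 / C) N₀ q / totientRatio q ≤ 1 / 2 := by
    intro q
    by_cases hq : N₀ < firstIndex a q
    · exact (hle q hq).trans (not_le.1 (hN₀ _ hq.le)).le
    · rw [firstWeight, if_neg hq, zero_div]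
      norm_num
  filter_upwards [ae_infinite_nint_lt (firstWeight_nonneg a hc.le N₀) hhalf
    (not_summable_firstWeight hmono hsep hc N₀)] with α hα
  rw [frequently_atTop]
  intro M
  obtain ⟨q, ⟨-, hq⟩, hqM⟩ := hα.exists_notMem_finset (floorDiffs a M)
  have hidx : N₀ < firstIndex a q := by
    by_contra h
    rw [firstWeight, if_neg h, zero_div] at hq
    exact (nint_nonneg _).not_gt hq
  have hpos := Nat.zero_lt_of_lt hidx
  exact ⟨firstIndex a q, (lt_firstIndex hpos hqM).le,
    (floorDeltaMin_le α (mem_floorDiffs_firstIndex hpos)).trans (hq.le.trans (hle q hidx))⟩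

theorem stmt13 (a : ℕ → ℝ)
    (hpos : ∀ n, 1 ≤ n → 0 < a n)
    (hmono : ∀ m n, 1 ≤ m → m < n → a m < a n)
    (hsep : ∀ m n, 1 ≤ m → 1 ≤ n → m ≠ n → 1 ≤ |a m - a n|) :
    ∀ᵐ α ∂(volume.restrict (Set.Icc (0:ℝ) 1)),
      ∃ᶠ N in atTop,
        floorDeltaMin a α N ≤
          3 * Log2 ((sSup {k : ℤ | ∃ m n : ℕ, 1 ≤ m ∧ m ≤ N ∧ 1 ≤ n ∧ n ≤ N ∧
                m ≠ n ∧ k = ⌊|a m - a n|⌋} : ℤ) : ℝ) /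
            ((Hcard a N : ℝ) * Log ((N : ℝ) / 4) * Log2 ((N : ℝ) / 4)) :=
  ae_frequently_floorDeltaMin_le hmono hsep
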